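/- Lemma B.13 (main high-probability regret decomposition for linear bandits): If η ≤ 1/(64000·C·d²·ln(νT)·ln(C/δ)), then Algorithm 2 guarantees that with probability at least 1 − δ, Σ_{t=1}^T ⟨w̃_t − u*, ℓ_t⟩ ≤ Õ(ν/η + η d² L̄_T + √(L̄_u·ln(1/δ))) + (√ν + ρ)·(161·C·d·√(ln(C/δ)·L̊_T) − 1/(1000·η·d·ln(νT))), where C = Θ(ln²(dνT)). -/

import Mathlib

open MeasureTheory Real Finset Matrix

/-! Common notions for the linear-bandit setting (self-concordant barriers,
the lifted normal barrier, quadratic norms, Bregman divergences, Minkowsky functions). -/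

/-- Euclidean dot product on `ℝ^n`. -/
noncomputable def dotp {n : ℕ} (x y : Fin n → ℝ) : ℝ := ∑ i, x i * y i

/-- Quadratic norm `‖h‖_M = √(hᵀ M h)`. -/
noncomputable def qnorm {n : ℕ} (M : Matrix (Fin n) (Fin n) ℝ) (h : Fin n → ℝ) : ℝ :=
  Real.sqrt (dotp h (M.mulVec h))

/-- First directional derivative `Df(x)[h]`. -/
noncomputable def der1 {n : ℕ} (f : (Fin n → ℝ) → ℝ) (x h : Fin n → ℝ) : ℝ :=
  fderiv ℝ f x h

/-- Second directional derivative `D²f(x)[h₁,h₂]`. -/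
noncomputable def der2 {n : ℕ} (f : (Fin n → ℝ) → ℝ) (x h₁ h₂ : Fin n → ℝ) : ℝ :=
  iteratedFDeriv ℝ 2 f x ![h₁, h₂]

/-- Third directional derivative `D³f(x)[h,h,h]`. -/
noncomputable def der3 {n : ℕ} (f : (Fin n → ℝ) → ℝ) (x h : Fin n → ℝ) : ℝ :=
  iteratedFDeriv ℝ 3 f x ![h, h, h]

/-- Hessian matrix `∇²f(x)`. -/
noncomputable def hess {n : ℕ} (f : (Fin n → ℝ) → ℝ) (x : Fin n → ℝ) :
    Matrix (Fin n) (Fin n) ℝ :=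
  Matrix.of fun i j => der2 f x (Pi.single i 1) (Pi.single j 1)

/-- Gradient vector `∇f(x)`. -/
noncomputable def gradv {n : ℕ} (f : (Fin n → ℝ) → ℝ) (x : Fin n → ℝ) : Fin n → ℝ :=
  fun i => fderiv ℝ f x (Pi.single i 1)

/-- Bregman divergence `D_f(u,w) = f(u) − f(w) − ⟨∇f(w), u − w⟩`. -/
noncomputable def breg {n : ℕ} (f : (Fin n → ℝ) → ℝ) (u w : Fin n → ℝ) : ℝ :=
  f u - f w - dotp (gradv f w) (u - w)

/-- `ψ` is a `ν`-self-concordant barrier for `K`. -/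
structure IsSCB {n : ℕ} (K : Set (Fin n → ℝ)) (ψ : (Fin n → ℝ) → ℝ) (ν : ℝ) : Prop where
  smooth : ContDiffOn ℝ 3 ψ (interior K)
  convexOn : ConvexOn ℝ (interior K) ψ
  blowup : ∀ x ∈ frontier K, Filter.Tendsto ψ (nhdsWithin x (interior K)) Filter.atTop
  selfConc : ∀ w ∈ interior K, ∀ h, |der3 ψ w h| ≤ 2 * Real.sqrt (der2 ψ w h h) ^ 3
  gradBound : ∀ w ∈ interior K, ∀ h,
    |der1 ψ w h| ≤ Real.sqrt ν * Real.sqrt (der2 ψ w h h)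

/-- Lift `w ∈ ℝ^d` to `(w,1) ∈ ℝ^{d+1}`. -/
noncomputable def liftv {d : ℕ} (w : Fin d → ℝ) : Fin (d + 1) → ℝ := Fin.snoc w 1

/-- The lifted barrier `Ψ(w,b) = 400 (ψ(w/b) − 2ν ln b)`, an `800ν`-normal barrier on
the conic hull of `Ω⁺`. -/
noncomputable def liftedBarrier {d : ℕ} (ψ : (Fin d → ℝ) → ℝ) (ν : ℝ) :
    (Fin (d + 1) → ℝ) → ℝ :=
  fun x => 400 * (ψ (fun i => x i.castSucc / x (Fin.last d)) -
    2 * ν * Real.log (x (Fin.last d)))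

/-- Minkowsky function `π_w(u) = inf {s > 0 : w + (u − w)/s ∈ K}`. -/
noncomputable def mink {n : ℕ} (K : Set (Fin n → ℝ)) (w u : Fin n → ℝ) : ℝ :=
  sInf {s : ℝ | 0 < s ∧ w + s⁻¹ • (u - w) ∈ K}



/-! ### One-dimensional calculus -/

lemma aux_mono {f f' : ℝ → ℝ} {a : ℝ} (ha : 0 ≤ a)
    (hf : ∀ x ∈ Set.Icc 0 a, HasDerivAt f (f' x) x) (h : ∀ x ∈ Set.Icc 0 a, 0 ≤ f' x) :
    f 0 ≤ f a := by
  have hm : MonotoneOn f (Set.Icc 0 a) := by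
    apply monotoneOn_of_deriv_nonneg (convex_Icc 0 a)
    · exact fun x hx => (hf x hx).continuousAt.continuousWithinAt
    · intro x hx
      exact (hf x (interior_subset hx)).differentiableAt.differentiableWithinAt
    · intro x hx
      rw [(hf x (interior_subset hx)).deriv]
      exact h x (interior_subset hx)
  exact hm ⟨le_rfl, ha⟩ ⟨ha, le_rfl⟩ ha

lemma aux_sc {G G' : ℝ → ℝ} {a : ℝ} (ha : 0 ≤ a)
    (hG : ∀ x ∈ Set.Icc 0 a, HasDerivAt G (G' x) x) (h0 : ∀ x ∈ Set.Icc 0 a, 0 ≤ G x)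
    (h : ∀ x ∈ Set.Icc 0 a, |G' x| ≤ 2 * √(G x) ^ 3) {ε : ℝ} (hε : 0 < ε) :
    |(√(G a + ε))⁻¹ - (√(G 0 + ε))⁻¹| ≤ a := by
  have hpos : ∀ x ∈ Set.Icc 0 a, 0 < G x + ε := fun x hx => by linarith [h0 x hx]
  have hd : ∀ x ∈ Set.Icc 0 a, HasDerivAt (fun x => (√(G x + ε))⁻¹)
      (-(G' x / (2 * √(G x + ε))) / √(G x + ε) ^ 2) x := fun x hx =>
    (((hG x hx).add_const ε).sqrt (hpos x hx).ne').inv (Real.sqrt_pos.2 (hpos x hx)).ne'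
  have hb : ∀ x ∈ Set.Icc 0 a, |-(G' x / (2 * √(G x + ε))) / √(G x + ε) ^ 2| ≤ 1 := by
    intro x hx
    have hs := Real.sqrt_pos.2 (hpos x hx)
    have e : -(G' x / (2 * √(G x + ε))) / √(G x + ε) ^ 2 = -(G' x) / (2 * √(G x + ε) ^ 3) := by
      field_simp
    rw [e, abs_div, abs_neg, abs_of_pos (by positivity : 0 < 2 * √(G x + ε) ^ 3), div_le_one (by positivity)]
    refine (h x hx).trans ?_
    have : √(G x) ≤ √(G x + ε) := Real.sqrt_le_sqrt (by linarith)
    gcongr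
  rw [abs_le]
  constructor
  · have := aux_mono (f := fun x => (√(G x + ε))⁻¹ + x) ha
      (fun x hx => (hd x hx).add (hasDerivAt_id x))
      (fun x hx => by have := (abs_le.1 (hb x hx)).1; linarith)
    linarith
  · have := aux_mono (f := fun x => x - (√(G x + ε))⁻¹) ha
      (fun x hx => (hasDerivAt_id x).sub (hd x hx))
      (fun x hx => by have := (abs_le.1 (hb x hx)).2; linarith)
    linarith

lemma aux_lower {G G' : ℝ → ℝ} {a : ℝ} (ha : 0 ≤ a)
    (hG : ∀ x ∈ Set.Icc 0 a, HasDerivAt G (G' x) x) (h0 : ∀ x ∈ Set.Icc 0 a, 0 ≤ G x)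
    (h : ∀ x ∈ Set.Icc 0 a, |G' x| ≤ 2 * √(G x) ^ 3) :
    G 0 ≤ G a * (1 + √(G 0) * a) ^ 2 := by
  set r := √(G 0) with hr
  have hG0 : G 0 = r ^ 2 := (Real.sq_sqrt (h0 0 ⟨le_rfl, ha⟩)).symm
  have hGa := h0 a ⟨ha, le_rfl⟩
  rcases (Real.sqrt_nonneg (G 0)).eq_or_lt with h1 | h1
  · rw [← hr] at h1
    rw [hG0, ← h1]
    have : 0 ≤ (1 + 0 * a) ^ 2 := by positivity
    nlinarith [mul_nonneg hGa this]
  rw [← hr] at h1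
  have key : ∀ ε > 0, r ^ 2 ≤ (G a + ε) * (1 + r * a) ^ 2 := by
    intro ε hε
    have h2 := (abs_le.1 (aux_sc ha hG h0 h hε)).2
    have h3 : (√(G 0 + ε))⁻¹ ≤ r⁻¹ := by
      apply inv_anti₀ h1
      exact Real.sqrt_le_sqrt (by linarith)
    have h4 : (√(G a + ε))⁻¹ ≤ (1 + r * a) / r := by
      have : (1 + r * a) / r = r⁻¹ + a := by field_simp
      linarith
    have hs : 0 < √(G a + ε) := Real.sqrt_pos.2 (by linarith)
    rw [inv_le_iff_one_le_mul₀ hs, div_mul_eq_mul_div, le_div_iff₀ h1, one_mul] at h4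
    calc r ^ 2 ≤ ((1 + r * a) * √(G a + ε)) ^ 2 := by gcongr
      _ = (G a + ε) * (1 + r * a) ^ 2 := by
        rw [mul_pow, Real.sq_sqrt (by linarith)]; ring
  rw [hG0]
  have hp : 0 < (1 + r * a) ^ 2 := by positivity
  apply le_of_forall_pos_le_add
  intro ε hε
  have := key (ε / (1 + r * a) ^ 2) (by positivity)
  rw [add_mul, div_mul_cancel₀ _ hp.ne'] at this
  exact this

lemma aux_upper {G G' : ℝ → ℝ} {a : ℝ} (ha : 0 ≤ a)
    (hG : ∀ x ∈ Set.Icc 0 a, HasDerivAt G (G' x) x) (h0 : ∀ x ∈ Set.Icc 0 a, 0 ≤ G x)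
    (h : ∀ x ∈ Set.Icc 0 a, |G' x| ≤ 2 * √(G x) ^ 3) {ε : ℝ} (hε : 0 < ε)
    {q : ℝ} (hq : 0 < q) (hq1 : q ≤ (√(G 0 + ε))⁻¹ - a) :
    G a ≤ (q ^ 2)⁻¹ := by
  have h2 := (abs_le.1 (aux_sc ha hG h0 h hε)).1
  have hGa := h0 a ⟨ha, le_rfl⟩
  have hs : 0 < √(G a + ε) := Real.sqrt_pos.2 (by linarith)
  have h3 : q ≤ (√(G a + ε))⁻¹ := by linarith
  have h4 : √(G a + ε) ≤ q⁻¹ := by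
    rw [le_inv_comm₀ hs hq]; exact h3
  have h5 : (√(G a + ε)) ^ 2 ≤ (q⁻¹) ^ 2 := by gcongr
  rw [Real.sq_sqrt (by linarith), inv_pow] at h5
  linarith

/-- derivative growth -/
lemma aux_growth {f1 G G' : ℝ → ℝ} {a : ℝ} (ha : 0 ≤ a)
    (hf : ∀ x ∈ Set.Icc 0 a, HasDerivAt f1 (G x) x)
    (hG : ∀ x ∈ Set.Icc 0 a, HasDerivAt G (G' x) x) (h0 : ∀ x ∈ Set.Icc 0 a, 0 ≤ G x)
    (h : ∀ x ∈ Set.Icc 0 a, |G' x| ≤ 2 * √(G x) ^ 3) :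
    f1 0 + G 0 * a / (1 + √(G 0) * a) ≤ f1 a := by
  set r := √(G 0) with hr
  have hr0 : 0 ≤ r := Real.sqrt_nonneg _
  have hp : ∀ x ∈ Set.Icc 0 a, 0 < 1 + r * x := fun x hx => by
    have := mul_nonneg hr0 hx.1; linarith
  have := aux_mono (f := fun x => f1 x - G 0 * x / (1 + r * x)) ha
    (f' := fun x => G x - (G 0 * 1 * (1 + r * x) - G 0 * x * (r * 1)) / (1 + r * x) ^ 2)
    (fun x hx => (hf x hx).sub ((((hasDerivAt_id x).const_mul (G 0))).div
      (((hasDerivAt_id x).const_mul r).const_add 1) (hp x hx).ne')) (by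
    intro x hx
    have hl := aux_lower (a := x) hx.1 (fun y hy => hG y ⟨hy.1, hy.2.trans hx.2⟩)
      (fun y hy => h0 y ⟨hy.1, hy.2.trans hx.2⟩) (fun y hy => h y ⟨hy.1, hy.2.trans hx.2⟩)
    have hq := hp x hx
    rw [sub_nonneg, div_le_iff₀ (by positivity)]
    rw [← hr] at hl
    linarith)
  simp only [mul_zero, zero_div, sub_zero] at this
  linarith

lemma aux_breg {f f1 G G' : ℝ → ℝ}
    (hf0 : ∀ x ∈ Set.Icc 0 (1:ℝ), HasDerivAt f (f1 x) x)
    (hf : ∀ x ∈ Set.Icc 0 (1:ℝ), HasDerivAt f1 (G x) x)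
    (hG : ∀ x ∈ Set.Icc 0 (1:ℝ), HasDerivAt G (G' x) x) (h0 : ∀ x ∈ Set.Icc 0 (1:ℝ), 0 ≤ G x)
    (h : ∀ x ∈ Set.Icc 0 (1:ℝ), |G' x| ≤ 2 * √(G x) ^ 3) :
    G 0 / (2 * (1 + √(G 0))) ≤ f 1 - f 0 - f1 0 := by
  set r := √(G 0) with hr
  have hr0 : 0 ≤ r := Real.sqrt_nonneg _
  have hG0 := h0 0 (by simp)
  have := aux_mono (f := fun x => f x - f1 0 * x - G 0 / (2 * (1 + r)) * x ^ 2) zero_le_one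
    (f' := fun x => f1 x - f1 0 * 1 - G 0 / (2 * (1 + r)) * (2 * x))
    (fun x hx => ((hf0 x hx).sub ((hasDerivAt_id x).const_mul _)).sub
      (by simpa using ((hasDerivAt_pow 2 x).const_mul (G 0 / (2 * (1 + r)))))) (by
    intro x hx
    have hl := aux_growth (a := x) hx.1 (fun y hy => hf y ⟨hy.1, hy.2.trans hx.2⟩)
      (fun y hy => hG y ⟨hy.1, hy.2.trans hx.2⟩)
      (fun y hy => h0 y ⟨hy.1, hy.2.trans hx.2⟩) (fun y hy => h y ⟨hy.1, hy.2.trans hx.2⟩)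
    rw [← hr] at hl
    have h3 : G 0 / (2 * (1 + r)) * (2 * x) ≤ G 0 * x / (1 + r * x) := by
      have : G 0 / (2 * (1 + r)) * (2 * x) = G 0 * x / (1 + r) := by field_simp
      rw [this]
      have hx1 := hx.1
      have hx2 := hx.2
      have : r * x ≤ r * 1 := by gcongr
      gcongr
      linarith
    linarith)
  norm_num at this
  linarith

lemma aux_semibdd {f1 G : ℝ → ℝ} {a ν : ℝ} (ha : 0 ≤ a) (hν : 0 < ν)
    (hf : ∀ x ∈ Set.Icc 0 a, HasDerivAt f1 (G x) x) (h0 : ∀ x ∈ Set.Icc 0 a, 0 ≤ G x)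
    (h : ∀ x ∈ Set.Icc 0 a, |f1 x| ≤ √ν * √(G x)) : f1 0 * a ≤ ν := by
  by_cases hc : f1 0 ≤ 0
  · nlinarith
  push Not at hc
  have hpos : ∀ x ∈ Set.Icc 0 a, 0 < f1 x := by
    intro x hx
    have := aux_mono (a := x) hx.1 (fun y hy => hf y ⟨hy.1, hy.2.trans hx.2⟩)
      (fun y hy => h0 y ⟨hy.1, hy.2.trans hx.2⟩)
    linarith
  have hm := aux_mono (f := fun x => -(f1 x)⁻¹ - x / ν) ha
    (fun x hx => ((hf x hx).inv (hpos x hx).ne').neg.sub ((hasDerivAt_id x).div_const ν)) (by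
    intro x hx
    have h1 := h x hx
    have h2 := hpos x hx
    rw [abs_of_pos h2] at h1
    have h3 : f1 x ^ 2 ≤ ν * G x := by
      calc f1 x ^ 2 ≤ (√ν * √(G x)) ^ 2 := by gcongr
        _ = ν * G x := by rw [mul_pow, Real.sq_sqrt hν.le, Real.sq_sqrt (h0 x hx)]
    have : 1 / ν ≤ G x / f1 x ^ 2 := by
      rw [div_le_div_iff₀ hν (by positivity)]; linarith
    rw [neg_div, neg_neg]; linarith)
  simp only [zero_div, sub_zero] at hm
  have h3 := inv_pos.2 (hpos a ⟨ha, le_rfl⟩)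
  have h4 : a / ν ≤ (f1 0)⁻¹ := by linarith
  rw [div_le_iff₀ hν, inv_mul_eq_div, le_div_iff₀ hc] at h4
  linarith


/-! ### Directional derivatives along lines -/

lemma line_deriv {n : ℕ} {f : (Fin n → ℝ) → ℝ} {k : ℕ} {N : WithTop ℕ∞} {x h : Fin n → ℝ} {τ : ℝ}
    (hf : ContDiffAt ℝ N f (x + τ • h)) (hk : (k : WithTop ℕ∞) < N) :
    HasDerivAt (fun τ : ℝ => iteratedFDeriv ℝ k f (x + τ • h) (fun _ => h))
      (iteratedFDeriv ℝ (k + 1) f (x + τ • h) (fun _ => h)) τ := by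
  have h1 := (hf.differentiableAt_iteratedFDeriv hk).hasFDerivAt
  have h2 : HasDerivAt (fun τ : ℝ => x + τ • h) h τ := by
    simpa using ((hasDerivAt_id τ).smul_const h).const_add x
  have h3 := h1.comp_hasDerivAt τ h2
  have h4 := (ContinuousMultilinearMap.apply ℝ (fun _ : Fin k => (Fin n → ℝ)) ℝ
    (fun _ => h)).hasFDerivAt.comp_hasDerivAt τ h3
  rw [iteratedFDeriv_succ_apply_left]
  exact h4

lemma der1_eq {n : ℕ} (f : (Fin n → ℝ) → ℝ) (x h : Fin n → ℝ) :
    der1 f x h = iteratedFDeriv ℝ 1 f x (fun _ => h) := by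
  rw [iteratedFDeriv_one_apply]; rfl

lemma der2_eq {n : ℕ} (f : (Fin n → ℝ) → ℝ) (x h : Fin n → ℝ) :
    der2 f x h h = iteratedFDeriv ℝ 2 f x (fun _ => h) := by
  unfold der2; congr 1; ext i; fin_cases i <;> rfl

lemma der3_eq {n : ℕ} (f : (Fin n → ℝ) → ℝ) (x h : Fin n → ℝ) :
    der3 f x h = iteratedFDeriv ℝ 3 f x (fun _ => h) := by
  unfold der3; congr 1; ext i; fin_cases i <;> rfl

lemma der2_bilin {n : ℕ} (f : (Fin n → ℝ) → ℝ) (x a b : Fin n → ℝ) :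
    der2 f x a b = fderiv ℝ (fderiv ℝ f) x a b := by
  unfold der2; rw [iteratedFDeriv_two_apply]; rfl

lemma line0 {n : ℕ} {f : (Fin n → ℝ) → ℝ} {N : WithTop ℕ∞} {x h : Fin n → ℝ} {τ : ℝ}
    (hf : ContDiffAt ℝ N f (x + τ • h)) (hk : 0 < N) :
    HasDerivAt (fun τ : ℝ => f (x + τ • h)) (der1 f (x + τ • h) h) τ := by
  have := line_deriv (k := 0) hf (by exact_mod_cast hk)
  simpa only [der1_eq, iteratedFDeriv_zero_apply] using this

lemma line1 {n : ℕ} {f : (Fin n → ℝ) → ℝ} {N : WithTop ℕ∞} {x h : Fin n → ℝ} {τ : ℝ}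
    (hf : ContDiffAt ℝ N f (x + τ • h)) (hk : 1 < N) :
    HasDerivAt (fun τ : ℝ => der1 f (x + τ • h) h) (der2 f (x + τ • h) h h) τ := by
  have := line_deriv (k := 1) hf (by exact_mod_cast hk)
  simpa only [der1_eq, der2_eq] using this

lemma line2 {n : ℕ} {f : (Fin n → ℝ) → ℝ} {N : WithTop ℕ∞} {x h : Fin n → ℝ} {τ : ℝ}
    (hf : ContDiffAt ℝ N f (x + τ • h)) (hk : 2 < N) :
    HasDerivAt (fun τ : ℝ => der2 f (x + τ • h) h h) (der3 f (x + τ • h) h) τ := by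
  have := line_deriv (k := 2) hf (by exact_mod_cast hk)
  simpa only [der3_eq, der2_eq] using this

lemma der1_smul {n : ℕ} (f : (Fin n → ℝ) → ℝ) (x h : Fin n → ℝ) (c : ℝ) :
    der1 f x (c • h) = c * der1 f x h := by simp [der1]

lemma der2_smul {n : ℕ} (f : (Fin n → ℝ) → ℝ) (x h : Fin n → ℝ) (c : ℝ) :
    der2 f x (c • h) (c • h) = c ^ 2 * der2 f x h h := by
  simp [der2_bilin]; ring

lemma seg_int {n : ℕ} {K : Set (Fin n → ℝ)} (hK : Convex ℝ K) {w y : Fin n → ℝ}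
    (hw : w ∈ interior K) (hy : y ∈ K) {τ : ℝ} (h0 : 0 ≤ τ) (h1 : τ < 1) :
    w + τ • (y - w) ∈ interior K := by
  have := hK.combo_interior_self_mem_interior hw hy (a := 1 - τ) (b := τ) (by linarith) h0 (by ring)
  convert this using 1
  module

section barrier
variable {n : ℕ} {K : Set (Fin n → ℝ)} {ψ : (Fin n → ℝ) → ℝ} {ν : ℝ}

lemma IsSCB.cda (hψ : IsSCB K ψ ν) {x : Fin n → ℝ} (hx : x ∈ interior K) : ContDiffAt ℝ 3 ψ x :=
  hψ.smooth.contDiffAt (isOpen_interior.mem_nhds hx)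

lemma IsSCB.nonneg (hψ : IsSCB K ψ ν) {w : Fin n → ℝ} (hw : w ∈ interior K) (h : Fin n → ℝ) :
    0 ≤ der2 ψ w h h := by
  let A : ℝ →ᵃ[ℝ] (Fin n → ℝ) := AffineMap.lineMap w (w + h)
  have hA : ∀ τ, A τ = w + τ • h := fun τ => by
    simp [A, AffineMap.lineMap_apply, add_comm]
  have hc : Continuous (fun τ : ℝ => w + τ • h) := by fun_prop
  set U := A ⁻¹' interior K with hU
  have hUo : IsOpen U := by
    have : U = (fun τ : ℝ => w + τ • h) ⁻¹' interior K := by ext τ; simp [hU, hA]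
    rw [this]; exact isOpen_interior.preimage hc
  have hconv : ConvexOn ℝ U (fun τ : ℝ => ψ (w + τ • h)) := by
    have := hψ.convexOn.comp_affineMap A
    have e : ψ ∘ A = fun τ : ℝ => ψ (w + τ • h) := by ext τ; simp [hA]
    rwa [e] at this
  have hd : ∀ τ ∈ U, HasDerivAt (fun τ : ℝ => ψ (w + τ • h)) (der1 ψ (w + τ • h) h) τ := by
    intro τ hτ
    have hτ' : w + τ • h ∈ interior K := by rw [← hA]; exact hτ
    exact line0 (hψ.cda hτ') (by norm_num)
  have hm := hconv.monotoneOn_derivWithin (fun τ hτ => (hd τ hτ).differentiableAt.differentiableWithinAt)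
  have h0U : (0 : ℝ) ∈ U := by simp [hU, hA, hw]
  have hm' : MonotoneOn (fun τ : ℝ => der1 ψ (w + τ • h) h) U := by
    refine hm.congr ?_
    intro τ hτ
    rw [derivWithin_of_isOpen hUo hτ, (hd τ hτ).deriv]
  have hd2 : HasDerivAt (fun τ : ℝ => der1 ψ (w + τ • h) h) (der2 ψ (w + (0:ℝ) • h) h h) 0 :=
    line1 (hψ.cda (by simpa using hw)) (by norm_num)
  have := hm'.derivWithin_nonneg (x := 0)
  rw [derivWithin_of_isOpen hUo h0U, hd2.deriv] at this
  simpa using this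

lemma IsSCB.der2_add_le (hψ : IsSCB K ψ ν) {w : Fin n → ℝ} (hw : w ∈ interior K) (a b : Fin n → ℝ) :
    der2 ψ w (a + b) (a + b) ≤ 2 * der2 ψ w a a + 2 * der2 ψ w b b := by
  have := hψ.nonneg hw (a - b)
  simp only [der2_bilin, map_add, map_sub, _root_.add_apply,
    _root_.sub_apply] at *
  linarith

lemma IsSCB.l0 (hψ : IsSCB K ψ ν) {w h : Fin n → ℝ} {τ : ℝ} (hw : w + τ • h ∈ interior K) :
    HasDerivAt (fun τ : ℝ => ψ (w + τ • h)) (der1 ψ (w + τ • h) h) τ :=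
  line0 (hψ.cda hw) (by norm_num)
lemma IsSCB.l1 (hψ : IsSCB K ψ ν) {w h : Fin n → ℝ} {τ : ℝ} (hw : w + τ • h ∈ interior K) :
    HasDerivAt (fun τ : ℝ => der1 ψ (w + τ • h) h) (der2 ψ (w + τ • h) h h) τ :=
  line1 (hψ.cda hw) (by norm_num)
lemma IsSCB.l2 (hψ : IsSCB K ψ ν) {w h : Fin n → ℝ} {τ : ℝ} (hw : w + τ • h ∈ interior K) :
    HasDerivAt (fun τ : ℝ => der2 ψ (w + τ • h) h h) (der3 ψ (w + τ • h) h) τ :=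
  line2 (hψ.cda hw) (by norm_num)

/-- Dikin ellipsoid -/
lemma IsSCB.dikin (hψ : IsSCB K ψ ν) {w h : Fin n → ℝ}
    (hw : w ∈ interior K) (hr : der2 ψ w h h < 1) : w + h ∈ interior K := by
  by_contra hcon
  have hc : Continuous (fun τ : ℝ => w + τ • h) := by fun_prop
  set B := {τ : ℝ | 0 ≤ τ ∧ w + τ • h ∉ interior K} with hB
  have hBcl : IsClosed B :=
    isClosed_Ici.inter ((isOpen_interior.preimage hc).isClosed_compl)
  have h1B : (1 : ℝ) ∈ B := by simp [hB, hcon]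
  have hBb : BddBelow B := ⟨0, fun x hx => hx.1⟩
  set s := sInf B with hs
  have hsB : s ∈ B := hBcl.csInf_mem ⟨1, h1B⟩ hBb
  have hs1 : s ≤ 1 := csInf_le hBb h1B
  have hlt : ∀ τ, 0 ≤ τ → τ < s → w + τ • h ∈ interior K := by
    intro τ h0 h1
    by_contra h2
    exact absurd (csInf_le hBb (⟨h0, h2⟩ : τ ∈ B)) (not_le.2 h1)
  have hs0 : 0 < s := by
    rcases hsB.1.eq_or_lt with h | h
    · exfalso; have := hsB.2; rw [← h] at this; simp at this; exact this hw
    · exact h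
  have htend : Filter.Tendsto (fun τ : ℝ => w + τ • h) (nhdsWithin s (Set.Ico 0 s))
      (nhdsWithin (w + s • h) (interior K)) := by
    apply tendsto_nhdsWithin_of_tendsto_nhds_of_eventually_within
    · exact (hc.tendsto s).mono_left nhdsWithin_le_nhds
    · filter_upwards [self_mem_nhdsWithin] with τ hτ using hlt τ hτ.1 hτ.2
  have hne : (nhdsWithin s (Set.Ico 0 s)).NeBot := by
    rw [← mem_closure_iff_nhdsWithin_neBot, closure_Ico hs0.ne]
    exact ⟨hs0.le, le_rfl⟩
  have hfr : w + s • h ∈ frontier K := by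
    refine ⟨?_, hsB.2⟩
    refine closure_mono interior_subset ?_
    rw [mem_closure_iff_nhdsWithin_neBot]
    exact htend.neBot
  have hinf := (hψ.blowup _ hfr).comp htend
  set r2 := der2 ψ w h h with hr2
  have hr2n : 0 ≤ r2 := hψ.nonneg hw h
  obtain ⟨ε, hε, hε1⟩ : ∃ ε > 0, r2 + ε < 1 := ⟨(1 - r2) / 2, by linarith, by linarith⟩
  set q := (√(r2 + ε))⁻¹ - 1 with hq
  have hq0 : 0 < q := by
    have h1 : √(r2 + ε) < 1 := by rw [Real.sqrt_lt' one_pos]; simpa using hε1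
    have h2 : 0 < √(r2 + ε) := Real.sqrt_pos.2 (by linarith)
    have := (one_lt_inv₀ h2).2 h1
    linarith
  set M := (q ^ 2)⁻¹ with hM
  have hM0 : 0 < M := by positivity
  have hbd : ∀ τ ∈ Set.Ico 0 s, ψ (w + τ • h) ≤ ψ w + |der1 ψ w h| + M := by
    intro τ hτ
    have hin : ∀ x ∈ Set.Icc 0 τ, w + x • h ∈ interior K := fun x hx =>
      hlt x hx.1 (lt_of_le_of_lt hx.2 hτ.2)
    have hG : ∀ x ∈ Set.Icc 0 τ, der2 ψ (w + x • h) h h ≤ M := by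
      intro x hx
      have := aux_upper (G := fun τ : ℝ => der2 ψ (w + τ • h) h h) (a := x) hx.1
        (fun y hy => hψ.l2 (hin y ⟨hy.1, hy.2.trans hx.2⟩))
        (fun y hy => hψ.nonneg (hin y ⟨hy.1, hy.2.trans hx.2⟩) h)
        (fun y hy => hψ.selfConc _ (hin y ⟨hy.1, hy.2.trans hx.2⟩) h) hε hq0 (by
          simp only [zero_smul, add_zero]
          have : x ≤ 1 := by linarith [hx.2, hτ.2]
          rw [← hr2]; linarith)
      exact this
    have hf1 : ∀ x ∈ Set.Icc 0 τ, der1 ψ (w + x • h) h ≤ der1 ψ w h + M := by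
      intro x hx
      have := aux_mono (f := fun x : ℝ => M * x - der1 ψ (w + x • h) h) (a := x) hx.1
        (fun y hy => ((hasDerivAt_id y).const_mul M).sub (hψ.l1 (hin y ⟨hy.1, hy.2.trans hx.2⟩)))
        (fun y hy => by have := hG y ⟨hy.1, hy.2.trans hx.2⟩; simp; linarith)
      simp at this
      have hx1 : M * x ≤ M * 1 := by gcongr; linarith [hx.2, hτ.2]
      linarith
    have := aux_mono (f := fun x : ℝ => (|der1 ψ w h| + M) * x - ψ (w + x • h)) (a := τ) hτ.1
        (fun y hy => ((hasDerivAt_id y).const_mul (|der1 ψ w h| + M)).sub (hψ.l0 (hin y hy)))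
        (fun y hy => by have := hf1 y hy; have := le_abs_self (der1 ψ w h); simp; linarith)
    simp at this
    have hx1 : (|der1 ψ w h| + M) * τ ≤ (|der1 ψ w h| + M) * 1 := by
      gcongr; linarith [hτ.2]
    linarith
  have h1 := hinf.eventually_gt_atTop (ψ w + |der1 ψ w h| + M)
  have h2 : ∀ᶠ τ in nhdsWithin s (Set.Ico 0 s), τ ∈ Set.Ico 0 s := self_mem_nhdsWithin
  obtain ⟨τ, h3, h4⟩ := (h1.and h2).exists
  have := hbd τ h4
  simp only [Function.comp] at h3
  linarith

lemma IsSCB.semibdd (hψ : IsSCB K ψ ν) (hK : Convex ℝ K) (hν : 0 < ν) {w y : Fin n → ℝ}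
    (hw : w ∈ interior K) (hy : y ∈ K) : der1 ψ w (y - w) ≤ ν := by
  have key : ∀ a : ℝ, 0 ≤ a → a < 1 → der1 ψ w (y - w) * a ≤ ν := by
    intro a h0 h1
    have hin : ∀ x ∈ Set.Icc 0 a, w + x • (y - w) ∈ interior K := fun x hx =>
      seg_int hK hw hy hx.1 (lt_of_le_of_lt hx.2 h1)
    have := aux_semibdd (f1 := fun τ : ℝ => der1 ψ (w + τ • (y - w)) (y - w)) h0 hν
      (fun x hx => hψ.l1 (hin x hx)) (fun x hx => hψ.nonneg (hin x hx) _)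
      (fun x hx => hψ.gradBound _ (hin x hx) _)
    simpa using this
  by_contra hc
  push Not at hc
  set A := der1 ψ w (y - w)
  have hA : 0 < A := by linarith
  have := key ((ν / A + 1) / 2) (by positivity) (by
    have : ν / A < 1 := by rwa [div_lt_one hA]
    linarith)
  have e : A * ((ν / A + 1) / 2) = (ν + A) / 2 := by field_simp
  linarith

lemma IsSCB.rbound (hψ : IsSCB K ψ ν) (hK : Convex ℝ K) (hν : 1 ≤ ν) {w y : Fin n → ℝ}
    (hw : w ∈ interior K) (hy : y ∈ K) :
    √(der2 ψ w (y - w) (y - w)) ≤ 2 * ν - der1 ψ w (y - w) + 2 := by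
  set g := y - w with hg
  have hin : ∀ x ∈ Set.Icc (0:ℝ) (1/2), w + x • g ∈ interior K := fun x hx =>
      seg_int hK hw hy hx.1 (by linarith [hx.2])
  have h1 := aux_growth (f1 := fun τ : ℝ => der1 ψ (w + τ • g) g) (a := 1 / 2) (by norm_num)
    (fun x hx => hψ.l1 (hin x hx)) (fun x hx => hψ.l2 (hin x hx)) (fun x hx => hψ.nonneg (hin x hx) _)
    (fun x hx => hψ.selfConc _ (hin x hx) _)
  have h2 := hψ.semibdd hK (by linarith) (hin (1/2) (by norm_num)) hy
  have e : y - (w + (1 / 2 : ℝ) • g) = (1 / 2 : ℝ) • g := by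
    rw [hg]; module
  rw [e, der1_smul] at h2
  have h3 := hψ.semibdd hK (by linarith) hw hy
  rw [← hg] at h3
  simp only [zero_smul, add_zero] at h1
  have hn := hψ.nonneg hw g
  set r := √(der2 ψ w g g) with hr
  have hr0 : 0 ≤ r := Real.sqrt_nonneg _
  have hrr : der2 ψ w g g = r ^ 2 := (Real.sq_sqrt hn).symm
  rw [hrr] at h1
  set m := 2 * ν - der1 ψ w g
  have h4 : r ^ 2 * (1 / 2) / (1 + r * (1 / 2)) ≤ m := by
    simp only [m]; linarith
  have h5 : r ^ 2 * (1 / 2) ≤ m * (1 + r * (1 / 2)) := by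
    rwa [div_le_iff₀ (by positivity)] at h4
  have hm : 1 ≤ m := by simp only [m]; linarith
  by_contra hc
  push Not at hc
  nlinarith

lemma IsSCB.breg_lower (hψ : IsSCB K ψ ν) (hK : Convex ℝ K) {w y : Fin n → ℝ}
    (hw : w ∈ interior K) (hy : y ∈ interior K) :
    der2 ψ w (y - w) (y - w) / (2 * (1 + √(der2 ψ w (y - w) (y - w)))) ≤
      ψ y - ψ w - der1 ψ w (y - w) := by
  have hin : ∀ x ∈ Set.Icc (0:ℝ) 1, w + x • (y - w) ∈ interior K := fun x hx => by
    have := hK.interior hw hy (a := 1 - x) (b := x) (by linarith [hx.2]) hx.1 (by ring)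
    convert this using 1
    module
  have := aux_breg (f := fun τ : ℝ => ψ (w + τ • (y - w)))
    (fun x hx => hψ.l0 (hin x hx)) (fun x hx => hψ.l1 (hin x hx)) (fun x hx => hψ.l2 (hin x hx))
    (fun x hx => hψ.nonneg (hin x hx) _) (fun x hx => hψ.selfConc _ (hin x hx) _)
  simpa using this

lemma IsSCB.growth (hψ : IsSCB K ψ ν) (hK : Convex ℝ K) (hν : 0 < ν) {w y : Fin n → ℝ}
    (hw : w ∈ interior K) (hy : y ∈ K) {s : ℝ} (h0 : 0 ≤ s) (h1 : s < 1) :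
    ψ (w + s • (y - w)) ≤ ψ w - ν * Real.log (1 - s) := by
  have hin : ∀ x ∈ Set.Icc (0:ℝ) s, w + x • (y - w) ∈ interior K := fun x hx =>
      seg_int hK hw hy hx.1 (by linarith [hx.2])
  have := aux_mono (f := fun x : ℝ => - ν * Real.log (1 - x) - ψ (w + x • (y - w))) h0
    (fun x hx => ((((hasDerivAt_id x).const_sub 1).log (by
      simp only [id]; linarith [hx.2])).const_mul (-ν)).sub (hψ.l0 (hin x hx))) (by
    intro x hx
    have h2 := hψ.semibdd hK hν (hin x hx) hy
    have e : y - (w + x • (y - w)) = (1 - x) • (y - w) := by module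
    rw [e, der1_smul] at h2
    have hp : 0 < 1 - x := by linarith [hx.2]
    simp only [id]
    rw [sub_nonneg, neg_mul, mul_div_assoc', ← neg_div, le_div_iff₀ hp]
    linarith)
  simp at this
  linarith

lemma IsSCB.hess_cmp (hψ : IsSCB K ψ ν) (hK : Convex ℝ K) (hν : 1 ≤ ν)
    {w1 y w : Fin n → ℝ} (hw1 : w1 ∈ interior K) (hy : y ∈ K) {s T : ℝ} (hT : 0 < T) (h0 : 0 ≤ s)
    (h1 : s ≤ 1 - 1 / T) (hw : w = w1 + s • (y - w1)) (h : Fin n → ℝ) :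
    der2 ψ w h h ≤ (4 * ν * T) ^ 2 * der2 ψ w1 h h := by
  have hT' : 0 < 1 / T := by positivity
  have hwi : w ∈ interior K := by rw [hw]; exact seg_int hK hw1 hy h0 (by linarith)
  have key : ∀ g, der2 ψ w1 g g < 1 → 0 ≤ der1 ψ w g → der2 ψ w g g ≤ (4 * ν * T) ^ 2 := by
    intro g hg hg1
    have h2 := interior_subset (hψ.dikin hw1 hg)
    have h3 : w + (1 / T) • g ∈ K := by
      have h4 : w1 + ((1 / T) / (1 - s)) • g ∈ K := by
        have hle : (1 / T) / (1 - s) ≤ 1 := by rw [div_le_one (by linarith)]; linarith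
        have := hK (interior_subset hw1) h2 (a := 1 - (1 / T) / (1 - s)) (b := (1 / T) / (1 - s))
          (by linarith) (div_nonneg hT'.le (by linarith)) (by ring)
        convert this using 1
        module
      have := hK h4 hy (a := 1 - s) (b := s) (by linarith) h0 (by ring)
      convert this using 1
      rw [smul_add, smul_smul, mul_div_cancel₀ _ (by linarith : (1 - s) ≠ 0), hw]
      module
    have h5 := hψ.rbound hK hν hwi h3
    rw [add_sub_cancel_left, der2_smul, der1_smul, Real.sqrt_mul (by positivity),
      Real.sqrt_sq hT'.le] at h5
    have h6 : 0 ≤ 1 / T * der1 ψ w g := by positivity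
    have h7 : 1 / T * √(der2 ψ w g g) ≤ 4 * ν := by linarith
    rw [one_div, inv_mul_le_iff₀ hT] at h7
    have h8 : √(der2 ψ w g g) ^ 2 ≤ (T * (4 * ν)) ^ 2 := by gcongr
    rw [Real.sq_sqrt (hψ.nonneg hwi g)] at h8
    linarith
  have key2 : ∀ g, der2 ψ w1 g g < 1 → der2 ψ w g g ≤ (4 * ν * T) ^ 2 := by
    intro g hg
    by_cases hs : 0 ≤ der1 ψ w g
    · exact key g hg hs
    · have := key ((-1 : ℝ) • g) (by rw [der2_smul]; linarith) (by rw [der1_smul]; linarith)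
      rw [der2_smul] at this; linarith
  have hn := hψ.nonneg hw1 h
  apply le_of_forall_pos_le_add
  intro ε hε
  set P := (4 * ν * T) ^ 2 with hP
  have hP0 : 0 < P := by positivity
  have hc : 0 < der2 ψ w1 h h + ε / P := by positivity
  have := key2 ((√(der2 ψ w1 h h + ε / P))⁻¹ • h) (by
    rw [der2_smul, inv_pow, Real.sq_sqrt hc.le, inv_mul_lt_iff₀ hc]
    have : 0 < ε / P := by positivity
    linarith)
  rw [der2_smul, inv_pow, Real.sq_sqrt hc.le, inv_mul_le_iff₀ hc, add_mul,
    div_mul_cancel₀ _ hP0.ne'] at this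
  linarith

end barrier


/-! ### The lifted barrier -/

lemma lin_sum {n : ℕ} (L : (Fin n → ℝ) →L[ℝ] ℝ) (p : Fin n → ℝ) :
    L p = ∑ i, p i * L (Pi.single i 1) := by
  conv_lhs => rw [← Finset.univ_sum_single p]
  rw [map_sum]
  refine Finset.sum_congr rfl fun i _ => ?_
  have : (Pi.single i (p i) : Fin n → ℝ) = p i • Pi.single i 1 := by
    rw [← Pi.single_smul]; simp
  rw [this, map_smul, smul_eq_mul]

lemma dotp_gradv {n : ℕ} (f : (Fin n → ℝ) → ℝ) (x p : Fin n → ℝ) :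
    dotp (gradv f x) p = der1 f x p := by
  unfold dotp gradv der1
  rw [lin_sum]
  exact Finset.sum_congr rfl fun i _ => mul_comm _ _

lemma dotp_hess {n : ℕ} (f : (Fin n → ℝ) → ℝ) (x p : Fin n → ℝ) :
    dotp p ((hess f x).mulVec p) = der2 f x p p := by
  unfold dotp hess
  rw [der2_bilin]
  have h1 := lin_sum ((fderiv ℝ (fderiv ℝ f) x).flip p) p
  simp only [ContinuousLinearMap.flip_apply] at h1
  rw [h1]
  refine Finset.sum_congr rfl fun i _ => ?_
  rw [lin_sum]
  simp only [Matrix.mulVec, dotProduct, Matrix.of_apply, der2_bilin]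
  congr 1
  exact Finset.sum_congr rfl fun i _ => mul_comm _ _

lemma liftv_castSucc {d : ℕ} (w : Fin d → ℝ) (i : Fin d) : liftv w i.castSucc = w i := by
  simp [liftv]
lemma liftv_last {d : ℕ} (w : Fin d → ℝ) : liftv w (Fin.last d) = 1 := by
  simp [liftv]

noncomputable def lz {d : ℕ} (h : Fin d → ℝ) : Fin (d + 1) → ℝ := Fin.snoc h 0

lemma lz_castSucc {d : ℕ} (w : Fin d → ℝ) (i : Fin d) : lz w i.castSucc = w i := by
  simp [lz]
lemma lz_last {d : ℕ} (w : Fin d → ℝ) : lz w (Fin.last d) = 0 := by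
  simp [lz]

lemma liftv_sub {d : ℕ} (u w : Fin d → ℝ) : liftv u - liftv w = lz (u - w) := by
  ext i
  refine Fin.lastCases ?_ (fun i => ?_) i
  · simp [liftv_last, lz_last]
  · simp [liftv_castSucc, lz_castSucc]

lemma liftv_add_lz {d : ℕ} (u w : Fin d → ℝ) : liftv u + lz w = liftv (u + w) := by
  ext i
  refine Fin.lastCases ?_ (fun i => ?_) i
  · simp [liftv_last, lz_last]
  · simp [liftv_castSucc, lz_castSucc]

lemma lz_smul {d : ℕ} (c : ℝ) (w : Fin d → ℝ) : lz (c • w) = c • lz w := by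
  ext i
  refine Fin.lastCases ?_ (fun i => ?_) i
  · simp [lz_last]
  · simp [lz_castSucc]

lemma dotp_lz {d : ℕ} (x : Fin (d + 1) → ℝ) (l : Fin d → ℝ) :
    dotp x (lz l) = dotp (fun i => x i.castSucc) l := by
  simp [dotp, Fin.sum_univ_castSucc, lz_castSucc, lz_last]

lemma liftv_inj {d : ℕ} {u w : Fin d → ℝ} (h : liftv u = liftv w) : u = w := by
  ext i; rw [← liftv_castSucc u, h, liftv_castSucc]

lemma lifted_liftv {d : ℕ} (ψ : (Fin d → ℝ) → ℝ) (ν : ℝ) (w : Fin d → ℝ) :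
    liftedBarrier ψ ν (liftv w) = 400 * ψ w := by
  simp [liftedBarrier, liftv_castSucc, liftv_last]

def coneU {d : ℕ} (K : Set (Fin d → ℝ)) : Set (Fin (d + 1) → ℝ) :=
  {x | 0 < x (Fin.last d) ∧ (fun i => x (Fin.castSucc i) / x (Fin.last d)) ∈ interior K}

section lifted
variable {d : ℕ} {K : Set (Fin d → ℝ)} {ψ : (Fin d → ℝ) → ℝ} {ν : ℝ}

lemma liftv_mem_coneU {w : Fin d → ℝ} (hw : w ∈ interior K) : liftv w ∈ coneU K := by
  simpa [coneU, liftv_castSucc, liftv_last] using hw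

lemma coneU_open : IsOpen (coneU K) := by
  rw [isOpen_iff_mem_nhds]
  intro x hx
  have h1 : ∀ᶠ y in nhds x, 0 < y (Fin.last d) :=
    (continuous_apply (Fin.last d)).continuousAt.eventually_const_lt hx.1
  have h2 : ContinuousAt (fun y : Fin (d + 1) → ℝ => fun i : Fin d => y i.castSucc / y (Fin.last d)) x := by
    rw [continuousAt_pi]
    intro i
    exact (continuous_apply _).continuousAt.div (continuous_apply _).continuousAt hx.1.ne'
  filter_upwards [h1, h2.eventually_mem (isOpen_interior.mem_nhds hx.2)] with y h3 h4 using ⟨h3, h4⟩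

lemma IsSCB.lifted_cda (hψ : IsSCB K ψ ν) {x : Fin (d + 1) → ℝ} (hx : x ∈ coneU K) :
    ContDiffAt ℝ 3 (liftedBarrier ψ ν) x := by
  unfold liftedBarrier
  have h0 : ∀ j : Fin (d + 1), ContDiffAt ℝ 3 (fun y : Fin (d + 1) → ℝ => y j) x := fun j =>
    (contDiff_apply ℝ ℝ j).contDiffAt
  have h2 : ContDiffAt ℝ 3 (fun y : Fin (d + 1) → ℝ => fun i : Fin d => y i.castSucc / y (Fin.last d)) x := by
    rw [contDiffAt_pi]
    intro i
    exact (h0 _).div (h0 _) hx.1.ne'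
  have h3 := (hψ.cda hx.2).comp x h2
  exact contDiffAt_const.mul (h3.sub (contDiffAt_const.mul ((h0 _).log hx.1.ne')))

lemma lifted_line (w : Fin d → ℝ) (p : Fin (d + 1) → ℝ) {τ : ℝ}
    (hτ : 0 < 1 + τ * p (Fin.last d)) :
    (fun i : Fin d => (liftv w + τ • p) i.castSucc / (liftv w + τ • p) (Fin.last d)) =
      w + (τ / (1 + τ * p (Fin.last d))) • ((fun i => p i.castSucc) - p (Fin.last d) • w) := by
  ext i
  simp only [Pi.add_apply, Pi.smul_apply, liftv_castSucc, liftv_last, smul_eq_mul, Pi.sub_apply]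
  field_simp
  ring

lemma IsSCB.lifted_ders (hψ : IsSCB K ψ ν) {w : Fin d → ℝ} (hw : w ∈ interior K)
    (p : Fin (d + 1) → ℝ) (g : Fin d → ℝ)
    (hg : g = (fun i => p i.castSucc) - p (Fin.last d) • w) :
    der1 (liftedBarrier ψ ν) (liftv w) p = 400 * (der1 ψ w g - 2 * ν * p (Fin.last d)) ∧
    der2 (liftedBarrier ψ ν) (liftv w) p p = 400 * (der2 ψ w g g
      - 2 * p (Fin.last d) * der1 ψ w g + 2 * ν * p (Fin.last d) ^ 2) := by
  set s := p (Fin.last d) with hs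
  set Ψ := liftedBarrier ψ ν with hΨ
  have e1 : ∀ᶠ τ : ℝ in nhds 0, 0 < 1 + τ * s := by
    have : ContinuousAt (fun τ : ℝ => 1 + τ * s) 0 := by fun_prop
    exact this.eventually_const_lt (by simp)
  have e2 : ∀ᶠ τ : ℝ in nhds 0, w + (τ / (1 + τ * s)) • g ∈ interior K := by
    have : ContinuousAt (fun τ : ℝ => w + (τ / (1 + τ * s)) • g) 0 := by
      have h : ContinuousAt (fun τ : ℝ => τ / (1 + τ * s)) 0 :=
        ContinuousAt.div (by fun_prop) (by fun_prop) (by simp)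
      exact continuousAt_const.add (h.smul continuousAt_const)
    exact this.eventually_mem (isOpen_interior.mem_nhds (by simpa using hw))
  have e3 : ∀ τ : ℝ, 0 < 1 + τ * s → w + (τ / (1 + τ * s)) • g ∈ interior K →
      liftv w + τ • p ∈ coneU K := by
    intro τ h1 h2
    refine ⟨by simpa [liftv_last] using h1, ?_⟩
    rw [lifted_line w p h1, ← hg]; exact h2
  have e4 : ∀ τ : ℝ, 0 < 1 + τ * s → Ψ (liftv w + τ • p) =
      400 * (ψ (w + (τ / (1 + τ * s)) • g) - 2 * ν * Real.log (1 + τ * s)) := by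
    intro τ h1
    rw [hΨ, liftedBarrier, lifted_line w p h1, ← hg]
    simp [liftv_last, hs]
  have hθ : ∀ τ : ℝ, 0 < 1 + τ * s → HasDerivAt (fun τ : ℝ => τ / (1 + τ * s))
      (1 / (1 + τ * s) ^ 2) τ := by
    intro τ h1
    have h2 : HasDerivAt (fun τ : ℝ => 1 + τ * s) s τ := by
      simpa using ((hasDerivAt_id τ).mul_const s).const_add 1
    have := (hasDerivAt_id τ).div h2 h1.ne'
    refine this.congr_deriv ?_
    simp only [id]; congr 1; ring
  have hlin : ∀ τ : ℝ, HasDerivAt (fun τ : ℝ => 1 + τ * s) s τ := by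
    intro τ
    simpa using ((hasDerivAt_id τ).mul_const s).const_add 1
  have e5 : ∀ᶠ τ : ℝ in nhds 0, der1 Ψ (liftv w + τ • p) p =
      400 * (der1 ψ (w + (τ / (1 + τ * s)) • g) g * (1 / (1 + τ * s) ^ 2) - 2 * ν * (s / (1 + τ * s))) := by
    filter_upwards [e1.eventually_nhds, e2] with τ h1 h2
    have h1' := h1.self_of_nhds
    have a1 : HasDerivAt (fun τ : ℝ => Ψ (liftv w + τ • p)) (der1 Ψ (liftv w + τ • p) p) τ :=
      line0 (hψ.lifted_cda (e3 τ h1' h2)) (by norm_num)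
    have a2 : HasDerivAt (fun τ : ℝ => 400 * (ψ (w + (τ / (1 + τ * s)) • g) - 2 * ν * Real.log (1 + τ * s)))
        (400 * (der1 ψ (w + (τ / (1 + τ * s)) • g) g * (1 / (1 + τ * s) ^ 2) - 2 * ν * (s / (1 + τ * s)))) τ := by
      have b1 := (hψ.l0 h2).comp τ (hθ τ h1')
      have b2 := (hlin τ).log h1'.ne'
      exact (b1.sub (b2.const_mul (2 * ν))).const_mul 400
    have a3 : (fun τ : ℝ => Ψ (liftv w + τ • p)) =ᶠ[nhds τ]
      (fun τ : ℝ => 400 * (ψ (w + (τ / (1 + τ * s)) • g) - 2 * ν * Real.log (1 + τ * s))) := by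
      filter_upwards [h1] with τ h using e4 τ h
    exact (a1.unique (a2.congr_of_eventuallyEq a3))
  constructor
  · have := e5.self_of_nhds
    simpa using this
  · have a1 : HasDerivAt (fun τ : ℝ => der1 Ψ (liftv w + τ • p) p)
        (der2 Ψ (liftv w + (0:ℝ) • p) p p) 0 :=
      line1 (hψ.lifted_cda (by simpa using liftv_mem_coneU hw)) (by norm_num)
    have hp0 : (0:ℝ) < 1 + 0 * s := by simp
    have b1 := (hψ.l1 (w := w) (h := g) (τ := 0 / (1 + 0 * s)) (by simpa using hw)).comp 0 (hθ 0 hp0)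
    have b2 : HasDerivAt (fun τ : ℝ => 1 / (1 + τ * s) ^ 2) (-(2 * s)) 0 := by
      have := ((hlin 0).pow 2).inv (by simp)
      simp only [one_div]
      refine this.congr_deriv ?_
      simp
    have b3 : HasDerivAt (fun τ : ℝ => s / (1 + τ * s)) (-(s ^ 2)) 0 := by
      have := (hasDerivAt_const (0:ℝ) s).div (hlin 0) hp0.ne'
      refine this.congr_deriv ?_
      simp; ring
    have a2 := ((b1.mul b2).sub (b3.const_mul (2 * ν))).const_mul 400
    have a3 := a1.unique (a2.congr_of_eventuallyEq e5)
    simp at a3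
    rw [a3]; ring

lemma IsSCB.lifted_grad (hψ : IsSCB K ψ ν) {w : Fin d → ℝ} (hw : w ∈ interior K) (h : Fin d → ℝ) :
    der1 (liftedBarrier ψ ν) (liftv w) (lz h) = 400 * der1 ψ w h := by
  have := (hψ.lifted_ders hw (lz h) h (by ext i; simp [lz_castSucc, lz_last])).1
  simpa [lz_last] using this

lemma IsSCB.lifted_hess_lz (hψ : IsSCB K ψ ν) {w : Fin d → ℝ} (hw : w ∈ interior K) (h : Fin d → ℝ) :
    der2 (liftedBarrier ψ ν) (liftv w) (lz h) (lz h) = 400 * der2 ψ w h h := by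
  have := (hψ.lifted_ders hw (lz h) h (by ext i; simp [lz_castSucc, lz_last])).2
  simpa [lz_last] using this

lemma IsSCB.lifted_hess_liftv (hψ : IsSCB K ψ ν) {w : Fin d → ℝ} (hw : w ∈ interior K) (u : Fin d → ℝ) :
    der2 (liftedBarrier ψ ν) (liftv w) (liftv u) (liftv u) =
      400 * (der2 ψ w (u - w) (u - w) - 2 * der1 ψ w (u - w) + 2 * ν) := by
  have := (hψ.lifted_ders hw (liftv u) (u - w) (by ext i; simp [liftv_castSucc, liftv_last])).2
  simpa [liftv_last] using this

lemma IsSCB.breg_lift (hψ : IsSCB K ψ ν) {w : Fin d → ℝ} (hw : w ∈ interior K) (u : Fin d → ℝ) :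
    breg (liftedBarrier ψ ν) (liftv u) (liftv w) = 400 * (ψ u - ψ w - der1 ψ w (u - w)) := by
  rw [breg, dotp_gradv, liftv_sub, hψ.lifted_grad hw, lifted_liftv, lifted_liftv]; ring

/-- a positive definite Hessian forces an interior point -/
lemma IsSCB.int_of_hess (hψ : IsSCB K ψ ν) (hK : Convex ℝ K) (hne : (interior K).Nonempty)
    {w : Fin d → ℝ} (hw : w ∈ K) {p : Fin (d + 1) → ℝ}
    (hp : der2 (liftedBarrier ψ ν) (liftv w) p p ≠ 0) : w ∈ interior K := by
  by_contra hcon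
  set Ψ := liftedBarrier ψ ν with hΨ
  rw [der2_bilin] at hp
  have hd : DifferentiableAt ℝ (fderiv ℝ Ψ) (liftv w) := by
    by_contra h
    rw [fderiv_zero_of_not_differentiableAt h] at hp
    simp at hp
  obtain ⟨y, hy⟩ := hne
  have hin : ∀ τ : ℝ, 0 < τ → τ ≤ 1 → w + τ • (y - w) ∈ interior K := by
    intro τ h0 h1
    have := hK.combo_self_interior_mem_interior hw hy (a := 1 - τ) (b := τ) (by linarith) h0 (by ring)
    convert this using 1
    module
  have hc : Continuous (fun τ : ℝ => w + τ • (y - w)) := by fun_prop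
  have hc1 : Continuous (fun τ : ℝ => liftv (w + τ • (y - w))) := by
    have : (fun τ : ℝ => liftv (w + τ • (y - w))) = fun τ : ℝ => liftv w + τ • lz (y - w) := by
      ext1 τ; rw [← liftv_add_lz, lz_smul]
    rw [this]; fun_prop
  have hc2 : ContinuousAt (fun τ : ℝ => fderiv ℝ Ψ (liftv (w + τ • (y - w))) (lz (y - w))) 0 := by
    have h1 : ContinuousAt (fderiv ℝ Ψ) (liftv (w + (0:ℝ) • (y - w))) := by
      simpa using hd.continuousAt
    have h2 : ContinuousAt (fun τ : ℝ => fderiv ℝ Ψ (liftv (w + τ • (y - w)))) 0 :=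
      ContinuousAt.comp (f := fun τ : ℝ => liftv (w + τ • (y - w))) h1 hc1.continuousAt
    exact h2.clm_apply continuousAt_const
  set L := fderiv ℝ Ψ (liftv (w + (0:ℝ) • (y - w))) (lz (y - w)) with hL
  have hev := hc2.eventually (Ioi_mem_nhds (show L - 1 < L by linarith))
  obtain ⟨ε, hε, hball⟩ := Metric.eventually_nhds_iff.1 hev
  set t0 := min (ε / 2) 1 with ht0
  have ht0p : 0 < t0 := by positivity
  have ht01 : t0 ≤ 1 := min_le_right _ _
  have ht0e : t0 < ε := lt_of_le_of_lt (min_le_left _ _) (by linarith)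
  set M := |L| + 1
  have hbd : ∀ τ, 0 < τ → τ ≤ t0 → 400 * ψ (w + τ • (y - w)) ≤ 400 * ψ (w + t0 • (y - w)) + M := by
    intro τ h0 h1
    have hin' : ∀ x ∈ Set.Icc 0 (t0 - τ), (w + τ • (y - w)) + x • (y - w) = w + (τ + x) • (y - w) ∧
       w + (τ + x) • (y - w) ∈ interior K := by
      intro x hx
      refine ⟨by module, hin _ (by linarith [hx.1]) (by linarith [hx.2])⟩
    have := aux_mono (f := fun x : ℝ => 400 * ψ ((w + τ • (y - w)) + x • (y - w)) + M * x) (a := t0 - τ)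
      (by linarith)
      (fun x hx => ((hψ.l0 (by rw [(hin' x hx).1]; exact (hin' x hx).2)).const_mul 400).add
        ((hasDerivAt_id x).const_mul M)) (by
        intro x hx
        obtain ⟨q1, q2⟩ := hin' x hx
        rw [q1]
        have q3 := hψ.lifted_grad q2 (y - w)
        have q4 : L - 1 < fderiv ℝ Ψ (liftv (w + (τ + x) • (y - w))) (lz (y - w)) := by
          apply hball
          rw [Real.dist_eq, sub_zero, abs_of_pos (by linarith [hx.1])]
          linarith [hx.2]
        rw [← q3, der1]
        have := neg_abs_le L
        simp only [M]; linarith)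
    simp only [zero_smul, add_zero, mul_zero] at this
    rw [(hin' (t0 - τ) ⟨by linarith, le_rfl⟩).1, add_sub_cancel] at this
    have hM : M * (t0 - τ) ≤ M * 1 := by
      have : 0 ≤ M := by positivity
      gcongr; linarith
    linarith
  have hfr : w ∈ frontier K := ⟨subset_closure hw, hcon⟩
  have htend : Filter.Tendsto (fun τ : ℝ => w + τ • (y - w)) (nhdsWithin 0 (Set.Ioc 0 t0))
      (nhdsWithin w (interior K)) := by
    apply tendsto_nhdsWithin_of_tendsto_nhds_of_eventually_within
    · have := (hc.tendsto 0).mono_left (nhdsWithin_le_nhds (s := Set.Ioc 0 t0))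
      simpa using this
    · filter_upwards [self_mem_nhdsWithin] with τ hτ using hin τ hτ.1 (hτ.2.trans ht01)
  have hne : (nhdsWithin (0:ℝ) (Set.Ioc 0 t0)).NeBot := by
    rw [← mem_closure_iff_nhdsWithin_neBot, closure_Ioc ht0p.ne]
    exact ⟨le_rfl, ht0p.le⟩
  have hinf := (hψ.blowup _ hfr).comp htend
  have h1 := hinf.eventually_gt_atTop (ψ (w + t0 • (y - w)) + M / 400)
  have h2 : ∀ᶠ τ in nhdsWithin (0:ℝ) (Set.Ioc 0 t0), τ ∈ Set.Ioc 0 t0 := self_mem_nhdsWithin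
  obtain ⟨τ, h3, h4⟩ := (h1.and h2).exists
  have := hbd τ h4.1 h4.2
  simp only [Function.comp] at h3
  linarith

end lifted


/-! ### Linear algebra -/

lemma dotp_eq {n : ℕ} (x y : Fin n → ℝ) : dotp x y = x ⬝ᵥ y := rfl

lemma dotp_comm' {n : ℕ} (x y : Fin n → ℝ) : dotp x y = dotp y x := dotProduct_comm x y

lemma dotp_add_left {n : ℕ} (x y z : Fin n → ℝ) : dotp (x + y) z = dotp x z + dotp y z :=
  add_dotProduct x y z
lemma dotp_add_right {n : ℕ} (x y z : Fin n → ℝ) : dotp z (x + y) = dotp z x + dotp z y :=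
  dotProduct_add z x y
lemma dotp_sub_left {n : ℕ} (x y z : Fin n → ℝ) : dotp (x - y) z = dotp x z - dotp y z :=
  sub_dotProduct x y z
lemma dotp_sub_right {n : ℕ} (x y z : Fin n → ℝ) : dotp z (x - y) = dotp z x - dotp z y :=
  dotProduct_sub z x y
lemma dotp_smul_left {n : ℕ} (c : ℝ) (x z : Fin n → ℝ) : dotp (c • x) z = c * dotp x z :=
  smul_dotProduct c x z
lemma dotp_smul_right {n : ℕ} (c : ℝ) (x z : Fin n → ℝ) : dotp x (c • z) = c * dotp x z :=
  dotProduct_smul c x z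
lemma dotp_self_nonneg {n : ℕ} (x : Fin n → ℝ) : 0 ≤ dotp x x :=
  Finset.sum_nonneg fun _ _ => mul_self_nonneg _
lemma dotp_self_pos {n : ℕ} {x : Fin n → ℝ} (hx : x ≠ 0) : 0 < dotp x x := by
  rcases (dotp_self_nonneg x).lt_or_eq with h | h
  · exact h
  · exact absurd (dotProduct_self_eq_zero.mp h.symm) hx

lemma dotp_cs {n : ℕ} (x y : Fin n → ℝ) : (dotp x y) ^ 2 ≤ dotp x x * dotp y y := by
  have := Finset.sum_mul_sq_le_sq_mul_sq Finset.univ x y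
  unfold dotp
  simpa [sq] using this

lemma dotp_cs_abs {n : ℕ} (x y : Fin n → ℝ) : |dotp x y| ≤ √(dotp x x) * √(dotp y y) := by
  rw [← Real.sqrt_mul (dotp_self_nonneg x)]
  exact Real.abs_le_sqrt (dotp_cs x y)

lemma dotp_mulVec_symm {n : ℕ} {R : Matrix (Fin n) (Fin n) ℝ} (hR : R.IsSymm) (x y : Fin n → ℝ) :
    dotp x (R.mulVec y) = dotp (R.mulVec x) y := by
  rw [dotp_eq, dotp_eq, dotProduct_mulVec, ← mulVec_transpose, hR.eq]

lemma eig_dot {n : ℕ} {N : Matrix (Fin n) (Fin n) ℝ} (hN : N.IsHermitian) (i : Fin n) :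
    ∃ v : Fin n → ℝ, v ⬝ᵥ v = 1 ∧ v ⬝ᵥ N.mulVec v = hN.eigenvalues i := by
  refine ⟨hN.eigenvectorBasis i, ?_, ?_⟩
  · have := hN.eigenvectorBasis.orthonormal.1 i
    have h2 := EuclideanSpace.real_norm_sq_eq (hN.eigenvectorBasis i)
    rw [this] at h2
    simp only [dotProduct]
    simp only [sq] at h2
    linarith
  · have := hN.eigenvalues_eq i
    simpa using this.symm

lemma herm_le {n : ℕ} {N : Matrix (Fin n) (Fin n) ℝ} (hN : N.IsHermitian) (c : ℝ)
    (h : ∀ i, hN.eigenvalues i ≤ c) (q : Fin n → ℝ) : q ⬝ᵥ N.mulVec q ≤ c * (q ⬝ᵥ q) := by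
  have hs := hN.spectral_theorem
  have h1 : (c • (1 : Matrix (Fin n) (Fin n) ℝ) - N).PosSemidef := by
    set U : Matrix (Fin n) (Fin n) ℝ := (hN.eigenvectorUnitary : Matrix (Fin n) (Fin n) ℝ) with hU
    have e : c • (1 : Matrix (Fin n) (Fin n) ℝ) - N
        = U * Matrix.diagonal (fun i => c - hN.eigenvalues i) * Uᴴ := by
      have hUU : U * Uᴴ = 1 := by
        have := (Unitary.mem_iff.mp hN.eigenvectorUnitary.2).2
        simpa [Matrix.star_eq_conjTranspose] using this
      have hN2 : N = U * Matrix.diagonal hN.eigenvalues * Uᴴ := by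
        conv_lhs => rw [hs]
        rw [Unitary.conjStarAlgAut_apply]
        rfl
      have : Matrix.diagonal (fun i => c - hN.eigenvalues i)
          = c • (1 : Matrix (Fin n) (Fin n) ℝ) - Matrix.diagonal hN.eigenvalues := by
        ext i j
        by_cases hij : i = j
        · subst hij; simp
        · simp [hij]
      rw [this, mul_sub, sub_mul, ← hN2]
      rw [Matrix.mul_smul, mul_one, Matrix.smul_mul, hUU]
    rw [e]
    exact (Matrix.PosSemidef.diagonal fun i => sub_nonneg.mpr (h i)).mul_mul_conjTranspose_same U
  have := h1.dotProduct_mulVec_nonneg q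
  simp [Matrix.sub_mulVec, Matrix.smul_mulVec, dotProduct_sub] at this
  linarith

lemma det_low {n : ℕ} {N : Matrix (Fin n) (Fin n) ℝ} (hN : N.IsHermitian)
    (h1 : ∀ q : Fin n → ℝ, q ⬝ᵥ q ≤ q ⬝ᵥ N.mulVec q)
    (h2 : ∃ q : Fin n → ℝ, 2 * (q ⬝ᵥ q) < q ⬝ᵥ N.mulVec q) : 2 ≤ N.det := by
  have he : ∀ i, 1 ≤ hN.eigenvalues i := fun i => by
    obtain ⟨v, hv, hv2⟩ := eig_dot hN i
    rw [← hv2, ← hv]; exact h1 v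
  obtain ⟨i, hi⟩ : ∃ i, 2 < hN.eigenvalues i := by
    by_contra! hc
    obtain ⟨q, hq⟩ := h2
    exact absurd (herm_le hN 2 hc q) (not_le.mpr hq)
  have hd := hN.det_eq_prod_eigenvalues
  simp only [RCLike.ofReal_real_eq_id, id] at hd
  rw [hd, ← Finset.mul_prod_erase Finset.univ _ (Finset.mem_univ i)]
  have : 1 ≤ ∏ x ∈ Finset.univ.erase i, hN.eigenvalues x := by
    calc (1:ℝ) = ∏ x ∈ Finset.univ.erase i, (1:ℝ) := by simp
      _ ≤ _ := Finset.prod_le_prod (fun _ _ => zero_le_one) (fun j _ => he j)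
  nlinarith

lemma det_up {n : ℕ} {N : Matrix (Fin n) (Fin n) ℝ} (hN : N.PosSemidef) (c : ℝ)
    (h1 : ∀ q : Fin n → ℝ, q ⬝ᵥ N.mulVec q ≤ c * (q ⬝ᵥ q)) : N.det ≤ c ^ n := by
  have hH := hN.isHermitian
  have he : ∀ i, hH.eigenvalues i ≤ c := fun i => by
    obtain ⟨v, hv, hv2⟩ := eig_dot hH i
    rw [← hv2]; simpa [hv] using h1 v
  have hd := hH.det_eq_prod_eigenvalues
  simp only [RCLike.ofReal_real_eq_id, id] at hd
  rw [hd]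
  calc _ ≤ ∏ i : Fin n, c := Finset.prod_le_prod (fun i _ => hN.eigenvalues_nonneg i) (fun i _ => he i)
    _ = c ^ n := by simp

open scoped MatrixOrder in
lemma posDef_factor {n : ℕ} {A : Matrix (Fin n) (Fin n) ℝ} (hA : A.PosDef) :
    ∃ B : Matrix (Fin n) (Fin n) ℝ, IsUnit B ∧ A = Bᵀ * B := by
  obtain ⟨B, hB⟩ := CStarAlgebra.nonneg_iff_eq_star_mul_self.mp hA.posSemidef.nonneg
  have hB' : A = Bᵀ * B := by rw [hB]; simp [Matrix.star_eq_conjTranspose]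
  refine ⟨B, ?_, hB'⟩
  have hu := hA.isUnit
  rw [hB'] at hu
  rw [Matrix.isUnit_iff_isUnit_det] at hu ⊢
  rw [Matrix.det_mul, Matrix.det_transpose] at hu
  exact (IsUnit.mul_iff.mp hu).1

lemma quad_conj {n : ℕ} (H B : Matrix (Fin n) (Fin n) ℝ) (q : Fin n → ℝ) :
    q ⬝ᵥ (Bᵀ * H * B).mulVec q = (B.mulVec q) ⬝ᵥ H.mulVec (B.mulVec q) := by
  rw [← Matrix.mulVec_mulVec, ← Matrix.mulVec_mulVec, dotProduct_mulVec, Matrix.vecMul_transpose]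

lemma factor_aux {n : ℕ} {A B : Matrix (Fin n) (Fin n) ℝ} (hB : IsUnit B) (hA : A = Bᵀ * B) :
    (B⁻¹)ᵀ * A * B⁻¹ = 1 ∧ B * B⁻¹ = 1 ∧ B⁻¹ * B = 1 := by
  have hd := (Matrix.isUnit_iff_isUnit_det B).mp hB
  have h1 := Matrix.mul_nonsing_inv B hd
  have h2 := Matrix.nonsing_inv_mul B hd
  refine ⟨?_, h1, h2⟩
  rw [hA, ← mul_assoc, ← Matrix.transpose_mul, h1, Matrix.transpose_one, one_mul, h1]

lemma det_double {n : ℕ} {A H : Matrix (Fin n) (Fin n) ℝ} (hA : A.PosDef) (hH : H.PosSemidef)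
    (hp : ∃ p : Fin n → ℝ, p ⬝ᵥ A.mulVec p < p ⬝ᵥ H.mulVec p) : 2 * A.det ≤ (A + H).det := by
  obtain ⟨B, hB, hAB⟩ := posDef_factor hA
  obtain ⟨h1, h2, h3⟩ := factor_aux hB hAB
  set N := (B⁻¹)ᵀ * (A + H) * B⁻¹ with hN
  have hq : ∀ q, q ⬝ᵥ N.mulVec q = q ⬝ᵥ q + (B⁻¹.mulVec q) ⬝ᵥ H.mulVec (B⁻¹.mulVec q) := by
    intro q
    have e : N = 1 + (B⁻¹)ᵀ * H * B⁻¹ := by rw [hN, mul_add, add_mul, h1]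
    rw [e, Matrix.add_mulVec, Matrix.one_mulVec, dotProduct_add, quad_conj]
  have hNh : N.IsHermitian := by
    have := (hA.posSemidef.add hH).conjTranspose_mul_mul_same B⁻¹
    exact this.isHermitian
  have hdet : N.det * A.det = (A + H).det := by
    have e : Bᵀ * N * B = A + H := by
      rw [hN]
      calc Bᵀ * ((B⁻¹)ᵀ * (A + H) * B⁻¹) * B = (Bᵀ * (B⁻¹)ᵀ) * (A + H) * (B⁻¹ * B) := by
            simp only [mul_assoc]
        _ = A + H := by rw [← Matrix.transpose_mul, h3, Matrix.transpose_one, one_mul, mul_one]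
    rw [← e, hAB]; simp only [Matrix.det_mul]; ring
  have hl : 2 ≤ N.det := by
    refine det_low hNh (fun q => ?_) ?_
    · rw [hq]
      have := hH.dotProduct_mulVec_nonneg (B⁻¹.mulVec q)
      rw [star_trivial] at this; linarith
    · obtain ⟨p, hp⟩ := hp
      refine ⟨B.mulVec p, ?_⟩
      rw [hq, Matrix.mulVec_mulVec, h3, Matrix.one_mulVec]
      have : B.mulVec p ⬝ᵥ B.mulVec p = p ⬝ᵥ A.mulVec p := by
        have := quad_conj 1 B p
        rw [mul_one, ← hAB, Matrix.one_mulVec] at this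
        exact this.symm
      rw [this]; linarith
  have := hA.det_pos
  rw [← hdet]; nlinarith

lemma det_bound {n : ℕ} {A D : Matrix (Fin n) (Fin n) ℝ} (hA : A.PosSemidef) (hD : D.PosDef) (c : ℝ)
    (h : ∀ p : Fin n → ℝ, p ⬝ᵥ A.mulVec p ≤ c * (p ⬝ᵥ D.mulVec p)) : A.det ≤ c ^ n * D.det := by
  obtain ⟨B, hB, hAB⟩ := posDef_factor hD
  obtain ⟨h1, h2, h3⟩ := factor_aux hB hAB
  set N := (B⁻¹)ᵀ * A * B⁻¹ with hN
  have hNh : N.PosSemidef := hA.conjTranspose_mul_mul_same B⁻¹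
  have hdet : N.det * D.det = A.det := by
    have e : Bᵀ * N * B = A := by
      rw [hN]
      calc Bᵀ * ((B⁻¹)ᵀ * A * B⁻¹) * B = (Bᵀ * (B⁻¹)ᵀ) * A * (B⁻¹ * B) := by
            simp only [mul_assoc]
        _ = A := by rw [← Matrix.transpose_mul, h3, Matrix.transpose_one, one_mul, mul_one]
    rw [← e, hAB]; simp only [Matrix.det_mul]; ring
  have hl : N.det ≤ c ^ n := by
    refine det_up hNh c fun q => ?_
    rw [hN, quad_conj]
    refine (h _).trans_eq ?_
    rw [← quad_conj, h1, Matrix.one_mulVec]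
  rw [← hdet]
  exact mul_le_mul_of_nonneg_right hl hD.det_pos.le


open scoped MatrixOrder in
lemma psd_sq_inj {n : ℕ} {A B : Matrix (Fin n) (Fin n) ℝ} (hA : A.PosSemidef) (hB : B.PosSemidef)
    (h : A * A = B * B) : A = B := by
  rw [← CFC.sqrt_mul_self A hA.nonneg, h, CFC.sqrt_mul_self B hB.nonneg]

lemma psd_closed (n : ℕ) :
    IsClosed {A : Fin n → Fin n → ℝ | (Matrix.of A).PosSemidef} := by
  have e : {A : Fin n → Fin n → ℝ | (Matrix.of A).PosSemidef}
      = {A | ∀ i j, A i j = A j i} ∩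
        ⋂ x : Fin n → ℝ, {A | 0 ≤ ∑ i, x i * ∑ j, A i j * x j} := by
    ext A
    simp only [Set.mem_ofPred_eq, Set.mem_inter_iff, Set.mem_iInter]
    constructor
    · intro h
      refine ⟨fun i j => ?_, fun x => ?_⟩
      · have := congrFun (congrFun h.isHermitian i) j
        simpa using this.symm
      · have := h.dotProduct_mulVec_nonneg x
        simpa [dotProduct, mulVec] using this
    · rintro ⟨h1, h2⟩
      refine Matrix.PosSemidef.of_dotProduct_mulVec_nonneg ?_ fun x => ?_
      · ext i j; simp [h1 i j]
      · simpa [dotProduct, mulVec] using h2 x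
  rw [e]
  refine IsClosed.inter ?_ (isClosed_iInter fun x => ?_)
  · simp only [Set.ofPred_forall]
    exact isClosed_iInter fun i => isClosed_iInter fun j =>
      isClosed_eq (by fun_prop) (by fun_prop)
  · exact isClosed_le (by fun_prop) (by fun_prop)

lemma sqrt_meas {Ω : Type*} {n : ℕ} (m : MeasurableSpace Ω) (H R : Ω → Matrix (Fin n) (Fin n) ℝ)
    (hH : ∀ i j, Measurable[m] fun ω => H ω i j)
    (hR : ∀ ω, (R ω).PosSemidef ∧ R ω * R ω = H ω) (i j : Fin n) :
    Measurable[m] fun ω => R ω i j := by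
  let s : Set (Fin n → Fin n → ℝ) := {A | (Matrix.of A).PosSemidef}
  let f : (Fin n → Fin n → ℝ) → (Fin n → Fin n → ℝ) := fun A i j => ∑ k, A i k * A k j
  have hf : Continuous f := by fun_prop
  have hinj : Set.InjOn f s := by
    intro A hA B hB hAB
    have := psd_sq_inj (A := Matrix.of A) (B := Matrix.of B) hA hB (by
      ext i j
      simpa [Matrix.mul_apply] using congrFun (congrFun hAB i) j)
    exact Matrix.of.injective this
  have he := ContinuousOn.measurableEmbedding (psd_closed n).measurableSet hf.continuousOn hinj
  let g : Ω → s := fun ω => ⟨fun i j => R ω i j, (hR ω).1⟩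
  have hg : Measurable[m] g := by
    rw [← he.measurable_comp_iff]
    have : (s.domRestrict f) ∘ g = fun ω i j => H ω i j := by
      funext ω; ext i j
      rw [← (hR ω).2]
      rfl
    rw [this]
    exact measurable_pi_lambda _ fun i => measurable_pi_lambda _ fun j => hH i j
  exact (measurable_pi_apply j).comp ((measurable_pi_apply i).comp (measurable_subtype_coe.comp hg))

lemma inv_meas {Ω : Type*} {n : ℕ} (m : MeasurableSpace Ω) (R : Ω → Matrix (Fin n) (Fin n) ℝ)
    (hR : ∀ i j, Measurable[m] fun ω => R ω i j) (i j : Fin n) :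
    Measurable[m] fun ω => (R ω)⁻¹ i j := by
  have hR' : Measurable[m] fun ω => (fun i j => R ω i j : Fin n → Fin n → ℝ) :=
    measurable_pi_lambda _ fun i => measurable_pi_lambda _ fun j => hR i j
  have h1 : Continuous fun A : Fin n → Fin n → ℝ => (Matrix.of A).det :=
    Continuous.matrix_det (A := fun A : Fin n → Fin n → ℝ => Matrix.of A) continuous_id
  have h2 : Continuous fun A : Fin n → Fin n → ℝ => (Matrix.of A).adjugate i j :=
    (Continuous.matrix_adjugate (A := fun A : Fin n → Fin n → ℝ => Matrix.of A)
      continuous_id).matrix_elem i j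
  have e : (fun ω => (R ω)⁻¹ i j) = fun ω => ((R ω).det)⁻¹ * (R ω).adjugate i j := by
    funext ω
    rw [Matrix.inv_def]; simp
  rw [e]
  exact (h1.measurable.comp hR').inv.mul (h2.measurable.comp hR')

lemma mulVec_meas {Ω : Type*} {n : ℕ} (m : MeasurableSpace Ω) (R : Ω → Matrix (Fin n) (Fin n) ℝ)
    (x : Ω → Fin n → ℝ)
    (hR : ∀ i j, Measurable[m] fun ω => R ω i j) (hx : ∀ i, Measurable[m] fun ω => x ω i) (i : Fin n) :
    Measurable[m] fun ω => (R ω).mulVec (x ω) i := by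
  simp only [Matrix.mulVec, dotProduct]
  exact Finset.measurable_sum _ fun j _ => (hR i j).mul (hx j)

lemma dotp_meas {Ω : Type*} {n : ℕ} (m : MeasurableSpace Ω) (y x : Ω → Fin n → ℝ)
    (hy : ∀ i, Measurable[m] fun ω => y ω i) (hx : ∀ i, Measurable[m] fun ω => x ω i) :
    Measurable[m] fun ω => dotp (y ω) (x ω) := by
  simp only [dotp]
  exact Finset.measurable_sum _ fun j _ => (hy j).mul (hx j)

lemma hess_cont {d : ℕ} {K : Set (Fin d → ℝ)}
    {ψ : (Fin d → ℝ) → ℝ} {ν : ℝ} (hψ : IsSCB K ψ ν) (p q : Fin (d + 1) → ℝ) :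
    ContinuousOn (fun x => der2 (liftedBarrier ψ ν) x p q) (coneU K) := by
  intro x hx
  have h3 := hψ.lifted_cda hx
  have h4 : ContinuousAt (iteratedFDeriv ℝ 2 (liftedBarrier ψ ν)) x := by
    have := h3.iteratedFDeriv_right (m := 0) (i := 2) (by norm_num)
    exact this.continuousAt
  have h6 := (ContinuousMultilinearMap.apply ℝ (fun _ : Fin 2 => Fin (d+1) → ℝ) ℝ
        ![p, q]).continuous.continuousAt.comp h4
  exact h6.continuousWithinAt

/-- Hessian entries of the lifted barrier are measurable along measurable points of the cone. -/
lemma hess_meas {Ω : Type*} {d : ℕ} (m : MeasurableSpace Ω) {K : Set (Fin d → ℝ)}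
    {ψ : (Fin d → ℝ) → ℝ} {ν : ℝ} (hψ : IsSCB K ψ ν) (w : Ω → Fin (d + 1) → ℝ)
    (hw : ∀ i, Measurable[m] fun ω => w ω i) (hwU : ∀ ω, w ω ∈ coneU K) (i j : Fin (d + 1)) :
    Measurable[m] fun ω => hess (liftedBarrier ψ ν) (w ω) i j := by
  have hw' : Measurable[m] w := measurable_pi_lambda _ hw
  have hg : Measurable[m] (fun ω => (⟨w ω, hwU ω⟩ : coneU K)) := Measurable.subtype_mk hw'
  have hc := continuousOn_iff_continuous_domRestrict.mp
    (hess_cont hψ (Pi.single i 1) (Pi.single j 1))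
  exact hc.measurable.comp hg


/-! ### Geometry of the shrunk set -/

lemma mink_mem {d : ℕ} {K : Set (Fin d → ℝ)} (hK : Convex ℝ K) (hc : IsClosed K)
    {w x : Fin d → ℝ} (hw : w ∈ K) (hx : x ∈ K) {c : ℝ} (hc0 : 0 < c)
    (h : mink (liftv '' K) (liftv w) (liftv x) ≤ c) :
    ∃ y ∈ K, x = w + c • (y - w) := by
  have key : ∀ s : ℝ, (liftv w + s⁻¹ • (liftv x - liftv w) ∈ liftv '' K) ↔ w + s⁻¹ • (x - w) ∈ K := by
    intro s
    rw [liftv_sub, ← lz_smul, liftv_add_lz]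
    constructor
    · rintro ⟨y, hy, h⟩
      rwa [← liftv_inj h]
    · intro h; exact ⟨_, h, rfl⟩
  unfold mink at h
  simp only [key] at h
  have hmem : ∀ c' : ℝ, c < c' → w + c'⁻¹ • (x - w) ∈ K := by
    intro c' hc'
    obtain ⟨s, ⟨hs0, hs⟩, hsc⟩ := exists_lt_of_csInf_lt (⟨1, one_pos, by simpa using hx⟩ :
      {s : ℝ | 0 < s ∧ w + s⁻¹ • (x - w) ∈ K}.Nonempty) (lt_of_le_of_lt h hc')
    have hc'0 : 0 < c' := hc0.trans hc'
    have e : w + c'⁻¹ • (x - w) = w + (s / c') • ((w + s⁻¹ • (x - w)) - w) := by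
      rw [add_sub_cancel_left, smul_smul]
      congr 2
      field_simp
    rw [e]
    exact hK.add_smul_sub_mem hw hs ⟨by positivity, by rw [div_le_one hc'0]; exact hsc.le⟩
  refine ⟨w + c⁻¹ • (x - w), ?_, ?_⟩
  · have hcont : ContinuousAt (fun c' : ℝ => w + c'⁻¹ • (x - w)) c :=
      continuousAt_const.add ((continuousAt_inv₀ hc0.ne').smul continuousAt_const)
    have ht : Filter.Tendsto (fun c' : ℝ => w + c'⁻¹ • (x - w)) (nhdsWithin c (Set.Ioi c))
        (nhds (w + c⁻¹ • (x - w))) := hcont.tendsto.mono_left nhdsWithin_le_nhds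
    exact hc.mem_of_tendsto ht (Filter.eventually_of_mem self_mem_nhdsWithin fun c' hc' => hmem c' hc')
  · rw [add_sub_cancel_left, smul_smul, mul_inv_cancel₀ hc0.ne', one_smul]; abel

lemma mink_le {d : ℕ} {K : Set (Fin d → ℝ)}
    {w y : Fin d → ℝ} (hy : y ∈ K) {c : ℝ} (hc0 : 0 < c) :
    mink (liftv '' K) (liftv w) (liftv (w + c • (y - w))) ≤ c := by
  unfold mink
  refine csInf_le ⟨0, fun s hs => hs.1.le⟩ ⟨hc0, ?_⟩
  rw [liftv_sub, ← lz_smul, liftv_add_lz, add_sub_cancel_left, smul_smul, inv_mul_cancel₀ hc0.ne',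
    one_smul]
  exact ⟨y, hy, by congr 1; abel⟩

/-- the shrunk set -/
def shr {d : ℕ} (K : Set (Fin d → ℝ)) (w1 : Fin d → ℝ) (c : ℝ) : Set (Fin d → ℝ) :=
  {w | ∃ y ∈ K, w = w1 + c • (y - w1)}

section
variable {d : ℕ} {K : Set (Fin d → ℝ)} {ψ : (Fin d → ℝ) → ℝ} {ν : ℝ} {w1 : Fin d → ℝ} {T : ℝ}

lemma shr_int (hK : Convex ℝ K) (hw1 : w1 ∈ interior K) (hT : 2 ≤ T) {w : Fin d → ℝ}
    (hw : w ∈ shr K w1 (1 - 1 / T)) : w ∈ interior K := by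
  obtain ⟨y, hy, rfl⟩ := hw
  have h1 : 1 / T ≤ 1 := by rw [div_le_one] <;> linarith
  have h2 : 0 < 1 / T := by positivity
  exact seg_int hK hw1 hy (by linarith) (by linarith)

lemma shr_convex (hK : Convex ℝ K) (c : ℝ) : Convex ℝ (shr K w1 c) := by
  rintro _ ⟨y, hy, rfl⟩ _ ⟨z, hz, rfl⟩ a b ha hb hab
  refine ⟨a • y + b • z, hK hy hz ha hb hab, ?_⟩
  have : b = 1 - a := by linarith
  subst this
  ext i; simp; ring

lemma w1_shr (hw1 : w1 ∈ K) (c : ℝ) : w1 ∈ shr K w1 c := ⟨w1, hw1, by simp⟩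

lemma der1_min (hw1 : w1 ∈ interior K) (hmin : ∀ y ∈ K, ψ w1 ≤ ψ y) (h : Fin d → ℝ) :
    der1 ψ w1 h = 0 := by
  have : IsLocalMin ψ w1 :=
    Filter.eventually_of_mem (mem_interior_iff_mem_nhds.mp hw1) fun y hy => hmin y hy
  unfold der1
  rw [this.fderiv_eq_zero]; rfl

lemma IsSCB.shr_le (hψ : IsSCB K ψ ν) (hK : Convex ℝ K) (hν : 1 ≤ ν) (hw1 : w1 ∈ interior K) (hT : 2 ≤ T)
    {w : Fin d → ℝ} (hw : w ∈ shr K w1 (1 - 1 / T)) : ψ w ≤ ψ w1 + ν * Real.log T := by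
  obtain ⟨y, hy, rfl⟩ := hw
  have h1 : 1 / T ≤ 1 := by rw [div_le_one] <;> linarith
  have h2 : 0 < 1 / T := by positivity
  have := hψ.growth hK (by linarith) hw1 hy (s := 1 - 1 / T) (by linarith) (by linarith)
  rw [sub_sub_cancel, show Real.log (1 / T) = - Real.log T by rw [one_div, Real.log_inv]] at this
  linarith

lemma IsSCB.D1_le (hψ : IsSCB K ψ ν) (hK : Convex ℝ K) (hν : 1 ≤ ν) (hw1 : w1 ∈ interior K) (hT : 2 ≤ T)
    (hmin : ∀ y ∈ K, ψ w1 ≤ ψ y)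
    {u : Fin d → ℝ} (hu : u ∈ shr K w1 (1 - 1 / T)) :
    breg (liftedBarrier ψ ν) (liftv u) (liftv w1) ≤ 400 * ν * Real.log T := by
  rw [hψ.breg_lift hw1, der1_min hw1 hmin]
  have := hψ.shr_le hK hν hw1 hT hu
  linarith

lemma IsSCB.breg_nonneg (hψ : IsSCB K ψ ν) (hK : Convex ℝ K) {u w : Fin d → ℝ} (hu : u ∈ interior K)
    (hw : w ∈ interior K) : 0 ≤ breg (liftedBarrier ψ ν) (liftv u) (liftv w) := by
  rw [hψ.breg_lift hw]
  have := hψ.breg_lower hK hw hu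
  have h0 := hψ.nonneg hw (u - w)
  have : 0 ≤ der2 ψ w (u - w) (u - w) / (2 * (1 + √(der2 ψ w (u - w) (u - w)))) := by positivity
  linarith

lemma IsSCB.norm_le (hψ : IsSCB K ψ ν) (hK : Convex ℝ K) (hν : 1 ≤ ν)
    {u w : Fin d → ℝ} (hw : w ∈ interior K) (hu : u ∈ K) :
    √(der2 (liftedBarrier ψ ν) (liftv w) (liftv u) (liftv u)) ≤ 67 * (2 * ν - der1 ψ w (u - w)) := by
  rw [hψ.lifted_hess_liftv hw]
  have h1 := hψ.semibdd hK (by linarith) hw hu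
  have h2 := hψ.rbound hK hν hw hu
  have h0 := hψ.nonneg hw (u - w)
  have h3 := Real.sq_sqrt h0
  have h4 := Real.sqrt_nonneg (der2 ψ w (u - w) (u - w))
  set r := √(der2 ψ w (u - w) (u - w))
  set g := der1 ψ w (u - w)
  apply Real.sqrt_le_iff.mpr
  refine ⟨by linarith, ?_⟩
  rw [← h3]
  obtain ⟨m, hm⟩ : ∃ m, m = 2 * ν - g := ⟨_, rfl⟩
  have hg : g = 2 * ν - m := by linarith
  rw [hg] at h1 h2 ⊢
  have h5 : r ≤ 3 * m := by linarith
  have h6 : r ^ 2 ≤ 9 * m ^ 2 := by nlinarith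
  nlinarith

lemma IsSCB.D_lower (hψ : IsSCB K ψ ν) (hK : Convex ℝ K) (hν : 1 ≤ ν) (hw1 : w1 ∈ interior K) (hT : 2 ≤ T)
    (hmin : ∀ y ∈ K, ψ w1 ≤ ψ y)
    {u w : Fin d → ℝ} (hu : u ∈ K) (hw : w ∈ shr K w1 (1 - 1 / T)) :
    5 * √(der2 (liftedBarrier ψ ν) (liftv w) (liftv u) (liftv u)) - 400 * ν * (2 + Real.log T) ≤
      breg (liftedBarrier ψ ν) (liftv u) (liftv w) := by
  have hwi := shr_int hK hw1 hT hw
  have h1 := hψ.norm_le hK hν hwi hu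
  rw [hψ.breg_lift hwi]
  have h2 := hψ.shr_le hK hν hw1 hT hw
  have h3 := hmin u hu
  have h4 := hψ.semibdd hK (by linarith) hwi hu
  nlinarith

lemma IsSCB.norm1_le (hψ : IsSCB K ψ ν) (hK : Convex ℝ K) (hν : 1 ≤ ν) (hw1 : w1 ∈ interior K)
    (hmin : ∀ y ∈ K, ψ w1 ≤ ψ y) {u : Fin d → ℝ} (hu : u ∈ K) :
    √(der2 (liftedBarrier ψ ν) (liftv w1) (liftv u) (liftv u)) ≤ 134 * ν := by
  have := hψ.norm_le hK hν hw1 hu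
  rw [der1_min hw1 hmin] at this
  linarith

lemma IsSCB.local_le (hψ : IsSCB K ψ ν) (hν : 1 ≤ ν) {u w : Fin d → ℝ} (hw : w ∈ interior K) :
    20 * √(der2 ψ w (u - w) (u - w)) ≤
      √(der2 (liftedBarrier ψ ν) (liftv w) (liftv u) (liftv u)) + 20 * √ν ∧
    20 * √ν ≤ √(der2 (liftedBarrier ψ ν) (liftv w) (liftv u) (liftv u)) := by
  rw [hψ.lifted_hess_liftv hw]
  have h0 := hψ.nonneg hw (u - w)
  have h3 := Real.sq_sqrt h0
  have h4 := Real.sqrt_nonneg (der2 ψ w (u - w) (u - w))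
  have h5 := (abs_le.mp (hψ.gradBound w hw (u - w))).2
  have h6 := Real.sq_sqrt (show 0 ≤ ν by linarith)
  have h7 := Real.sqrt_nonneg ν
  set r := √(der2 ψ w (u - w) (u - w))
  set g := der1 ψ w (u - w)
  set n := √ν
  rw [← h3]
  have e : (20 * (r - n)) ^ 2 + 400 * n ^ 2 ≤ 400 * (r ^ 2 - 2 * g + 2 * ν) := by
    rw [← h6]; nlinarith
  refine ⟨?_, ?_⟩
  · have : 20 * (r - n) ≤ √(400 * (r ^ 2 - 2 * g + 2 * ν)) :=
      Real.le_sqrt_of_sq_le (by nlinarith)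
    linarith
  · exact Real.le_sqrt_of_sq_le (by nlinarith)

lemma IsSCB.hess_le (hψ : IsSCB K ψ ν) (hK : Convex ℝ K) (hν : 1 ≤ ν) (hw1 : w1 ∈ interior K) (hT : 2 ≤ T)
    (hmin : ∀ y ∈ K, ψ w1 ≤ ψ y) {w : Fin d → ℝ} (hw : w ∈ shr K w1 (1 - 1 / T)) (p : Fin (d + 1) → ℝ) :
    der2 (liftedBarrier ψ ν) (liftv w) p p ≤
      2048 * ν ^ 4 * T ^ 2 * der2 (liftedBarrier ψ ν) (liftv w1) p p := by
  have hwi := shr_int hK hw1 hT hw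
  obtain ⟨g, hg⟩ : ∃ g : Fin d → ℝ, g = (fun i => p i.castSucc) - p (Fin.last d) • w := ⟨_, rfl⟩
  obtain ⟨g1, hg1⟩ : ∃ g : Fin d → ℝ, g = (fun i => p i.castSucc) - p (Fin.last d) • w1 := ⟨_, rfl⟩
  rw [(hψ.lifted_ders hwi p g hg).2, (hψ.lifted_ders hw1 p g1 hg1).2, der1_min hw1 hmin]
  set s := p (Fin.last d)
  have e : g = g1 + (-s) • (w - w1) := by
    rw [hg, hg1]; ext i; simp; ring
  have hA : der2 ψ w1 (w - w1) (w - w1) ≤ 16 * ν ^ 2 := by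
    have := hψ.rbound hK hν hw1 (interior_subset hwi)
    rw [der1_min hw1 hmin] at this
    have h0 := hψ.nonneg hw1 (w - w1)
    have h3 := Real.sq_sqrt h0
    have h4 := Real.sqrt_nonneg (der2 ψ w1 (w - w1) (w - w1))
    nlinarith
  have hB : der2 ψ w1 g g ≤ 2 * der2 ψ w1 g1 g1 + 2 * (s ^ 2 * der2 ψ w1 (w - w1) (w - w1)) := by
    rw [e]
    refine (hψ.der2_add_le hw1 _ _).trans ?_
    rw [der2_smul]; apply le_of_eq; ring
  have hC : der2 ψ w g g ≤ (4 * ν * T) ^ 2 * der2 ψ w1 g g := by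
    obtain ⟨y, hy, hwy⟩ := hw
    have h1 : 1 / T ≤ 1 := by rw [div_le_one] <;> linarith
    exact hψ.hess_cmp hK hν hw1 hy (by linarith) (by linarith) le_rfl hwy g
  have hD := (abs_le.mp (hψ.gradBound w hwi g))
  have h0 := hψ.nonneg hwi g
  have h3 := Real.sq_sqrt h0
  have h4 := Real.sqrt_nonneg (der2 ψ w g g)
  have h6 := Real.sq_sqrt (show 0 ≤ ν by linarith)
  have h7 := Real.sqrt_nonneg ν
  have h01 := hψ.nonneg hw1 g1
  set r := √(der2 ψ w g g)
  set n := √ν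
  have hE : -2 * s * der1 ψ w g ≤ r ^ 2 + ν * s ^ 2 := by
    have : |s * der1 ψ w g| ≤ |s| * (n * r) := by
      rw [abs_mul]; exact mul_le_mul_of_nonneg_left (hψ.gradBound w hwi g) (abs_nonneg _)
    have h8 := (abs_le.mp this).1
    rw [← h6]
    nlinarith [sq_nonneg (n * |s| - r), sq_abs s]
  have hF : der2 ψ w g g ≤ 16 * ν ^ 2 * T ^ 2 * (2 * der2 ψ w1 g1 g1 + 32 * ν ^ 2 * s ^ 2) := by
    refine hC.trans ?_
    have : der2 ψ w1 g g ≤ 2 * der2 ψ w1 g1 g1 + 32 * ν ^ 2 * s ^ 2 := by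
      nlinarith [sq_nonneg s]
    calc (4 * ν * T) ^ 2 * der2 ψ w1 g g ≤ (4 * ν * T) ^ 2 * (2 * der2 ψ w1 g1 g1 + 32 * ν ^ 2 * s ^ 2) :=
          mul_le_mul_of_nonneg_left this (by positivity)
      _ = _ := by ring
  have hν2 : 1 ≤ ν ^ 2 := by nlinarith
  have hν4 : ν ^ 2 ≤ ν ^ 4 := by nlinarith
  have hT2 : 1 ≤ T ^ 2 := by nlinarith
  have hx : ν ^ 2 * T ^ 2 * der2 ψ w1 g1 g1 ≤ ν ^ 4 * T ^ 2 * der2 ψ w1 g1 g1 := by gcongr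
  have hy : ν ^ 4 * T ^ 2 * s ^ 2 ≤ ν ^ 4 * T ^ 2 * (ν * s ^ 2) := by
    have : s ^ 2 ≤ ν * s ^ 2 := by nlinarith [sq_nonneg s]
    gcongr
  have hz : ν * s ^ 2 ≤ ν ^ 4 * T ^ 2 * (ν * s ^ 2) := by
    have : 1 ≤ ν ^ 4 * T ^ 2 := by nlinarith
    have h9 : 0 ≤ ν * s ^ 2 := by positivity
    nlinarith
  have hw' : 0 ≤ ν ^ 4 * T ^ 2 * der2 ψ w1 g1 g1 := by positivity
  rw [h3] at hE
  nlinarith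
end


/-! ### Mirror descent step -/

lemma opt_deriv {f : ℝ → ℝ} {f' : ℝ} (hf : HasDerivAt f f' 0) (h : ∀ τ ∈ Set.Ioc (0:ℝ) 1, f 0 ≤ f τ) :
    0 ≤ f' := by
  have h1 := (hf.hasDerivWithinAt (s := Set.Ioi 0))
  rw [hasDerivWithinAt_iff_tendsto_slope' (by simp)] at h1
  refine ge_of_tendsto h1 ?_
  filter_upwards [Ioc_mem_nhdsGT (show (0:ℝ) < 1 by norm_num)] with τ hτ
  rw [slope_def_field]
  have := h τ hτ
  exact div_nonneg (by linarith) (by linarith [hτ.1])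

section
variable {d : ℕ} {K : Set (Fin d → ℝ)} {ψ : (Fin d → ℝ) → ℝ} {ν : ℝ} {w1 : Fin d → ℝ} {T : ℝ}

lemma der1_sub {n : ℕ} (f : (Fin n → ℝ) → ℝ) (x a b : Fin n → ℝ) :
    der1 f x (a - b) = der1 f x a - der1 f x b := by
  unfold der1; rw [map_sub]

lemma IsSCB.omd (hψ : IsSCB K ψ ν) (hK : Convex ℝ K) {Q : Set (Fin d → ℝ)} (hQ : Convex ℝ Q)
    (hQK : Q ⊆ interior K) {w wn u : Fin d → ℝ} (hw : w ∈ interior K) (hwn : wn ∈ Q) (hu : u ∈ Q)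
    (g : Fin (d + 1) → ℝ) {η : ℝ}
    (hopt : ∀ y ∈ Q, dotp (liftv wn) g + (1 / η) * breg (liftedBarrier ψ ν) (liftv wn) (liftv w) ≤
      dotp (liftv y) g + (1 / η) * breg (liftedBarrier ψ ν) (liftv y) (liftv w)) :
    dotp (liftv wn - liftv u) g ≤ (1 / η) * (breg (liftedBarrier ψ ν) (liftv u) (liftv w) -
      breg (liftedBarrier ψ ν) (liftv u) (liftv wn) - breg (liftedBarrier ψ ν) (liftv wn) (liftv w)) := by
  have hd := hψ.l0 (w := wn) (h := u - wn) (τ := 0) (by simpa using hQK hwn)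
  rw [zero_smul, add_zero] at hd
  have hd2 : HasDerivAt (fun τ : ℝ => dotp (liftv wn) g + τ * dotp (liftv u - liftv wn) g
      + (1 / η) * (400 * (ψ (wn + τ • (u - wn)) - ψ w - (der1 ψ w (wn - w) + τ * der1 ψ w (u - wn)))))
      (1 * dotp (liftv u - liftv wn) g + (1 / η) * (400 * (der1 ψ wn (u - wn) - 1 * der1 ψ w (u - wn)))) 0 := by
    refine (((hasDerivAt_id (0:ℝ)).mul_const _).const_add _).add
      (((hd.sub_const _).sub (((hasDerivAt_id (0:ℝ)).mul_const _).const_add _)).const_mul _ |>.const_mul _)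
  have h0 := opt_deriv hd2 (fun τ hτ => by
    have hy : wn + τ • (u - wn) ∈ Q := hQ.add_smul_sub_mem hwn hu ⟨hτ.1.le, hτ.2⟩
    have := hopt _ hy
    rw [hψ.breg_lift hw, hψ.breg_lift hw] at this
    have e1 : wn + τ • (u - wn) - w = (wn - w) - (-τ) • (u - wn) := by
      ext i; simp; ring
    rw [e1, der1_sub ψ w (wn - w) (-τ • (u - wn)), der1_smul, ← liftv_add_lz, dotp_add_left, lz_smul, dotp_smul_left, ← liftv_sub] at this
    simp only [zero_mul, zero_smul, add_zero]
    have e2 : der1 ψ w (wn - w) - -τ * der1 ψ w (u - wn) = der1 ψ w (wn - w) + τ * der1 ψ w (u - wn) := by ring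
    rw [e2] at this
    linarith)
  rw [hψ.breg_lift hw, hψ.breg_lift hw, hψ.breg_lift (hQK hwn)]
  have e3 : der1 ψ w (u - wn) = der1 ψ w (u - w) - der1 ψ w (wn - w) := by
    rw [← der1_sub]; congr 1; abel
  rw [e3] at h0
  have e4 : dotp (liftv wn - liftv u) g = - dotp (liftv u - liftv wn) g := by
    rw [dotp_sub_left, dotp_sub_left]; ring
  rw [e4]
  have e5 : (1 / η) * (400 * (ψ u - ψ w - der1 ψ w (u - w)) - 400 * (ψ u - ψ wn - der1 ψ wn (u - wn)) -
      400 * (ψ wn - ψ w - der1 ψ w (wn - w))) =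
      (1 / η) * (400 * (der1 ψ wn (u - wn) - 1 * (der1 ψ w (u - w) - der1 ψ w (wn - w)))) := by ring
  rw [e5]; linarith

lemma IsSCB.loc_ip (hψ : IsSCB K ψ ν) {w : Fin d → ℝ} (hw : w ∈ interior K)
    {R : Matrix (Fin (d + 1)) (Fin (d + 1)) ℝ} (hs : R.IsSymm) (hR : R * R = hess (liftedBarrier ψ ν) (liftv w))
    {s : Fin (d + 1) → ℝ} (hss : dotp s s = 1) (h : Fin d → ℝ) :
    |dotp (lz h) (R.mulVec s)| ≤ 20 * √(der2 ψ w h h) := by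
  rw [dotp_mulVec_symm hs]
  refine (dotp_cs_abs _ _).trans ?_
  rw [hss, Real.sqrt_one, mul_one, ← dotp_mulVec_symm hs, Matrix.mulVec_mulVec, hR, dotp_hess,
    hψ.lifted_hess_lz hw, Real.sqrt_mul (by norm_num), show (400:ℝ) = 20 ^ 2 by norm_num,
    Real.sqrt_sq (by norm_num)]

lemma IsSCB.omd_step (hψ : IsSCB K ψ ν) (hK : Convex ℝ K) {Q : Set (Fin d → ℝ)} (hQ : Convex ℝ Q)
    (hQK : Q ⊆ interior K) {w wn u : Fin d → ℝ} (hw : w ∈ interior K) (hwn : wn ∈ Q) (hu : u ∈ Q)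
    {R : Matrix (Fin (d + 1)) (Fin (d + 1)) ℝ} (hs : R.IsSymm) (hR : R * R = hess (liftedBarrier ψ ν) (liftv w))
    {s : Fin (d + 1) → ℝ} (hss : dotp s s = 1) {x : ℝ} (hx : |x| ≤ 1)
    {g : Fin (d + 1) → ℝ} (hg : g = ((d:ℝ) * x) • R.mulVec s) {η : ℝ} (hη : 0 < η) (hηd : η * d ≤ 5)
    (hopt : ∀ y ∈ Q, dotp (liftv wn) g + (1 / η) * breg (liftedBarrier ψ ν) (liftv wn) (liftv w) ≤
      dotp (liftv y) g + (1 / η) * breg (liftedBarrier ψ ν) (liftv y) (liftv w)) :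
    dotp (liftv w - liftv u) g ≤ (breg (liftedBarrier ψ ν) (liftv u) (liftv w) -
      breg (liftedBarrier ψ ν) (liftv u) (liftv wn)) / η + η * d ^ 2 * |x| := by
  have h1 := hψ.omd hK hQ hQK hw hwn hu g hopt
  have h2 := hψ.loc_ip hw hs hR hss (wn - w)
  have h3 := hψ.breg_lower hK hw (hQK hwn)
  rw [hψ.breg_lift hw wn] at h1
  have h0 := hψ.nonneg hw (wn - w)
  have h5 := Real.sq_sqrt h0
  have h6 := Real.sqrt_nonneg (der2 ψ w (wn - w) (wn - w))
  set r := √(der2 ψ w (wn - w) (wn - w))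
  rw [← h5] at h3
  have h7 : dotp (liftv w - liftv wn) g ≤ d * |x| * (20 * r) := by
    have : dotp (liftv w - liftv wn) g = - (((d:ℝ) * x) * dotp (lz (wn - w)) (R.mulVec s)) := by
      rw [hg, dotp_smul_right, ← liftv_sub, dotp_sub_left, dotp_sub_left]; ring
    rw [this]
    refine (neg_le_abs _).trans ?_
    rw [abs_mul, abs_mul, Nat.abs_cast]
    exact mul_le_mul_of_nonneg_left h2 (by positivity)
  have h8 : dotp (liftv w - liftv u) g = dotp (liftv w - liftv wn) g + dotp (liftv wn - liftv u) g := by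
    simp only [dotp_sub_left]; ring
  rw [h8]
  set Dd := ψ wn - ψ w - der1 ψ w (wn - w)
  have hd0 : (0:ℝ) ≤ d := by positivity
  have hx0 := abs_nonneg x
  have key : 20 * (η * d * |x|) * r ≤ 400 * Dd + η ^ 2 * d ^ 2 * |x| := by
    set a := η * d * |x| with ha
    have ha0 : 0 ≤ a := by positivity
    have ha5 : a ≤ 5 := by nlinarith [mul_nonneg hη.le hd0]
    have ha2 : a ^ 2 ≤ η ^ 2 * d ^ 2 * |x| := by
      have : a ^ 2 = η ^ 2 * d ^ 2 * |x| * |x| := by rw [ha]; ring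
      rw [this]
      exact mul_le_of_le_one_right (by positivity) hx
    have hD : 20 * a * r - a ^ 2 ≤ 400 * (r ^ 2 / (2 * (1 + r))) := by
      rcases le_total r 1 with hr | hr
      · have : r ^ 2 / 4 ≤ r ^ 2 / (2 * (1 + r)) := by
          apply div_le_div_of_nonneg_left <;> nlinarith
        nlinarith [sq_nonneg (10 * r - a)]
      · have : r / 4 ≤ r ^ 2 / (2 * (1 + r)) := by
          rw [div_le_div_iff₀] <;> nlinarith
        nlinarith
    linarith
  have key2 : d * |x| * (20 * r) ≤ (1 / η) * (400 * Dd) + η * d ^ 2 * |x| := by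
    have e : d * |x| * (20 * r) = (1 / η) * (20 * (η * d * |x|) * r) := by field_simp
    have e2 : (1 / η) * (400 * Dd) + η * d ^ 2 * |x| = (1 / η) * (400 * Dd + η ^ 2 * d ^ 2 * |x|) := by
      field_simp
    rw [e, e2]
    exact mul_le_mul_of_nonneg_left key (by positivity)
  have e6 : ∀ A B : ℝ, (1 / η) * (A - B - 400 * Dd) = (A - B) / η - (1 / η) * (400 * Dd) := by
    intro A B; ring
  rw [e6] at h1
  linarith

lemma inv_symm' {n : ℕ} {R : Matrix (Fin n) (Fin n) ℝ} (hs : R.IsSymm) : (R⁻¹).IsSymm := by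
  rw [Matrix.IsSymm, Matrix.transpose_nonsing_inv, hs.eq]

lemma pd_inv {n : ℕ} {R : Matrix (Fin n) (Fin n) ℝ} (hR : R.PosDef) : R * R⁻¹ = 1 ∧ R⁻¹ * R = 1 := by
  have := (Matrix.isUnit_iff_isUnit_det R).mp hR.isUnit
  exact ⟨Matrix.mul_nonsing_inv R this, Matrix.nonsing_inv_mul R this⟩

lemma inv_last {R : Matrix (Fin (d + 1)) (Fin (d + 1)) ℝ} (hs : R.IsSymm) (s : Fin (d + 1) → ℝ) :
    dotp s (R⁻¹.mulVec (Pi.single (Fin.last d) 1)) = R⁻¹.mulVec s (Fin.last d) := by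
  rw [dotp_mulVec_symm (inv_symm' hs), dotp_eq, dotProduct_single_one]

lemma eq_lz (x : Fin (d + 1) → ℝ) (h : x (Fin.last d) = 0) : x = lz (fun i => x i.castSucc) := by
  ext i
  refine Fin.lastCases ?_ (fun i => ?_) i
  · simp [lz_last, h]
  · simp [lz_castSucc]

lemma IsSCB.play (hψ : IsSCB K ψ ν) {w : Fin d → ℝ} (hw : w ∈ interior K)
    {R : Matrix (Fin (d + 1)) (Fin (d + 1)) ℝ} (hpd : R.PosDef) (hs : R.IsSymm)
    (hR : R * R = hess (liftedBarrier ψ ν) (liftv w))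
    {s : Fin (d + 1) → ℝ} (hss : dotp s s = 1)
    (hse : dotp s (R⁻¹.mulVec (Pi.single (Fin.last d) 1)) = 0) :
    ∃ v ∈ K, liftv w + R⁻¹.mulVec s = liftv v := by
  rw [inv_last hs] at hse
  obtain ⟨h, hh⟩ : ∃ h, R⁻¹.mulVec s = lz h := ⟨_, eq_lz _ hse⟩
  rw [hh, liftv_add_lz]
  refine ⟨_, interior_subset (hψ.dikin hw ?_), rfl⟩
  have := hψ.lifted_hess_lz hw h
  rw [← dotp_hess, ← hR, ← hh, ← Matrix.mulVec_mulVec, dotp_mulVec_symm hs, Matrix.mulVec_mulVec,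
    (pd_inv hpd).1, Matrix.one_mulVec, hss] at this
  linarith
end


/-! ### Learning-rate schedule -/

def Sched {n : ℕ} (T : ℕ) (κ η : ℝ) (H : ℕ → Matrix (Fin n) (Fin n) ℝ) (S : ℕ → Finset ℕ)
    (e : ℕ → ℝ) : Prop :=
  S 1 = {1} ∧ e 1 = η ∧ ∀ t ∈ Finset.Icc 1 T,
    ((∃ p : Fin n → ℝ, 0 < dotp p ((H (t + 1) - ∑ τ ∈ S t, H τ).mulVec p)) →
      S (t + 1) = insert (t + 1) (S t) ∧ e (t + 1) = κ * e t) ∧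
    (¬ (∃ p : Fin n → ℝ, 0 < dotp p ((H (t + 1) - ∑ τ ∈ S t, H τ).mulVec p)) →
      S (t + 1) = S t ∧ e (t + 1) = e t)

section
variable {n T : ℕ} {κ η : ℝ} {H : ℕ → Matrix (Fin n) (Fin n) ℝ} {S : ℕ → Finset ℕ} {e : ℕ → ℝ}

lemma posDef_sum' (H : ℕ → Matrix (Fin n) (Fin n) ℝ) (s : Finset ℕ) (h1 : 1 ∈ s)
    (h : ∀ t ∈ s, (H t).PosDef) : (∑ t ∈ s, H t).PosDef := by
  rw [← Finset.add_sum_erase s _ h1]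
  exact (h 1 h1).add_posSemidef
    (Matrix.posSemidef_sum _ fun t ht => (h t (Finset.mem_of_mem_erase ht)).posSemidef)

lemma Sched.basic (hs : Sched T κ η H S e) (hH : ∀ t ∈ Finset.Icc 1 (T + 1), (H t).PosDef) :
    ∀ t : ℕ, 1 ≤ t → t ≤ T + 1 →
      1 ∈ S t ∧ S t ⊆ Finset.Icc 1 t ∧ e t = κ ^ ((S t).card - 1) * η ∧
      2 ^ ((S t).card - 1) * (H 1).det ≤ (∑ τ ∈ S t, H τ).det := by
  obtain ⟨h1, h2, h3⟩ := hs
  intro t ht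
  induction t, ht using Nat.le_induction with
  | base => intro _; rw [h1]; simp [h2]
  | succ t ht ih =>
    intro htT
    obtain ⟨a, b, c, f⟩ := ih (by omega)
    obtain ⟨h4, h5⟩ := h3 t (Finset.mem_Icc.mpr ⟨ht, by omega⟩)
    by_cases hp : ∃ p : Fin n → ℝ, 0 < dotp p ((H (t + 1) - ∑ τ ∈ S t, H τ).mulVec p)
    · obtain ⟨h6, h7⟩ := h4 hp
      have hnot : t + 1 ∉ S t := fun hc => by
        have := Finset.mem_Icc.mp (b hc); omega
      have hcard : (insert (t + 1) (S t)).card - 1 = ((S t).card - 1) + 1 := by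
        rw [Finset.card_insert_of_notMem hnot]
        have := Finset.card_pos.mpr ⟨1, a⟩
        omega
      have hA : (∑ τ ∈ S t, H τ).PosDef := posDef_sum' H _ a fun τ hτ => by
        have := Finset.mem_Icc.mp (b hτ)
        exact hH τ (Finset.mem_Icc.mpr ⟨this.1, by omega⟩)
      refine ⟨?_, ?_, ?_, ?_⟩
      · rw [h6]; exact Finset.mem_insert_of_mem a
      · rw [h6]
        intro x hx
        rcases Finset.mem_insert.mp hx with rfl | hx
        · exact Finset.mem_Icc.mpr ⟨by omega, le_rfl⟩
        · have := Finset.mem_Icc.mp (b hx)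
          exact Finset.mem_Icc.mpr ⟨this.1, by omega⟩
      · rw [h7, h6, hcard, c, pow_succ]; ring
      · rw [h6, hcard, Finset.sum_insert hnot, add_comm (H (t + 1))]
        have hd := det_double hA (hH (t + 1) (Finset.mem_Icc.mpr ⟨by omega, htT⟩)).posSemidef (by
          obtain ⟨p, hp⟩ := hp
          refine ⟨p, ?_⟩
          rw [dotp_eq, Matrix.sub_mulVec, dotProduct_sub] at hp
          linarith)
        refine le_trans ?_ hd
        rw [pow_succ]; linarith
    · obtain ⟨h6, h7⟩ := h5 hp
      rw [h6, h7]
      exact ⟨a, b.trans (Finset.Icc_subset_Icc le_rfl (by omega)), c, f⟩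

lemma Sched.mono (hs : Sched T κ η H S e) {s : ℕ} (hs1 : 1 ≤ s) :
    ∀ t : ℕ, s ≤ t → t ≤ T + 1 → S s ⊆ S t := by
  intro t ht
  induction t, ht using Nat.le_induction with
  | base => intro _; exact subset_rfl
  | succ t ht ih =>
    intro htT
    obtain ⟨h4, h5⟩ := hs.2.2 t (Finset.mem_Icc.mpr ⟨by omega, by omega⟩)
    refine (ih (by omega)).trans ?_
    by_cases hp : ∃ p : Fin n → ℝ, 0 < dotp p ((H (t + 1) - ∑ τ ∈ S t, H τ).mulVec p)
    · rw [(h4 hp).1]; exact Finset.subset_insert _ _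
    · rw [(h5 hp).1]

lemma dotp_sum_mulVec (H : ℕ → Matrix (Fin n) (Fin n) ℝ) (s : Finset ℕ) (p : Fin n → ℝ) :
    dotp p ((∑ τ ∈ s, H τ).mulVec p) = ∑ τ ∈ s, dotp p ((H τ).mulVec p) := by
  classical
  induction s using Finset.induction_on with
  | empty => simp [dotp]
  | insert a s ha ih =>
    rw [Finset.sum_insert ha, Finset.sum_insert ha, Matrix.add_mulVec, dotp_add_right, ih]

lemma sqrt_sum_le {ι : Type*} (s : Finset ι) (f : ι → ℝ) (hf : ∀ i ∈ s, 0 ≤ f i) :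
    √(∑ i ∈ s, f i) ≤ ∑ i ∈ s, √(f i) := by
  classical
  induction s using Finset.induction_on with
  | empty => simp
  | insert a s ha ih =>
    rw [Finset.sum_insert ha, Finset.sum_insert ha]
    have h1 := ih fun i hi => hf i (Finset.mem_insert_of_mem hi)
    have ha0 := hf a (Finset.mem_insert_self _ _)
    have hs0 : 0 ≤ ∑ i ∈ s, f i := Finset.sum_nonneg fun i hi => hf i (Finset.mem_insert_of_mem hi)
    have h2 := Real.sq_sqrt ha0
    have h3 := Real.sq_sqrt hs0
    have h4 := Real.sqrt_nonneg (f a)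
    have h5 := Real.sqrt_nonneg (∑ i ∈ s, f i)
    refine (Real.sqrt_le_iff.mpr ⟨add_nonneg h4 h5, ?_⟩).trans (add_le_add_right h1 _)
    nlinarith

/-- every norm is dominated by the sum over the switching times -/
lemma Sched.norm_le (hs : Sched T κ η H S e) (hH : ∀ t ∈ Finset.Icc 1 (T + 1), (H t).PosDef)
    (p : Fin n → ℝ) {t : ℕ} (ht : t ∈ Finset.Icc 1 T) :
    qnorm (H t) p ≤ ∑ τ ∈ S T, qnorm (H τ) p := by
  have hT : 1 ≤ T := (Finset.mem_Icc.mp ht).1.trans (Finset.mem_Icc.mp ht).2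
  have hb := hs.basic hH
  have key : qnorm (H t) p ≤ ∑ τ ∈ S t, qnorm (H τ) p := by
    obtain ⟨h1, h2⟩ := Finset.mem_Icc.mp ht
    by_cases htS : t ∈ S t
    · exact Finset.single_le_sum (f := fun τ => qnorm (H τ) p) (fun _ _ => Real.sqrt_nonneg _) htS
    · have ht2 : t ≠ 1 := by
        rintro rfl; exact htS (hb 1 le_rfl (by omega)).1
      obtain ⟨k, rfl⟩ : ∃ k, t = k + 1 := ⟨t - 1, by omega⟩
      obtain ⟨h4, h5⟩ := hs.2.2 k (Finset.mem_Icc.mpr ⟨by omega, by omega⟩)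
      by_cases hp : ∃ p : Fin n → ℝ, 0 < dotp p ((H (k + 1) - ∑ τ ∈ S k, H τ).mulVec p)
      · rw [(h4 hp).1] at htS; simp at htS
      · rw [(h5 hp).1]
        push Not at hp
        have := hp p
        rw [Matrix.sub_mulVec, dotp_sub_right, dotp_sum_mulVec] at this
        refine (Real.sqrt_le_sqrt (show dotp p ((H (k+1)).mulVec p) ≤ _ by linarith)).trans ?_
        refine sqrt_sum_le _ _ fun τ hτ => ?_
        have h6 := Finset.mem_Icc.mp ((hb k (by omega) (by omega)).2.1 hτ)
        have := (hH τ (Finset.mem_Icc.mpr ⟨h6.1, by omega⟩)).posSemidef.dotProduct_mulVec_nonneg p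
        simpa [dotp_eq] using this
  refine key.trans (Finset.sum_le_sum_of_subset_of_nonneg
    (hs.mono (Finset.mem_Icc.mp ht).1 T (Finset.mem_Icc.mp ht).2 (by omega)) fun _ _ _ => Real.sqrt_nonneg _)

lemma Sched.count (hs : Sched T κ η H S e) (hH : ∀ t ∈ Finset.Icc 1 (T + 1), (H t).PosDef)
    {c : ℝ} (hc : ∀ t ∈ Finset.Icc 1 T, ∀ p : Fin n → ℝ,
      dotp p ((H t).mulVec p) ≤ c * dotp p ((H 1).mulVec p)) {t : ℕ} (ht : t ∈ Finset.Icc 1 T) :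
    (2:ℝ) ^ ((S t).card - 1) ≤ ((T : ℝ) * c) ^ n := by
  obtain ⟨h1, h2⟩ := Finset.mem_Icc.mp ht
  obtain ⟨a, b, _, f⟩ := hs.basic hH t h1 (by omega)
  have hsub : ∀ τ ∈ S t, τ ∈ Finset.Icc 1 T := fun τ hτ => by
    have := Finset.mem_Icc.mp (b hτ)
    exact Finset.mem_Icc.mpr ⟨this.1, by omega⟩
  have hI : ∀ τ ∈ Finset.Icc 1 T, (H τ).PosDef := fun τ hτ => by
    have := Finset.mem_Icc.mp hτ
    exact hH τ (Finset.mem_Icc.mpr ⟨this.1, by omega⟩)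
  have hH1 := hI 1 (Finset.mem_Icc.mpr ⟨le_rfl, by omega⟩)
  have hA : (∑ τ ∈ S t, H τ).PosDef := posDef_sum' H _ a fun τ hτ => hI τ (hsub τ hτ)
  have hcard : ((S t).card : ℝ) ≤ T := by
    have h3 : (S t).card ≤ t := by
      simpa using Finset.card_le_card b
    exact_mod_cast h3.trans h2
  have hb := det_bound hA.posSemidef hH1 ((T:ℝ) * c) (fun p => by
    rw [← dotp_eq, ← dotp_eq, dotp_sum_mulVec]
    have hp0 : 0 ≤ c * dotp p ((H 1).mulVec p) :=
      le_trans (by simpa [dotp_eq] using hH1.posSemidef.dotProduct_mulVec_nonneg p)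
        (hc 1 (Finset.mem_Icc.mpr ⟨le_rfl, by omega⟩) p)
    calc ∑ τ ∈ S t, dotp p ((H τ).mulVec p) ≤ ∑ τ ∈ S t, c * dotp p ((H 1).mulVec p) :=
          Finset.sum_le_sum fun τ hτ => hc τ (hsub τ hτ) p
      _ = (S t).card * (c * dotp p ((H 1).mulVec p)) := by rw [Finset.sum_const, nsmul_eq_mul]
      _ ≤ T * (c * dotp p ((H 1).mulVec p)) := mul_le_mul_of_nonneg_right hcard hp0
      _ = _ := by ring)
  have := f.trans hb
  exact le_of_mul_le_mul_right this hH1.det_pos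

/-- summation by parts -/
lemma Sched.parts (hs : Sched T κ η H S e) (hH : ∀ t ∈ Finset.Icc 1 (T + 1), (H t).PosDef)
    (hκ : 0 < κ) (hη : 0 < η) (D : ℕ → ℝ) (hT : 1 ≤ T) :
    ∑ t ∈ Finset.Icc 1 T, (D t - D (t + 1)) / e t =
      D 1 / η - ∑ t ∈ (S T).erase 1, (κ - 1) * D t / e t - D (T + 1) / e T := by
  have key : ∀ m : ℕ, 1 ≤ m → m ≤ T → ∑ t ∈ Finset.Icc 1 m, (D t - D (t + 1)) / e t =
      D 1 / η - ∑ t ∈ (S m).erase 1, (κ - 1) * D t / e t - D (m + 1) / e m := by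
    intro m hm
    induction m, hm using Nat.le_induction with
    | base => intro _; simp [hs.1, hs.2.1]; ring
    | succ m hm ih =>
      intro hmT
      rw [Finset.sum_Icc_succ_top (by omega), ih (by omega)]
      obtain ⟨h4, h5⟩ := hs.2.2 m (Finset.mem_Icc.mpr ⟨by omega, by omega⟩)
      obtain ⟨a, b, c, -⟩ := hs.basic hH m (by omega) (by omega)
      have hem : 0 < e m := by rw [c]; positivity
      by_cases hp : ∃ p : Fin n → ℝ, 0 < dotp p ((H (m + 1) - ∑ τ ∈ S m, H τ).mulVec p)
      · obtain ⟨h6, h7⟩ := h4 hp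
        have hnot : m + 1 ∉ (S m).erase 1 := fun hc => by
          have := Finset.mem_Icc.mp (b (Finset.mem_of_mem_erase hc)); omega
        rw [h6, Finset.erase_insert_of_ne (by omega), Finset.sum_insert hnot, h7]
        field_simp
        ring
      · obtain ⟨h6, h7⟩ := h5 hp
        rw [h6, h7]; ring
  exact key T hT le_rfl
end


lemma logνT {ν : ℝ} {T : ℕ} (hν : 1 ≤ ν) (hT : 2 ≤ T) : 0.69 ≤ Real.log (ν * T) ∧ Real.log T ≤ Real.log (ν * T)
    ∧ 0 ≤ Real.log T ∧ 2 ≤ ν * T := by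
  have hT' : (2:ℝ) ≤ T := by exact_mod_cast hT
  have h1 : (T:ℝ) ≤ ν * T := by nlinarith
  refine ⟨?_, Real.log_le_log (by linarith) h1, Real.log_nonneg (by linarith), by linarith⟩
  have := Real.log_two_gt_d9
  have h2 : Real.log 2 ≤ Real.log (ν * T) := Real.log_le_log (by norm_num) (by linarith)
  linarith

lemma count_real {d T N : ℕ} {ν : ℝ} (hd : 1 ≤ d) (hν : 1 ≤ ν) (hT : 2 ≤ T)
    (h : (2:ℝ) ^ N ≤ ((T:ℝ) * (2048 * ν ^ 4 * (T:ℝ) ^ 2)) ^ (d + 1)) :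
    (N:ℝ) ≤ 50 * d * Real.log (ν * T) := by
  obtain ⟨h1, -, -, h2⟩ := logνT hν hT
  have hT' : (2:ℝ) ≤ T := by exact_mod_cast hT
  have hd' : (1:ℝ) ≤ d := by exact_mod_cast hd
  have h3 : (T:ℝ) * (2048 * ν ^ 4 * (T:ℝ) ^ 2) ≤ (ν * T) ^ 15 := by
    have a : (2048:ℝ) ≤ (ν * T) ^ 11 := by
      calc (2048:ℝ) = 2 ^ 11 := by norm_num
        _ ≤ _ := pow_le_pow_left₀ (by norm_num) h2 11
    have b : ν ^ 4 * (T:ℝ) ^ 3 ≤ (ν * T) ^ 4 := by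
      have e : (ν * T) ^ 4 = ν ^ 4 * (T:ℝ) ^ 3 * T := by ring
      rw [e]
      exact le_mul_of_one_le_right (by positivity) (by linarith)
    calc (T:ℝ) * (2048 * ν ^ 4 * (T:ℝ) ^ 2) = 2048 * (ν ^ 4 * (T:ℝ) ^ 3) := by ring
      _ ≤ (ν * T) ^ 11 * (ν * T) ^ 4 := by gcongr
      _ = _ := by ring
  have h4 : (2:ℝ) ^ N ≤ ((ν * T) ^ 15) ^ (d + 1) :=
    h.trans (pow_le_pow_left₀ (by positivity) h3 _)
  have h5 := Real.log_le_log (by positivity) h4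
  rw [Real.log_pow, Real.log_pow, Real.log_pow] at h5
  have := Real.log_two_gt_d9
  push_cast at h5
  have hN : (0:ℝ) ≤ N := by positivity
  set Lg := Real.log (ν * T)
  have h6 : ((d:ℝ) + 1) * (15 * Lg) ≤ 30 * d * Lg := by nlinarith
  nlinarith

section
variable {d T : ℕ} {K : Set (Fin d → ℝ)} {ψ : (Fin d → ℝ) → ℝ} {ν η : ℝ} {w1 u : Fin d → ℝ}
  {W : ℕ → Fin d → ℝ} {H R : ℕ → Matrix (Fin (d + 1)) (Fin (d + 1)) ℝ} {S : ℕ → Finset ℕ} {e : ℕ → ℝ}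
  {s g : ℕ → Fin (d + 1) → ℝ} {x : ℕ → ℝ} {ρ : ℝ}

set_option maxHeartbeats 1000000 in
lemma IsSCB.det_regret (hψ : IsSCB K ψ ν) (hK : Convex ℝ K) (hd : 1 ≤ d) (hT : 2 ≤ T) (hν : 1 ≤ ν)
    (hη : 0 < η) (hηd : η * d ≤ 5 / 2) (hw1 : w1 ∈ interior K) (hmin : ∀ y ∈ K, ψ w1 ≤ ψ y)
    (hW1 : W 1 = w1) (hW : ∀ t ∈ Finset.Icc 1 (T + 1), W t ∈ shr K w1 (1 - 1 / (T:ℝ)))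
    (hu : u ∈ shr K w1 (1 - 1 / (T:ℝ)))
    (hH : ∀ t, t ∈ Finset.Icc 1 (T + 1) → H t = hess (liftedBarrier ψ ν) (liftv (W t)))
    (hHpd : ∀ t ∈ Finset.Icc 1 (T + 1), (H t).PosDef)
    (hRs : ∀ t ∈ Finset.Icc 1 T, (R t).IsSymm) (hR : ∀ t ∈ Finset.Icc 1 T, R t * R t = H t)
    (hs : ∀ t ∈ Finset.Icc 1 T, dotp (s t) (s t) = 1) (hx : ∀ t ∈ Finset.Icc 1 T, |x t| ≤ 1)
    (hg : ∀ t ∈ Finset.Icc 1 T, g t = ((d:ℝ) * x t) • (R t).mulVec (s t))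
    (hsch : Sched T (Real.exp (1 / (100 * d * Real.log (ν * T)))) η H S e)
    (hopt : ∀ t ∈ Finset.Icc 1 T, ∀ y ∈ shr K w1 (1 - 1 / (T:ℝ)),
      dotp (liftv (W (t + 1))) (g t)
        + (1 / e t) * breg (liftedBarrier ψ ν) (liftv (W (t + 1))) (liftv (W t)) ≤
      dotp (liftv y) (g t) + (1 / e t) * breg (liftedBarrier ψ ν) (liftv y) (liftv (W t)))
    (hρ : ∃ t ∈ Finset.Icc 1 T, ρ = qnorm (H t) (liftv u)) :
    ∑ t ∈ Finset.Icc 1 T, dotp (liftv (W t) - liftv u) (g t) ≤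
      ν / η * (800 * Real.log T + 805) + 2 * η * d ^ 2 * ∑ t ∈ Finset.Icc 1 T, |x t|
        - ρ / (40 * η * d * Real.log (ν * T)) := by
  obtain ⟨hL, hLT, hLT0, -⟩ := logνT hν hT
  have hT' : (2:ℝ) ≤ T := by exact_mod_cast hT
  have hd' : (1:ℝ) ≤ d := by exact_mod_cast hd
  set Lg := Real.log (ν * T) with hLg
  set β := 1 / (100 * d * Lg) with hβ
  have hdL : 0.69 ≤ d * Lg := by nlinarith
  have hβ0 : 0 < β := by rw [hβ]; positivity
  have hβ1 : β ≤ 1 / 69 := by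
    rw [hβ]; apply one_div_le_one_div_of_le <;> nlinarith
  have hβd : β * (d * Lg) = 1 / 100 := by rw [hβ]; field_simp
  set κ := Real.exp β with hκ
  have hκ1 : β ≤ κ - 1 := by linarith [Real.add_one_le_exp β]
  have hκ2 : κ - 1 ≤ 2 * β := by
    have := Real.abs_exp_sub_one_le (x := β) (by rw [abs_of_pos hβ0]; linarith)
    rw [abs_of_pos hβ0] at this
    exact (le_abs_self _).trans this
  have hκ0 : 0 < κ := Real.exp_pos _
  have hsub : ∀ t ∈ Finset.Icc 1 T, t ∈ Finset.Icc 1 (T + 1) := fun t ht => by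
    have := Finset.mem_Icc.mp ht
    exact Finset.mem_Icc.mpr ⟨this.1, by omega⟩
  have hquad : ∀ t ∈ Finset.Icc 1 (T + 1), ∀ p, dotp p ((H t).mulVec p) =
      der2 (liftedBarrier ψ ν) (liftv (W t)) p p := fun t ht p => by
    rw [hH t ht, dotp_hess]
  have h1T1 : 1 ∈ Finset.Icc 1 (T + 1) := Finset.mem_Icc.mpr ⟨le_rfl, by omega⟩
  have hcount : ∀ t ∈ Finset.Icc 1 T, (((S t).card - 1 : ℕ) : ℝ) ≤ 50 * d * Lg := by
    intro t ht
    refine count_real hd hν hT (hsch.count hHpd (fun t ht p => ?_) ht)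
    rw [hquad t (hsub t ht), hquad 1 h1T1, hW1]
    exact hψ.hess_le hK hν hw1 hT' hmin (hW t (hsub t ht)) p
  have he : ∀ t ∈ Finset.Icc 1 T, η ≤ e t ∧ e t ≤ 2 * η := by
    intro t ht
    obtain ⟨-, -, c, -⟩ := hsch.basic hHpd t (Finset.mem_Icc.mp ht).1 (by have := (Finset.mem_Icc.mp ht).2; omega)
    have hc := hcount t ht
    rw [c]
    have e1 : κ ^ ((S t).card - 1) = Real.exp (((S t).card - 1 : ℕ) * β) := by
      rw [hκ, ← Real.exp_nat_mul]
    have e2 : (((S t).card - 1 : ℕ) : ℝ) * β ≤ 1 / 2 := by nlinarith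
    have e3 : Real.exp (((S t).card - 1 : ℕ) * β) ≤ 2 := by
      refine (Real.exp_le_exp.mpr e2).trans ?_
      have := Real.exp_one_lt_d9
      have e4 : Real.exp (1 / 2) ^ 2 = Real.exp 1 := by rw [← Real.exp_nat_mul]; norm_num
      nlinarith [Real.exp_pos (1 / 2)]
    have e5 : 1 ≤ Real.exp (((S t).card - 1 : ℕ) * β) := Real.one_le_exp (by positivity)
    rw [e1]
    constructor <;> nlinarith
  set D : ℕ → ℝ := fun t => breg (liftedBarrier ψ ν) (liftv u) (liftv (W t)) with hD
  have hint : ∀ w ∈ shr K w1 (1 - 1 / (T:ℝ)), w ∈ interior K := fun w hw => shr_int hK hw1 hT' hw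
  have hstep : ∀ t ∈ Finset.Icc 1 T, dotp (liftv (W t) - liftv u) (g t) ≤
      (D t - D (t + 1)) / e t + 2 * η * d ^ 2 * |x t| := by
    intro t ht
    have ht1 : t + 1 ∈ Finset.Icc 1 (T + 1) := by
      have := Finset.mem_Icc.mp ht
      exact Finset.mem_Icc.mpr ⟨by omega, by omega⟩
    obtain ⟨h1, h2⟩ := he t ht
    have := hψ.omd_step hK (shr_convex hK _) hint (hint _ (hW t (hsub t ht))) (hW _ ht1) hu (hRs t ht)
      (by rw [hR t ht, hH t (hsub t ht)]) (hs t ht) (hx t ht) (hg t ht) (by linarith)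
      (by nlinarith) (hopt t ht)
    refine this.trans ?_
    have h3 : e t * d ^ 2 * |x t| ≤ 2 * η * d ^ 2 * |x t| := by gcongr
    linarith
  have hsum := Finset.sum_le_sum hstep
  rw [Finset.sum_add_distrib, ← Finset.mul_sum, hsch.parts hHpd hκ0 hη D (by omega)] at hsum
  refine hsum.trans ?_
  have hD1 : D 1 ≤ 400 * ν * Real.log T := by
    simp only [hD, hW1]; exact hψ.D1_le hK hν hw1 hT' hmin hu
  have hTm : T ∈ Finset.Icc 1 T := Finset.mem_Icc.mpr ⟨by omega, le_rfl⟩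
  have hDT : 0 ≤ D (T + 1) / e T := by
    refine div_nonneg (hψ.breg_nonneg hK (hint _ hu) (hint _ (hW _ (Finset.mem_Icc.mpr ⟨by omega, le_rfl⟩)))) ?_
    linarith [(he T hTm).1]
  set E := 400 * ν * (2 + Real.log T) with hE
  have hE0 : 0 ≤ E := by positivity
  obtain ⟨h1S, hSsub, -, -⟩ := hsch.basic hHpd T (by omega) (by omega)
  have hSm : ∀ t ∈ S T, t ∈ Finset.Icc 1 T := fun t ht => hSsub ht
  have hterm : ∀ t ∈ (S T).erase 1, 5 * β / (2 * η) * qnorm (H t) (liftv u) - 2 * β / η * E ≤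
      (κ - 1) * D t / e t := by
    intro t ht
    have htI := hSm t (Finset.mem_of_mem_erase ht)
    obtain ⟨h1, h2⟩ := he t htI
    have hl := hψ.D_lower hK hν hw1 hT' hmin (interior_subset (hint _ hu)) (hW t (hsub t htI))
    rw [← hquad t (hsub t htI)] at hl
    change 5 * qnorm (H t) (liftv u) - E ≤ D t at hl
    have hq0 : 0 ≤ qnorm (H t) (liftv u) := Real.sqrt_nonneg _
    have he0 : 0 < e t := by linarith
    have q1 : β / (2 * η) ≤ (κ - 1) / e t := by
      rw [div_le_div_iff₀ (by linarith) he0]; nlinarith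
    have q2 : (κ - 1) / e t ≤ 2 * β / η := by
      rw [div_le_div_iff₀ he0 hη]; nlinarith
    have q0 : 0 ≤ (κ - 1) / e t := div_nonneg (by linarith) he0.le
    have e1 : (κ - 1) * D t / e t = (κ - 1) / e t * D t := by ring
    have e2 : 5 * β / (2 * η) = 5 * (β / (2 * η)) := by ring
    rw [e1, e2]
    have z1 := mul_le_mul_of_nonneg_left hl q0
    have z2 := mul_le_mul_of_nonneg_right q1 hq0
    have z3 := mul_le_mul_of_nonneg_right q2 hE0
    rw [mul_sub] at z1
    have z4 : (κ - 1) / e t * (5 * qnorm (H t) (liftv u)) = 5 * ((κ - 1) / e t * qnorm (H t) (liftv u)) := by ring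
    have z5 : 5 * (β / (2 * η)) * qnorm (H t) (liftv u) = 5 * (β / (2 * η) * qnorm (H t) (liftv u)) := by ring
    rw [z4] at z1
    rw [z5]
    linarith
  have hs2 := Finset.sum_le_sum hterm
  rw [Finset.sum_sub_distrib, ← Finset.mul_sum, Finset.sum_const, Finset.card_erase_of_mem h1S,
    nsmul_eq_mul] at hs2
  have hcnt : (((S T).card - 1 : ℕ) : ℝ) * (2 * β / η * E) ≤ E / η := by
    have hc := hcount T hTm
    have : (((S T).card - 1 : ℕ) : ℝ) * (2 * β) ≤ 1 := by nlinarith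
    calc (((S T).card - 1 : ℕ) : ℝ) * (2 * β / η * E) = (((S T).card - 1 : ℕ) : ℝ) * (2 * β) * (E / η) := by ring
      _ ≤ 1 * (E / η) := mul_le_mul_of_nonneg_right this (by positivity)
      _ = _ := one_mul _
  have hρ2 : ρ - 134 * ν ≤ ∑ t ∈ (S T).erase 1, qnorm (H t) (liftv u) := by
    obtain ⟨t, ht, rfl⟩ := hρ
    have h1 := hsch.norm_le hHpd (liftv u) ht
    rw [← Finset.add_sum_erase _ _ h1S] at h1
    have h2 := hψ.norm1_le hK hν hw1 hmin (interior_subset (hint _ hu))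
    rw [← hW1, ← hquad 1 h1T1] at h2
    change qnorm (H 1) (liftv u) ≤ _ at h2
    linarith
  have hρ3 := mul_le_mul_of_nonneg_left hρ2 (show 0 ≤ 5 * β / (2 * η) by positivity)
  have e7 : ρ / (40 * η * d * Lg) = 5 * β / (2 * η) * ρ := by
    rw [hβ]; field_simp; ring
  have e8 : 5 * β / (2 * η) * (134 * ν) ≤ 5 * ν / η := by
    have : 5 * β / (2 * η) * (134 * ν) = 335 * β * (ν / η) := by field_simp; ring
    rw [this, mul_div_assoc]
    exact mul_le_mul_of_nonneg_right (by linarith) (by positivity)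
  have e9 : D 1 / η ≤ 400 * ν * Real.log T / η := by gcongr
  have e10 : ν / η * (800 * Real.log T + 805) = 400 * ν * Real.log T / η + E / η + 5 * ν / η := by
    rw [hE]; ring
  rw [e7, e10]
  rw [mul_sub] at hρ3
  linarith
end


/-! ### Moments of the uniform measure on the sphere orthogonal to `v` -/

noncomputable def hh {n : ℕ} (a : Fin n → ℝ) : Matrix (Fin n) (Fin n) ℝ :=
  1 - (2 / dotp a a) • Matrix.vecMulVec a a

lemma hh_mulVec {n : ℕ} (a x : Fin n → ℝ) : (hh a).mulVec x = x - (2 / dotp a a * dotp a x) • a := by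
  unfold hh
  rw [Matrix.sub_mulVec, Matrix.one_mulVec, Matrix.smul_mulVec, Matrix.vecMulVec_mulVec]
  ext i
  simp [dotp_eq]
  ring

lemma hh_symm {n : ℕ} (a : Fin n → ℝ) : (hh a)ᵀ = hh a := by
  unfold hh
  rw [Matrix.transpose_sub, Matrix.transpose_one, Matrix.transpose_smul, Matrix.transpose_vecMulVec]

lemma hh_sq {n : ℕ} {a : Fin n → ℝ} (ha : a ≠ 0) : hh a * hh a = 1 := by
  have h0 := dotp_self_pos ha
  apply Matrix.ext_of_mulVec_single
  intro i
  rw [← Matrix.mulVec_mulVec, Matrix.one_mulVec, hh_mulVec, hh_mulVec, dotp_sub_right, dotp_smul_right]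
  ext j
  simp
  field_simp
  ring

section
variable {n : ℕ} {P : Measure (Fin n → ℝ)} [IsProbabilityMeasure P] {v : Fin n → ℝ}

lemma dotp_cont (a : Fin n → ℝ) : Continuous fun x : Fin n → ℝ => dotp a x := by
  unfold dotp; fun_prop

lemma sph_int2 (hs : ∀ᵐ x ∂P, dotp x x = 1 ∧ dotp x v = 0) (a c : Fin n → ℝ) :
    Integrable (fun x => dotp a x * dotp c x) P := by
  refine Integrable.of_bound (C := (√(dotp a a)) * (√(dotp c c)))
    ((dotp_cont a).mul (dotp_cont c)).aestronglyMeasurable ?_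
  filter_upwards [hs] with x hx
  rw [Real.norm_eq_abs, abs_mul]
  have h1 := dotp_cs_abs a x
  have h2 := dotp_cs_abs c x
  rw [hx.1, Real.sqrt_one, mul_one] at h1 h2
  exact mul_le_mul h1 h2 (abs_nonneg _) (Real.sqrt_nonneg _)

lemma sph_inv (hO : ∀ O : Matrix (Fin n) (Fin n) ℝ, Oᵀ * O = 1 → O.mulVec v = v → P.map O.mulVec = P)
    (O : Matrix (Fin n) (Fin n) ℝ) (h1 : Oᵀ * O = 1) (h2 : O.mulVec v = v) (f : (Fin n → ℝ) → ℝ)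
    (hf : Continuous f) : ∫ x, f (O.mulVec x) ∂P = ∫ x, f x ∂P := by
  conv_rhs => rw [← hO O h1 h2]
  rw [integral_map]
  · exact (Continuous.matrix_mulVec continuous_const continuous_id).aemeasurable
  · exact hf.aestronglyMeasurable

lemma sph_mean (hv : v ≠ 0) (hs : ∀ᵐ x ∂P, dotp x x = 1 ∧ dotp x v = 0)
    (hO : ∀ O : Matrix (Fin n) (Fin n) ℝ, Oᵀ * O = 1 → O.mulVec v = v → P.map O.mulVec = P)
    (a : Fin n → ℝ) : ∫ x, dotp a x ∂P = 0 := by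
  have h0 := dotp_self_pos hv
  have h := sph_inv hO (-hh v) (by rw [Matrix.transpose_neg, hh_symm, neg_mul_neg, hh_sq hv]) (by
    rw [Matrix.neg_mulVec, hh_mulVec]
    ext j; simp; field_simp; ring) (dotp a) (dotp_cont a)
  have h2 : ∫ x, dotp a ((-hh v).mulVec x) ∂P = ∫ x, - dotp a x ∂P := by
    apply integral_congr_ae
    filter_upwards [hs] with x hx
    rw [Matrix.neg_mulVec, hh_mulVec, dotp_comm' v x, hx.2, mul_zero, zero_smul, sub_zero]
    simp [dotp]
  rw [h2, integral_neg] at h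
  linarith

lemma sph_eq (hv : v ≠ 0)
    (hO : ∀ O : Matrix (Fin n) (Fin n) ℝ, Oᵀ * O = 1 → O.mulVec v = v → P.map O.mulVec = P)
    {p q : Fin n → ℝ} (hp : dotp p v = 0) (hq : dotp q v = 0) (hpq : dotp p p = dotp q q) :
    ∫ x, dotp p x * dotp p x ∂P = ∫ x, dotp q x * dotp q x ∂P := by
  by_cases hne : p - q = 0
  · rw [sub_eq_zero.mp hne]
  have h0 := dotp_self_pos hne
  have h := sph_inv hO (hh (p - q)) (by rw [hh_symm, hh_sq hne]) (by
    rw [hh_mulVec, show dotp (p - q) v = 0 by rw [dotp_sub_left, hp, hq, sub_zero]]; simp)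
    (fun x => dotp q x * dotp q x)
    ((dotp_cont q).mul (dotp_cont q))
  rw [← h]
  congr 1
  ext x
  have : dotp q ((hh (p - q)).mulVec x) = dotp p x := by
    rw [dotp_mulVec_symm (hh_symm _), hh_mulVec]
    have e : 2 / dotp (p - q) (p - q) * dotp (p - q) q = -1 := by
      rw [div_mul_eq_mul_div, div_eq_iff h0.ne']
      simp only [dotp_sub_left, dotp_sub_right, dotp_comm' q p]
      linarith
    rw [e]
    congr 1
    ext i; simp
  rw [this]

lemma sph_quad {d : ℕ} (hn : n = d + 1) (hv : v ≠ 0) (hs : ∀ᵐ x ∂P, dotp x x = 1 ∧ dotp x v = 0)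
    (hO : ∀ O : Matrix (Fin n) (Fin n) ℝ, Oᵀ * O = 1 → O.mulVec v = v → P.map O.mulVec = P)
    {p : Fin n → ℝ} (hp : dotp p v = 0) :
    d * ∫ x, dotp p x * dotp p x ∂P = dotp p p := by
  have h0 := dotp_self_pos hv
  let Q : (Fin n → ℝ) → ℝ := fun p => ∫ x, dotp p x * dotp p x ∂P
  have hsc : ∀ (c : ℝ) (p : Fin n → ℝ), Q (c • p) = c ^ 2 * Q p := by
    intro c p
    simp only [Q, dotp_smul_left]
    rw [← integral_const_mul]
    congr 1; ext x; ring
  have hcross : ∀ q : Fin n → ℝ, dotp q v = 0 → dotp q q * Q p = dotp p p * Q q := by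
    intro q hq
    have := sph_eq (P := P) hv hO (p := √(dotp q q) • p) (q := √(dotp p p) • q)
      (by rw [dotp_smul_left, hp, mul_zero]) (by rw [dotp_smul_left, hq, mul_zero])
      (by simp only [dotp_smul_left, dotp_smul_right, ← mul_assoc]
          rw [Real.mul_self_sqrt (dotp_self_nonneg _), Real.mul_self_sqrt (dotp_self_nonneg _)]; ring)
    change Q _ = Q _ at this
    rwa [hsc, hsc, Real.sq_sqrt (dotp_self_nonneg _), Real.sq_sqrt (dotp_self_nonneg _)] at this
  let e : Fin n → Fin n → ℝ := fun i => Pi.single i 1 - (v i / dotp v v) • v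
  have hev : ∀ i, dotp (e i) v = 0 := by
    intro i
    simp only [e, dotp_sub_left, dotp_smul_left]
    rw [dotp_eq, single_one_dotProduct]; field_simp; ring
  have hee : ∀ i, dotp (e i) (e i) = 1 - v i * v i / dotp v v := by
    intro i
    have : dotp (e i) (e i) = dotp (e i) (Pi.single i 1) - v i / dotp v v * dotp (e i) v := by
      conv_lhs => rw [show e i = Pi.single i 1 - (v i / dotp v v) • v from rfl]
      rw [dotp_sub_right, dotp_smul_right]
    rw [this, hev, mul_zero, sub_zero, dotp_eq, dotProduct_single_one]
    simp [e]; ring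
  have hQe : ∀ i, Q (e i) = ∫ x, x i * x i ∂P := by
    intro i
    apply integral_congr_ae
    filter_upwards [hs] with x hx
    have : dotp (e i) x = x i := by
      simp only [e, dotp_sub_left, dotp_smul_left]
      rw [dotp_comm' v x, hx.2, dotp_eq, single_one_dotProduct]; ring
    rw [this]
  have hsum1 : ∑ i, Q (e i) = 1 := by
    simp only [hQe]
    rw [← integral_finsetSum]
    · have : ∫ x, ∑ i, x i * x i ∂P = ∫ x, (1:ℝ) ∂P := by
        apply integral_congr_ae
        filter_upwards [hs] with x hx
        exact hx.1
      rw [this]; simp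
    · intro i _
      have := sph_int2 (P := P) hs (Pi.single i 1) (Pi.single i 1)
      simpa [dotp_eq, single_one_dotProduct] using this
  have hsum2 : ∑ i, dotp (e i) (e i) = d := by
    simp only [hee]
    rw [Finset.sum_sub_distrib, ← Finset.sum_div]
    have : ∑ i, v i * v i = dotp v v := rfl
    rw [this, div_self h0.ne', hn]
    simp [hn]
  have h3 : ∑ i, dotp (e i) (e i) * Q p = ∑ i, dotp p p * Q (e i) :=
    Finset.sum_congr rfl fun i _ => hcross (e i) (hev i)
  rw [← Finset.sum_mul, ← Finset.mul_sum, hsum1, hsum2, mul_one] at h3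
  exact h3

lemma sph_bil {d : ℕ} (hn : n = d + 1) (hv : v ≠ 0) (hs : ∀ᵐ x ∂P, dotp x x = 1 ∧ dotp x v = 0)
    (hO : ∀ O : Matrix (Fin n) (Fin n) ℝ, Oᵀ * O = 1 → O.mulVec v = v → P.map O.mulVec = P)
    (a : Fin n → ℝ) {c : Fin n → ℝ} (hc : dotp c v = 0) :
    d * ∫ x, dotp a x * dotp c x ∂P = dotp a c := by
  have h0 := dotp_self_pos hv
  obtain ⟨a', ha'⟩ : ∃ a' : Fin n → ℝ, a' = a - (dotp a v / dotp v v) • v := ⟨_, rfl⟩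
  have ha'v : dotp a' v = 0 := by
    rw [ha', dotp_sub_left, dotp_smul_left]; field_simp; ring
  have e1 : ∫ x, dotp a x * dotp c x ∂P = ∫ x, dotp a' x * dotp c x ∂P := by
    apply integral_congr_ae
    filter_upwards [hs] with x hx
    rw [ha', dotp_sub_left, dotp_smul_left, dotp_comm' v x, hx.2]; ring
  have e2 : dotp a c = dotp a' c := by
    rw [ha', dotp_sub_left, dotp_smul_left, dotp_comm' v c, hc]; ring
  have q1 := sph_quad hn hv hs hO (p := a' + c) (by rw [dotp_add_left, ha'v, hc, add_zero])
  have q2 := sph_quad hn hv hs hO (p := a' - c) (by rw [dotp_sub_left, ha'v, hc, sub_zero])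
  have e3 : ∫ x, dotp a' x * dotp c x ∂P = (∫ x, dotp (a' + c) x * dotp (a' + c) x ∂P
      - ∫ x, dotp (a' - c) x * dotp (a' - c) x ∂P) / 4 := by
    rw [← integral_sub (sph_int2 hs _ _) (sph_int2 hs _ _), ← integral_div]
    congr 1; ext x
    rw [dotp_add_left, dotp_sub_left]; ring
  rw [e1, e2, e3]
  have : dotp a' c = (dotp (a' + c) (a' + c) - dotp (a' - c) (a' - c)) / 4 := by
    simp only [dotp_add_left, dotp_sub_left, dotp_add_right, dotp_sub_right, dotp_comm' c a']; ring
  rw [this, ← q1, ← q2]; ring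
end


section
variable {Ω : Type} {m0 : MeasurableSpace Ω} {μ : Measure Ω} [IsProbabilityMeasure μ]

lemma superm {F : ℕ → MeasurableSpace Ω} (hF : Monotone F) (hle : ∀ t, F t ≤ m0)
    {T : ℕ} {ξ v : ℕ → Ω → ℝ} {B : ℝ}
    (hξ : ∀ t ∈ Icc 1 T, Measurable[F (t + 1)] (ξ t)) (hv : ∀ t ∈ Icc 1 T, Measurable[F t] (v t))
    (hξB : ∀ t ∈ Icc 1 T, ∀ ω, |ξ t ω| ≤ B) (hvB : ∀ t ∈ Icc 1 T, ∀ᵐ ω ∂μ, 0 ≤ v t ω)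
    (hc : ∀ t ∈ Icc 1 T, μ[fun ω => exp (ξ t ω) | F t] ≤ᵐ[μ] fun ω => 1 + v t ω) :
    ∀ n ≤ T, Integrable (fun ω => exp (∑ t ∈ Icc 1 n, (ξ t ω - v t ω))) μ ∧
      ∫ ω, exp (∑ t ∈ Icc 1 n, (ξ t ω - v t ω)) ∂μ ≤ 1 := by
  have hmeas : ∀ n ≤ T, Measurable[F (n + 1)] fun ω => exp (∑ t ∈ Icc 1 n, (ξ t ω - v t ω)) := by
    intro n hn
    refine Real.measurable_exp.comp ?_
    refine Finset.measurable_sum _ fun t ht => ?_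
    have ht' : t ∈ Icc 1 T := by simp at ht ⊢; omega
    have htn : t ≤ n := by simp at ht; omega
    exact ((hξ t ht').mono (hF (by omega)) le_rfl).sub ((hv t ht').mono (hF (by omega)) le_rfl)
  have hint : ∀ n ≤ T, Integrable (fun ω => exp (∑ t ∈ Icc 1 n, (ξ t ω - v t ω))) μ := by
    intro n hn
    refine Integrable.of_bound (C := exp (∑ t ∈ Icc 1 n, B))
      ((hmeas n hn).mono (hle _) le_rfl).aestronglyMeasurable ?_
    have : ∀ᵐ ω ∂μ, ∀ t ∈ Icc 1 T, 0 ≤ v t ω := by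
      rw [Finset.eventually_all]; exact hvB
    filter_upwards [this] with ω hω
    rw [Real.norm_eq_abs, abs_of_pos (exp_pos _)]
    apply exp_le_exp.mpr
    apply Finset.sum_le_sum
    intro t ht
    have ht' : t ∈ Icc 1 T := by simp at ht ⊢; omega
    have := (abs_le.mp (hξB t ht' ω)).2
    linarith [hω t ht']
  intro n
  induction n with
  | zero => intro _; exact ⟨hint 0 (by omega), by simp⟩
  | succ n ih =>
    intro hn
    have ht : n + 1 ∈ Icc 1 T := by simp; omega
    refine ⟨hint _ hn, ?_⟩
    obtain ⟨i1, i2⟩ := ih (by omega)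
    set f : Ω → ℝ := fun ω => exp (∑ t ∈ Icc 1 n, (ξ t ω - v t ω)) * exp (-v (n + 1) ω) with hf
    set g : Ω → ℝ := fun ω => exp (ξ (n + 1) ω) with hg
    have e : (fun ω => exp (∑ t ∈ Icc 1 (n + 1), (ξ t ω - v t ω))) = f * g := by
      ext ω
      simp only [hf, hg, Pi.mul_apply]
      rw [Finset.sum_Icc_succ_top (by omega), ← exp_add, ← exp_add]
      congr 1; ring
    have hfm : StronglyMeasurable[F (n + 1)] f := by
      apply Measurable.stronglyMeasurable
      exact (hmeas n (by omega)).mul (Real.measurable_exp.comp (hv _ ht).neg)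
    have hgi : Integrable g μ := by
      refine Integrable.of_bound (C := exp B)
        (Real.measurable_exp.comp ((hξ _ ht).mono (hle _) le_rfl)).aestronglyMeasurable ?_
      filter_upwards with ω
      rw [Real.norm_eq_abs, abs_of_pos (exp_pos _)]
      exact exp_le_exp.mpr (abs_le.mp (hξB _ ht ω)).2
    have hfg : Integrable (f * g) μ := by rw [← e]; exact hint _ hn
    have hpull := condExp_mul_of_stronglyMeasurable_left (m := F (n + 1)) hfm hfg hgi
    have h1 : ∫ ω, exp (∑ t ∈ Icc 1 (n + 1), (ξ t ω - v t ω)) ∂μ = ∫ ω, (μ[f * g | F (n + 1)]) ω ∂μ := by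
      rw [integral_condExp (hle _)]
      rw [e]
    rw [h1]
    refine le_trans (integral_mono_ae integrable_condExp i1 ?_) i2
    filter_upwards [hpull, hc _ ht] with ω h2 h3
    rw [h2, Pi.mul_apply]
    have hfp : 0 ≤ f ω := by simp only [hf]; positivity
    calc f ω * (μ[g | F (n + 1)]) ω ≤ f ω * (1 + v (n + 1) ω) := mul_le_mul_of_nonneg_left h3 hfp
      _ ≤ f ω * exp (v (n + 1) ω) := by
          apply mul_le_mul_of_nonneg_left _ hfp
          linarith [add_one_le_exp (v (n + 1) ω)]
      _ = _ := by
          simp only [hf]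
          rw [mul_assoc, ← exp_add]; simp

lemma exp_quad {y : ℝ} (h : |y| ≤ 1) : exp y ≤ 1 + y + y ^ 2 := by
  have := (abs_le.mp (Real.abs_exp_sub_one_sub_id_le h)).2
  linarith

lemma one_step {m : MeasurableSpace Ω} (hm : m ≤ m0) {X x G a : Ω → ℝ} {l B : ℝ} (hl : 0 < l) (hl1 : l ≤ 1)
    (hX : Measurable[m0] X) (hG : Measurable[m] G) (hGB : ∀ ω, G ω ≤ B) (hXG : ∀ ω, |X ω| ≤ G ω)
    (ha : Measurable[m] a) (ha1 : ∀ ω, |a ω| ≤ 1) (hx : Measurable[m0] x) (hx1 : ∀ ω, |x ω| ≤ 1)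
    (hq : ∀ ω, X ω ^ 2 ≤ G ω ^ 2 * |x ω| - 2 * a ω * X ω) (h0 : μ[X | m] =ᵐ[μ] 0) :
    μ[fun ω => exp (if l * G ω ≤ 1 then l * X ω else 0) | m] ≤ᵐ[μ]
      fun ω => 1 + if l * G ω ≤ 1 then l ^ 2 * G ω ^ 2 * (μ[fun ω => |x ω| | m]) ω else 0 := by
  have hms : MeasurableSet[m] {ω | l * G ω ≤ 1} :=
    (hG.const_mul l) measurableSet_Iic
  set β : Ω → ℝ := fun ω => if l * G ω ≤ 1 then l - 2 * l ^ 2 * a ω else 0 with hβ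
  set γ : Ω → ℝ := fun ω => if l * G ω ≤ 1 then l ^ 2 * G ω ^ 2 else 0 with hγ
  have hβm : Measurable[m] β := Measurable.ite hms (measurable_const.sub (measurable_const.mul ha)) measurable_const
  have hγm : Measurable[m] γ := Measurable.ite hms (measurable_const.mul (hG.pow_const 2)) measurable_const
  have hβ3 : ∀ ω, |β ω| ≤ 3 := by
    intro ω
    simp only [hβ]
    split_ifs
    · obtain ⟨h1, h2⟩ := abs_le.mp (ha1 ω)
      have : l ^ 2 ≤ 1 := by nlinarith
      rw [abs_le]; constructor <;> nlinarith [sq_nonneg l]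
    · simp
  have hG0 : ∀ ω, 0 ≤ G ω := fun ω => (abs_nonneg _).trans (hXG ω)
  have hγ1 : ∀ ω, |γ ω| ≤ 1 := by
    intro ω
    simp only [hγ]
    split_ifs with h
    · rw [abs_of_nonneg (by positivity), ← mul_pow]
      have : 0 ≤ l * G ω := mul_nonneg hl.le (hG0 ω)
      exact pow_le_one₀ this h
    · simp
  have hXi : Integrable X μ := Integrable.of_bound (C := B) hX.aestronglyMeasurable
    (Filter.Eventually.of_forall fun ω => (hXG ω).trans (hGB ω))
  have hxi : Integrable (fun ω => |x ω|) μ := Integrable.of_bound (C := 1) (continuous_abs.measurable.comp hx).aestronglyMeasurable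
    (Filter.Eventually.of_forall fun ω => by simpa using hx1 ω)
  have i1 : Integrable (β * X) μ := hXi.bdd_mul (c := 3) (hβm.mono hm le_rfl).aestronglyMeasurable
    (Filter.Eventually.of_forall hβ3)
  have i2 : Integrable (γ * fun ω => |x ω|) μ := hxi.bdd_mul (c := 1) (hγm.mono hm le_rfl).aestronglyMeasurable
    (Filter.Eventually.of_forall hγ1)
  have p1 := condExp_mul_of_stronglyMeasurable_left (m := m) hβm.stronglyMeasurable i1 hXi
  have p2 := condExp_mul_of_stronglyMeasurable_left (m := m) hγm.stronglyMeasurable i2 hxi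
  have hpt : ∀ ω, exp (if l * G ω ≤ 1 then l * X ω else 0) ≤ 1 + ((β * X) ω + (γ * fun ω => |x ω|) ω) := by
    intro ω
    simp only [Pi.mul_apply, hβ, hγ]
    split_ifs with h
    · have h1 : |l * X ω| ≤ 1 := by
        rw [abs_mul, abs_of_pos hl]
        exact (mul_le_mul_of_nonneg_left (hXG ω) hl.le).trans h
      have := exp_quad h1
      nlinarith [mul_le_mul_of_nonneg_left (hq ω) (sq_nonneg l)]
    · simp
  have hem : Measurable[m0] fun ω => exp (if l * G ω ≤ 1 then l * X ω else 0) :=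
    Real.measurable_exp.comp (Measurable.ite (hm _ hms) (measurable_const.mul hX) measurable_const)
  have i3 : Integrable (fun ω => 1 + ((β * X) ω + (γ * fun ω => |x ω|) ω)) μ :=
    (integrable_const 1).add (i1.add i2)
  have i4 : Integrable (fun ω => exp (if l * G ω ≤ 1 then l * X ω else 0)) μ := by
    refine i3.mono hem.aestronglyMeasurable (Filter.Eventually.of_forall fun ω => ?_)
    rw [Real.norm_eq_abs, Real.norm_eq_abs, abs_of_pos (exp_pos _)]
    exact (hpt ω).trans (le_abs_self _)
  have hmono := condExp_mono (m := m) i4 i3 (Filter.Eventually.of_forall hpt)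
  have s1 := condExp_add (integrable_const (1:ℝ)) (i1.add i2) m
  have s2 := condExp_add i1 i2 m
  have s0 : μ[fun _ => (1:ℝ) | m] = fun _ => 1 := condExp_const hm 1
  filter_upwards [hmono, s1, s2, p1, p2, h0] with ω a1 a2 a3 a4 a5 a6
  refine a1.trans ?_
  have e : (fun ω => 1 + ((β * X) ω + (γ * fun ω => |x ω|) ω)) = (fun _ => (1:ℝ)) + (β * X + γ * fun ω => |x ω|) := rfl
  rw [e, a2, Pi.add_apply, a3, Pi.add_apply, a4, a5, s0, Pi.mul_apply, Pi.mul_apply, a6]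
  simp only [hγ]
  split_ifs <;> simp

lemma grid_markov {N : ℕ} (hN : 1 ≤ N) {δ : ℝ} (hδ : 0 < δ) {M : ℕ → Ω → ℝ}
    (hi : ∀ j < N, Integrable (fun ω => exp (M j ω)) μ) (h1 : ∀ j < N, ∫ ω, exp (M j ω) ∂μ ≤ 1) :
    ENNReal.ofReal (1 - δ) ≤ μ {ω | ∀ j < N, M j ω ≤ log (N / δ)} := by
  have hN' : (0:ℝ) < N := by exact_mod_cast hN
  set Z : Ω → ℝ := fun ω => ∑ j ∈ range N, exp (M j ω) with hZ
  have hZi : Integrable Z μ := integrable_finsetSum _ fun j hj => hi j (by simpa using hj)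
  have hZ1 : ∫ ω, Z ω ∂μ ≤ N := by
    simp only [hZ]
    rw [integral_finsetSum _ fun j hj => hi j (by simpa using hj)]
    calc _ ≤ ∑ j ∈ range N, (1:ℝ) := Finset.sum_le_sum fun j hj => h1 j (by simpa using hj)
      _ = N := by simp
  have hmk := mul_meas_ge_le_integral_of_nonneg (μ := μ) (f := Z)
    (Filter.Eventually.of_forall fun ω => Finset.sum_nonneg fun j _ => (exp_pos _).le) hZi (N / δ)
  have hbad : μ.real {ω | N / δ ≤ Z ω} ≤ δ := by
    have : N / δ * μ.real {ω | N / δ ≤ Z ω} ≤ N := hmk.trans hZ1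
    rw [div_mul_eq_mul_div, div_le_iff₀ hδ] at this
    exact le_of_mul_le_mul_left this hN'
  have hsub : {ω | N / δ ≤ Z ω}ᶜ ⊆ {ω | ∀ j < N, M j ω ≤ log (N / δ)} := by
    intro ω hω j hj
    simp only [Set.mem_compl_iff, Set.mem_ofPred_eq, not_le] at hω
    have : exp (M j ω) ≤ Z ω :=
      Finset.single_le_sum (f := fun j => exp (M j ω)) (fun j _ => (exp_pos _).le) (by simpa using hj)
    rw [Real.le_log_iff_exp_le (by positivity)]
    linarith
  refine le_trans ?_ (measure_mono hsub)
  have hnm : NullMeasurableSet {ω | N / δ ≤ Z ω} μ :=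
    nullMeasurableSet_le aemeasurable_const hZi.aemeasurable
  rw [prob_compl_eq_one_sub₀ hnm]
  have : μ {ω | N / δ ≤ Z ω} ≤ ENNReal.ofReal δ := by
    rw [← ENNReal.ofReal_toReal (measure_ne_top μ _)]
    exact ENNReal.ofReal_le_ofReal hbad
  calc ENNReal.ofReal (1 - δ) = 1 - ENNReal.ofReal δ := by
        rw [ENNReal.ofReal_sub _ hδ.le]; simp
    _ ≤ _ := tsub_le_tsub_left this 1
end


section
variable {Ω : Type} {m0 : MeasurableSpace Ω} {μ : Measure Ω} [IsProbabilityMeasure μ]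

lemma freedman {F : ℕ → MeasurableSpace Ω} (hF : Monotone F) (hle : ∀ t, F t ≤ m0)
    {T N : ℕ} (hN : 1 ≤ N) {δ B : ℝ} (hδ : 0 < δ) {X x G a : ℕ → Ω → ℝ}
    (hX : ∀ t ∈ Icc 1 T, Measurable[F (t + 1)] (X t)) (hG : ∀ t ∈ Icc 1 T, Measurable[F t] (G t))
    (hGB : ∀ t ∈ Icc 1 T, ∀ ω, G t ω ≤ B) (hXG : ∀ t ∈ Icc 1 T, ∀ ω, |X t ω| ≤ G t ω)
    (ha : ∀ t ∈ Icc 1 T, Measurable[F t] (a t)) (ha1 : ∀ t ∈ Icc 1 T, ∀ ω, |a t ω| ≤ 1)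
    (hx : ∀ t ∈ Icc 1 T, Measurable[F (t + 1)] (x t)) (hx1 : ∀ t ∈ Icc 1 T, ∀ ω, |x t ω| ≤ 1)
    (hq : ∀ t ∈ Icc 1 T, ∀ ω, X t ω ^ 2 ≤ G t ω ^ 2 * |x t ω| - 2 * a t ω * X t ω)
    (h0 : ∀ t ∈ Icc 1 T, μ[X t | F t] =ᵐ[μ] 0) :
    ENNReal.ofReal (1 - δ) ≤ μ {ω | (∀ t ∈ Icc 1 T, 0 ≤ (μ[fun ω => |x t ω| | F t]) ω ∧
        (μ[fun ω => |x t ω| | F t]) ω ≤ 1) ∧ 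
      ∀ j < N, (∀ t ∈ Icc 1 T, (1/2:ℝ) ^ j * G t ω ≤ 1) →
        (1/2:ℝ) ^ j * ∑ t ∈ Icc 1 T, X t ω ≤ log (N / δ) +
          ∑ t ∈ Icc 1 T, ((1/2:ℝ) ^ j) ^ 2 * G t ω ^ 2 * (μ[fun ω => |x t ω| | F t]) ω} := by
  have hxi : ∀ t ∈ Icc 1 T, Integrable (fun ω => |x t ω|) μ := fun t ht =>
    Integrable.of_bound (C := 1) (((hx t ht).mono (hle _) le_rfl).abs).aestronglyMeasurable
    (Filter.Eventually.of_forall fun ω => by simpa using hx1 t ht ω)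
  have hq0 : ∀ᵐ ω ∂μ, ∀ t ∈ Icc 1 T, 0 ≤ (μ[fun ω => |x t ω| | F t]) ω ∧
        (μ[fun ω => |x t ω| | F t]) ω ≤ 1 := by
    rw [Finset.eventually_all]
    intro t ht
    have h1 := condExp_mono (m := F t) (hxi t ht) (integrable_const (1:ℝ))
      (Filter.Eventually.of_forall fun ω => hx1 t ht ω)
    have h2 : 0 ≤ᵐ[μ] μ[fun ω => |x t ω| | F t] :=
      condExp_nonneg (Filter.Eventually.of_forall fun ω => abs_nonneg _)
    rw [condExp_const (hle t)] at h1
    filter_upwards [h1, h2] with ω a1 a2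
    exact ⟨a2, a1⟩
  set l : ℕ → ℝ := fun j => (1/2:ℝ) ^ j with hl
  have hl0 : ∀ j, 0 < l j := fun j => by simp only [hl]; positivity
  have hl1 : ∀ j, l j ≤ 1 := fun j => pow_le_one₀ (by norm_num) (by norm_num)
  have hs : ∀ j, _ := fun j => superm (μ := μ) hF hle (T := T) (B := 1)
    (ξ := fun t ω => if l j * G t ω ≤ 1 then l j * X t ω else 0)
    (v := fun t ω => if l j * G t ω ≤ 1 then l j ^ 2 * G t ω ^ 2 * (μ[fun ω => |x t ω| | F t]) ω else 0)
    (fun t ht => by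
      refine Measurable.ite ?_ ((hX t ht).const_mul _) measurable_const
      exact (((hG t ht).mono (hF (Nat.le_succ t)) le_rfl).const_mul _) measurableSet_Iic)
    (fun t ht => by
      refine Measurable.ite (((hG t ht).const_mul _) measurableSet_Iic) ?_ measurable_const
      exact (((hG t ht).pow_const 2).const_mul _).mul stronglyMeasurable_condExp.measurable)
    (fun t ht ω => by
      split_ifs with h
      · rw [abs_mul, abs_of_pos (hl0 j)]
        exact (mul_le_mul_of_nonneg_left (hXG t ht ω) (hl0 j).le).trans h
      · simp)
    (fun t ht => by
      filter_upwards [hq0] with ω hω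
      have := (hω t ht).1
      split_ifs <;> positivity)
    (fun t ht => one_step (hle t) (hl0 j) (hl1 j) ((hX t ht).mono (hle _) le_rfl) (hG t ht) (hGB t ht)
      (hXG t ht) (ha t ht) (ha1 t ht) ((hx t ht).mono (hle _) le_rfl) (hx1 t ht) (hq t ht) (h0 t ht)) T le_rfl
  have hm := grid_markov (μ := μ) hN hδ (M := fun j ω => ∑ t ∈ Icc 1 T,
    ((if l j * G t ω ≤ 1 then l j * X t ω else 0) -
      if l j * G t ω ≤ 1 then l j ^ 2 * G t ω ^ 2 * (μ[fun ω => |x t ω| | F t]) ω else 0))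
    (fun j _ => (hs j).1) (fun j _ => (hs j).2)
  refine hm.trans (measure_mono_ae ?_)
  filter_upwards [hq0] with ω hω h
  refine ⟨hω, fun j hj hall => ?_⟩
  have := h j hj
  have e : ∑ t ∈ Icc 1 T,
    ((if l j * G t ω ≤ 1 then l j * X t ω else 0) -
      if l j * G t ω ≤ 1 then l j ^ 2 * G t ω ^ 2 * (μ[fun ω => |x t ω| | F t]) ω else 0) =
      l j * ∑ t ∈ Icc 1 T, X t ω - ∑ t ∈ Icc 1 T, l j ^ 2 * G t ω ^ 2 * (μ[fun ω => |x t ω| | F t]) ω := by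
    rw [Finset.mul_sum, ← Finset.sum_sub_distrib]
    refine Finset.sum_congr rfl fun t ht => ?_
    rw [if_pos (hall t ht), if_pos (hall t ht)]
  rw [e] at this
  simp only [hl] at this ⊢
  linarith

end

lemma grid_choice {N : ℕ} {T : ℕ} {L g : ℝ} {X G q : ℕ → ℝ} (hL : 1 ≤ L) (hg : 1 ≤ g)
    (hgN : g * (1 + √T) ≤ 2 ^ (N - 1)) (hN : 1 ≤ N)
    (hG : ∀ t ∈ Icc 1 T, 0 ≤ G t ∧ G t ≤ g) (hq : ∀ t ∈ Icc 1 T, 0 ≤ q t ∧ q t ≤ 1)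
    (h : ∀ j < N, (∀ t ∈ Icc 1 T, (1/2:ℝ) ^ j * G t ≤ 1) →
        (1/2:ℝ) ^ j * ∑ t ∈ Icc 1 T, X t ≤ L + ∑ t ∈ Icc 1 T, ((1/2:ℝ) ^ j) ^ 2 * G t ^ 2 * q t) :
    ∑ t ∈ Icc 1 T, X t ≤ 3 * g * √(L * ∑ t ∈ Icc 1 T, q t) + 2 * g * L := by
  set Q := ∑ t ∈ Icc 1 T, q t with hQ
  have hQ0 : 0 ≤ Q := Finset.sum_nonneg fun t ht => (hq t ht).1
  have hQT : Q ≤ T := by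
    calc Q ≤ ∑ t ∈ Icc 1 T, (1:ℝ) := Finset.sum_le_sum fun t ht => (hq t ht).2
      _ = T := by simp
  set z := √Q with hz
  set y := √L with hy
  have hz0 : 0 ≤ z := Real.sqrt_nonneg _
  have hz2 : z ^ 2 = Q := Real.sq_sqrt hQ0
  have hy2 : y ^ 2 = L := Real.sq_sqrt (by linarith)
  have hy1 : 1 ≤ y := Real.one_le_sqrt.mpr hL
  have hy0 : 0 < y := by linarith
  have hzT : z ≤ √T := Real.sqrt_le_sqrt hQT
  set A := g * (1 + z / y) with hA
  have hzy : 0 ≤ z / y := by positivity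
  have hA1 : 1 ≤ A := by nlinarith
  have hAN : A ≤ 2 ^ (N - 1) := by
    refine le_trans ?_ hgN
    apply mul_le_mul_of_nonneg_left _ (by linarith)
    have : z / y ≤ z := div_le_self hz0 hy1
    linarith
  -- the smallest power of two above A
  obtain ⟨j, hjN, hj1, hj2⟩ : ∃ j < N, A ≤ 2 ^ j ∧ (2:ℝ) ^ j ≤ 2 * A := by
    classical
    have hex : ∃ j : ℕ, A ≤ (2:ℝ) ^ j := ⟨_, hAN⟩
    refine ⟨Nat.find hex, ?_, Nat.find_spec hex, ?_⟩
    · have := Nat.find_min' hex hAN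
      omega
    · rcases Nat.eq_zero_or_pos (Nat.find hex) with h0 | h0
      · rw [h0]; simp; linarith
      · have := Nat.find_min hex (m := Nat.find hex - 1) (by omega)
        rw [not_le] at this
        have e : (2:ℝ) ^ Nat.find hex = 2 * 2 ^ (Nat.find hex - 1) := by
          rw [← pow_succ']; congr 1; omega
        rw [e]; linarith
  have hAg : g ≤ A := by nlinarith
  set P : ℝ := 2 ^ j with hP
  have hP0 : 0 < P := by positivity
  have hhalf : (1/2:ℝ) ^ j = 1 / P := by rw [hP, div_pow, one_pow]
  have hj := h j hjN (fun t ht => by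
    rw [hhalf, div_mul_eq_mul_div, one_mul, div_le_one hP0]
    linarith [(hG t ht).2])
  rw [hhalf] at hj
  have hs : ∑ t ∈ Icc 1 T, (1 / P) ^ 2 * G t ^ 2 * q t ≤ (1 / P) ^ 2 * g ^ 2 * Q := by
    rw [hQ, Finset.mul_sum]
    apply Finset.sum_le_sum
    intro t ht
    have h1 := hG t ht
    have h2 := (hq t ht).1
    have : G t ^ 2 ≤ g ^ 2 := pow_le_pow_left₀ h1.1 h1.2 2
    gcongr
  have h3 : 1 / P * ∑ t ∈ Icc 1 T, X t ≤ L + (1 / P) ^ 2 * g ^ 2 * Q := by linarith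
  have h4 : ∑ t ∈ Icc 1 T, X t ≤ P * L + g ^ 2 * Q / P := by
    have := mul_le_mul_of_nonneg_left h3 hP0.le
    have e1 : P * (1 / P * ∑ t ∈ Icc 1 T, X t) = ∑ t ∈ Icc 1 T, X t := by field_simp
    have e2 : P * (L + (1 / P) ^ 2 * g ^ 2 * Q) = P * L + g ^ 2 * Q / P := by field_simp
    linarith
  have h5 : g ^ 2 * Q / P ≤ g * (z * y) := by
    rw [div_le_iff₀ hP0]
    have : g * z / y ≤ P := by
      have : g * z / y = g * (z / y) := by ring
      nlinarith
    calc g ^ 2 * Q = g * (z * y) * (g * z / y) := by rw [← hz2]; field_simp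
      _ ≤ _ := by gcongr
  have h6 : P * L ≤ 2 * g * L + 2 * g * (z * y) := by
    calc P * L ≤ 2 * A * L := by gcongr
      _ = _ := by rw [hA, ← hy2]; field_simp
  have h7 : √(L * Q) = z * y := by rw [Real.sqrt_mul (by linarith), mul_comm]
  rw [h7]; linarith


section
variable {Ω : Type} {m0 : MeasurableSpace Ω} {μ : Measure Ω} [IsProbabilityMeasure μ]

lemma mean_zero_gen {ι E : Type} [Fintype ι] [MeasurableSpace E] {m : MeasurableSpace Ω} (hm : m ≤ m0)
    (s : Ω → E) (κ : Ω → Measure E) (g : ι → E → ℝ) (c : ι → Ω → ℝ)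
    (hc : ∀ k, Measurable[m] (c k))
    (hlaw : ∀ k, μ[fun ω => g k (s ω) | m] =ᵐ[μ] fun ω => ∫ x, g k x ∂(κ ω))
    (hg1 : ∀ k x, |g k x| ≤ 1) (hgm : ∀ k, Measurable[m0] fun ω => g k (s ω))
    (h0 : ∀ ω, ∑ k, c k ω * ∫ x, g k x ∂(κ ω) = 0)
    (hXi : Integrable (fun ω => ∑ k, c k ω * g k (s ω)) μ) :
    μ[fun ω => ∑ k, c k ω * g k (s ω) | m] =ᵐ[μ] 0 := by
  set D : Ω → ℝ := fun ω => 1 / (1 + ∑ k, |c k ω|) with hD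
  have hpos : ∀ ω, 0 < 1 + ∑ k, |c k ω| := fun ω => by
    have := Finset.sum_nonneg (s := Finset.univ) (f := fun k => |c k ω|) fun k _ => abs_nonneg _
    linarith
  have hDpos : ∀ ω, 0 < D ω := fun ω => by simp only [hD]; exact div_pos one_pos (hpos ω)
  have hDm : Measurable[m] D := by
    refine Measurable.div measurable_const (measurable_const.add ?_)
    exact Finset.measurable_sum _ fun k _ => (hc k).abs
  have hD1 : ∀ ω, |D ω| ≤ 1 := fun ω => by
    rw [abs_of_pos (hDpos ω)]
    simp only [hD]
    rw [div_le_one (hpos ω)]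
    have := Finset.sum_nonneg (s := Finset.univ) (f := fun k => |c k ω|) fun k _ => abs_nonneg _
    linarith
  have hDc : ∀ k ω, |(D * c k) ω| ≤ 1 := fun k ω => by
    rw [Pi.mul_apply, abs_mul, abs_of_pos (hDpos ω)]
    simp only [hD]
    rw [div_mul_eq_mul_div, one_mul, div_le_one (hpos ω)]
    have := Finset.single_le_sum (s := Finset.univ) (f := fun k => |c k ω|) (fun k _ => abs_nonneg _)
      (Finset.mem_univ k)
    linarith
  set X : Ω → ℝ := fun ω => ∑ k, c k ω * g k (s ω) with hX
  have hDX : Integrable (D * X) μ := hXi.bdd_mul (c := 1) (hDm.mono hm le_rfl).aestronglyMeasurable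
    (Filter.Eventually.of_forall hD1)
  have p1 := condExp_mul_of_stronglyMeasurable_left (m := m) hDm.stronglyMeasurable hDX hXi
  have hgi : ∀ k, Integrable (fun ω => g k (s ω)) μ := fun k =>
    Integrable.of_bound (C := 1) (hgm k).aestronglyMeasurable (Filter.Eventually.of_forall fun ω => hg1 k _)
  have hki : ∀ k, Integrable ((D * c k) * fun ω => g k (s ω)) μ := fun k =>
    (hgi k).bdd_mul (c := 1) ((hDm.mul (hc k)).mono hm le_rfl).aestronglyMeasurable
      (Filter.Eventually.of_forall (hDc k))
  have p2 : ∀ᵐ ω ∂μ, ∀ k ∈ (Finset.univ : Finset ι), (μ[(D * c k) * fun ω => g k (s ω) | m]) ω =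
      ((D * c k) * μ[fun ω => g k (s ω) | m]) ω := by
    rw [Finset.eventually_all]
    intro k _
    exact condExp_mul_of_stronglyMeasurable_left (m := m) (hDm.mul (hc k)).stronglyMeasurable (hki k) (hgi k)
  have p3 : ∀ᵐ ω ∂μ, ∀ k ∈ (Finset.univ : Finset ι), (μ[fun ω => g k (s ω) | m]) ω = ∫ x, g k x ∂(κ ω) := by
    rw [Finset.eventually_all]
    intro k _
    exact hlaw k
  have e : D * X = ∑ k, (D * c k) * fun ω => g k (s ω) := by
    ext ω
    simp only [Pi.mul_apply, hX, Finset.sum_apply, Finset.mul_sum]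
    exact Finset.sum_congr rfl fun k _ => by ring
  have p4 := condExp_finsetSum (s := (Finset.univ : Finset ι)) (fun k _ => hki k) m
  rw [← e] at p4
  filter_upwards [p1, p2, p3, p4] with ω a1 a2 a3 a4
  rw [a1, Pi.mul_apply, Finset.sum_apply] at a4
  have : ∑ k, (μ[(D * c k) * fun ω => g k (s ω) | m]) ω = D ω * ∑ k, c k ω * ∫ x, g k x ∂(κ ω) := by
    rw [Finset.mul_sum]
    refine Finset.sum_congr rfl fun k hk => ?_
    rw [a2 k hk, Pi.mul_apply, a3 k hk, Pi.mul_apply]; ring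
  rw [this, h0, mul_zero] at a4
  rcases mul_eq_zero.mp a4 with h | h
  · exact absurd h (hDpos ω).ne'
  · simpa using h

def cl (t : ℝ) : ℝ := max (-1) (min 1 t)
lemma cl_le (t : ℝ) : |cl t| ≤ 1 := by
  unfold cl
  rw [abs_le]; constructor
  · exact le_max_left _ _
  · exact max_le (by norm_num) (min_le_left _ _)
lemma cl_eq {t : ℝ} (h : |t| ≤ 1) : cl t = t := by
  obtain ⟨h1, h2⟩ := abs_le.mp h
  unfold cl
  rw [min_eq_right h2, max_eq_right h1]
lemma cl_meas : Measurable cl := by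
  unfold cl; fun_prop
lemma coord_le {n : ℕ} {x : Fin n → ℝ} (h : dotp x x = 1) (i : Fin n) : |x i| ≤ 1 := by
  have : x i * x i ≤ ∑ j, x j * x j :=
    Finset.single_le_sum (f := fun j => x j * x j) (fun j _ => mul_self_nonneg _) (Finset.mem_univ i)
  have h' : ∑ j, x j * x j = 1 := h
  rw [h'] at this
  exact abs_le_one_iff_mul_self_le_one.mpr this

lemma step_mean {d : ℕ} {m : MeasurableSpace Ω} (hm : m ≤ m0)
    (s : Ω → Fin (d + 1) → ℝ) (κ : Ω → Measure (Fin (d + 1) → ℝ)) (v : Ω → Fin (d + 1) → ℝ)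
    (hκ : ∀ ω, IsProbabilityMeasure (κ ω)) (hv : ∀ ω, v ω ≠ 0)
    (hsupp : ∀ ω, ∀ᵐ x ∂(κ ω), dotp x x = 1 ∧ dotp x (v ω) = 0)
    (hunif : ∀ ω, ∀ O : Matrix (Fin (d + 1)) (Fin (d + 1)) ℝ, Oᵀ * O = 1 →
          O.mulVec (v ω) = v ω → (κ ω).map O.mulVec = κ ω)
    (hlaw : ∀ g : (Fin (d + 1) → ℝ) → ℝ, Measurable g → (∀ x, |g x| ≤ 1) →
        μ[fun ω => g (s ω) | m] =ᵐ[μ] fun ω => ∫ x, g x ∂(κ ω))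
    (hs : ∀ i, Measurable[m0] fun ω => s ω i) (hss : ∀ ω, dotp (s ω) (s ω) = 1)
    (c0 : Ω → ℝ) (p a c : Ω → Fin (d + 1) → ℝ) (hc0 : Measurable[m] c0)
    (hp : ∀ i, Measurable[m] fun ω => p ω i) (ha : ∀ i, Measurable[m] fun ω => a ω i)
    (hc : ∀ i, Measurable[m] fun ω => c ω i) (hcv : ∀ ω, dotp (c ω) (v ω) = 0)
    (hz : ∀ ω, c0 ω + dotp (a ω) (c ω) = 0) (X : Ω → ℝ)
    (hX : ∀ ω, X ω = c0 ω + dotp (p ω) (s ω) + d * (dotp (a ω) (s ω) * dotp (c ω) (s ω)))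
    (hXi : Integrable X μ) : μ[X | m] =ᵐ[μ] 0 := by
  set g : (Unit ⊕ Fin (d + 1) ⊕ Fin (d + 1) × Fin (d + 1)) → (Fin (d + 1) → ℝ) → ℝ :=
    Sum.elim (fun _ _ => 1) (Sum.elim (fun i x => cl (x i)) (fun ij x => cl (x ij.1) * cl (x ij.2))) with hg
  set k : (Unit ⊕ Fin (d + 1) ⊕ Fin (d + 1) × Fin (d + 1)) → Ω → ℝ :=
    Sum.elim (fun _ => c0) (Sum.elim (fun i ω => p ω i) (fun ij ω => d * (a ω ij.1 * c ω ij.2))) with hk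
  have hgm : ∀ j, Measurable (g j) := by
    rintro (_ | i | ⟨i, j⟩)
    · exact measurable_const
    · exact cl_meas.comp (measurable_pi_apply i)
    · exact (cl_meas.comp (measurable_pi_apply i)).mul (cl_meas.comp (measurable_pi_apply j))
  have hg1 : ∀ j x, |g j x| ≤ 1 := by
    rintro (_ | i | ⟨i, j⟩) x
    · simp [hg]
    · exact cl_le _
    · simp only [hg, Sum.elim_inr]
      rw [abs_mul]
      exact mul_le_one₀ (cl_le _) (abs_nonneg _) (cl_le _)
  have hkm : ∀ j, Measurable[m] (k j) := by
    rintro (_ | i | ⟨i, j⟩)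
    · exact hc0
    · exact hp i
    · exact ((ha i).mul (hc j)).const_mul _
  have hpt : ∀ ω x, dotp x x = 1 → ∑ j, k j ω * g j x =
      c0 ω + dotp (p ω) x + d * (dotp (a ω) x * dotp (c ω) x) := by
    intro ω x hx
    simp only [Fintype.sum_sum_type, hk, hg, Sum.elim_inl, Sum.elim_inr, cl_eq (coord_le hx _)]
    simp only [Finset.univ_unique, Finset.sum_singleton, mul_one, add_assoc]
    congr 2
    simp only [dotp]
    rw [Finset.sum_mul_sum, Finset.mul_sum, Fintype.sum_prod_type]
    refine Finset.sum_congr rfl fun i _ => ?_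
    rw [Finset.mul_sum]
    exact Finset.sum_congr rfl fun j _ => by ring
  have hXe : X = fun ω => ∑ j, k j ω * g j (s ω) := by
    ext ω; rw [hX, hpt ω _ (hss ω)]
  rw [hXe]
  have hsm : Measurable[m0] s := @measurable_pi_lambda _ _ _ m0 _ _ hs
  refine mean_zero_gen hm s κ g k hkm (fun j => hlaw _ (hgm j) (hg1 j)) hg1 
    (fun j => (hgm j).comp hsm) ?_ (hXe ▸ hXi)
  intro ω
  have := hκ ω
  have hgi : ∀ j, Integrable (g j) (κ ω) := fun j => Integrable.of_bound (C := 1)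
    (hgm j).aestronglyMeasurable (Filter.Eventually.of_forall fun x => hg1 j x)
  have e1 : ∑ j, k j ω * ∫ x, g j x ∂(κ ω) = ∫ x, ∑ j, k j ω * g j x ∂(κ ω) := by
    rw [integral_finsetSum _ fun j _ => (hgi j).const_mul _]
    exact Finset.sum_congr rfl fun j _ => (integral_const_mul _ _).symm
  have i1 : Integrable (fun x => dotp (p ω) x) (κ ω) := by
    refine Integrable.of_bound (C := √(dotp (p ω) (p ω))) (dotp_cont _).aestronglyMeasurable ?_
    filter_upwards [hsupp ω] with x hx
    have := dotp_cs_abs (p ω) x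
    rw [hx.1, Real.sqrt_one, mul_one] at this
    exact this
  have i2 := sph_int2 (hsupp ω) (a ω) (c ω)
  have i3 : Integrable (fun x => c0 ω + dotp (p ω) x) (κ ω) := (integrable_const _).add i1
  rw [e1, integral_congr_ae (g := fun x => c0 ω + dotp (p ω) x + d * (dotp (a ω) x * dotp (c ω) x))
    (by filter_upwards [hsupp ω] with x hx using hpt ω x hx.1),
    integral_add i3 (i2.const_mul _),
    integral_add (integrable_const _) i1, integral_const_mul,
    sph_mean (hv ω) (hsupp ω) (hunif ω), sph_bil rfl (hv ω) (hsupp ω) (hunif ω) (a ω) (hcv ω)]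
  simpa using hz ω
end


lemma dotp_liftv_lz {d : ℕ} (w l : Fin d → ℝ) : dotp (liftv w) (lz l) = dotp w l := by
  rw [dotp_lz]; simp only [liftv_castSucc]

section
variable {d : ℕ} {K : Set (Fin d → ℝ)} {ψ : (Fin d → ℝ) → ℝ} {ν : ℝ}

lemma IsSCB.round_pt (hψ : IsSCB K ψ ν) (hν : 1 ≤ ν) {w u l : Fin d → ℝ} (hw : w ∈ interior K) (hu : u ∈ K)
    {R H : Matrix (Fin (d + 1)) (Fin (d + 1)) ℝ} (hpd : R.PosDef) (hs : R.IsSymm) (hR : R * R = H)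
    (hH : H = hess (liftedBarrier ψ ν) (liftv w)) {s : Fin (d + 1) → ℝ} (hss : dotp s s = 1)
    (hse : dotp s (R⁻¹.mulVec (Pi.single (Fin.last d) 1)) = 0)
    (hl : ∀ y ∈ K, |dotp y l| ≤ 1) {x X G : ℝ}
    (hx : x = dotp (liftv w + R⁻¹.mulVec s) (lz l))
    (hX : X = x + dotp (liftv u - liftv w) (((d:ℝ) * x) • R.mulVec s) - dotp u l)
    (hG : G = 2 + d * (qnorm H (liftv u) + 20 * √ν)) :
    |x| ≤ 1 ∧ |X| ≤ G ∧ X ^ 2 ≤ G ^ 2 * |x| - 2 * dotp u l * X := by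
  have hx1 : |x| ≤ 1 := by
    obtain ⟨v, hv, e⟩ := hψ.play hw hpd hs (hR.trans hH) hss hse
    rw [hx, e, dotp_liftv_lz]
    exact hl v hv
  set r := dotp (liftv u - liftv w) (R.mulVec s) with hr
  set q := qnorm H (liftv u) + 20 * √ν with hq
  have hrq : |r| ≤ q := by
    rw [hr, liftv_sub]
    refine (hψ.loc_ip hw hs (hR.trans hH) hss _).trans ((hψ.local_le hν hw).1.trans (le_of_eq ?_))
    rw [hq, qnorm, hH, dotp_hess]
  have hq0 : 0 ≤ q := (abs_nonneg _).trans hrq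
  have hm := hl u hu
  set m := dotp u l
  have hX' : X = x * (1 + d * r) - m := by
    rw [hX, dotp_smul_right]; ring
  have hd0 : (0:ℝ) ≤ d := by positivity
  have h1 : |1 + d * r| ≤ 1 + d * q := by
    refine (abs_add_le _ _).trans ?_
    rw [abs_mul, abs_of_nonneg hd0, abs_one]
    gcongr
  have hY : |x * (1 + d * r)| ≤ 1 + d * q := by
    rw [abs_mul]
    calc |x| * |1 + d * r| ≤ 1 * (1 + d * q) := mul_le_mul hx1 h1 (abs_nonneg _) zero_le_one
      _ = _ := one_mul _
  refine ⟨hx1, ?_, ?_⟩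
  · rw [hX', hG]
    refine (abs_sub _ _).trans ?_
    linarith
  · have e : X ^ 2 = (x * (1 + d * r)) ^ 2 - 2 * m * X - m ^ 2 := by rw [hX']; ring
    have h2 : (x * (1 + d * r)) ^ 2 ≤ G ^ 2 * |x| := by
      rw [mul_pow, mul_comm (G ^ 2)]
      have a1 : x ^ 2 ≤ |x| := by
        rw [← sq_abs]; nlinarith [abs_nonneg x]
      have a2 : (1 + d * r) ^ 2 ≤ G ^ 2 := by
        rw [← sq_abs]
        apply pow_le_pow_left₀ (abs_nonneg _)
        rw [hG]; linarith
      exact mul_le_mul a1 a2 (sq_nonneg _) (abs_nonneg _)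
    nlinarith [sq_nonneg m]

lemma round_dec {w u l : Fin d → ℝ}
    {R : Matrix (Fin (d + 1)) (Fin (d + 1)) ℝ} (hpd : R.PosDef) (hs : R.IsSymm)
    {s : Fin (d + 1) → ℝ} {x X : ℝ} {a c : Fin (d + 1) → ℝ}
    (hx : x = dotp (liftv w + R⁻¹.mulVec s) (lz l))
    (hX : X = x + dotp (liftv u - liftv w) (((d:ℝ) * x) • R.mulVec s) - dotp u l)
    (ha : a = R⁻¹.mulVec (lz l)) (hc : c = R.mulVec (liftv u - liftv w)) :
    dotp c (R⁻¹.mulVec (Pi.single (Fin.last d) 1)) = 0 ∧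
    (dotp w l - dotp u l) + dotp a c = 0 ∧
    X = (dotp w l - dotp u l) + dotp (a + (d * dotp w l) • c) s + d * (dotp a s * dotp c s) := by
  obtain ⟨i1, i2⟩ := pd_inv hpd
  have hsi := inv_symm' hs
  refine ⟨?_, ?_, ?_⟩
  · rw [inv_last hs, hc, Matrix.mulVec_mulVec, i2, Matrix.one_mulVec, liftv_sub, lz_last]
  · rw [ha, hc, ← dotp_mulVec_symm hsi, Matrix.mulVec_mulVec, i2, Matrix.one_mulVec, dotp_comm' (lz l), dotp_sub_left,
      dotp_liftv_lz, dotp_liftv_lz]; ring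
  · have e1 : x = dotp w l + dotp a s := by
      rw [hx, dotp_add_left, dotp_liftv_lz, ha, ← dotp_mulVec_symm hsi (lz l) s, dotp_comm' (lz l)]
    have e2 : dotp (liftv u - liftv w) (R.mulVec s) = dotp c s := by
      rw [dotp_mulVec_symm hs, hc]
    rw [hX, dotp_smul_right, e2, e1, dotp_add_left, dotp_smul_left]; ring

lemma IsSCB.G_le (hψ : IsSCB K ψ ν) (hK : Convex ℝ K) (hν : 1 ≤ ν) {T : ℝ} {w1 w u : Fin d → ℝ}
    (hw1 : w1 ∈ interior K) (hT : 2 ≤ T)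
    (hmin : ∀ y ∈ K, ψ w1 ≤ ψ y) (hw : w ∈ shr K w1 (1 - 1 / T)) (hu : u ∈ K) :
    qnorm (hess (liftedBarrier ψ ν) (liftv w)) (liftv u) ≤ 6164 * ν ^ 3 * T := by
  rw [qnorm, dotp_hess]
  have h1 := hψ.hess_le hK hν hw1 hT hmin hw (liftv u)
  have h2 := hψ.norm1_le hK hν hw1 hmin hu
  have h0 : 0 ≤ 134 * ν := by linarith
  rw [Real.sqrt_le_left h0] at h2
  apply Real.sqrt_le_iff.mpr
  refine ⟨by positivity, h1.trans ?_⟩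
  calc _ ≤ 2048 * ν ^ 4 * T ^ 2 * (134 * ν) ^ 2 := by gcongr
    _ ≤ _ := by
      have : 0 ≤ ν ^ 6 * T ^ 2 := by positivity
      nlinarith
end

/-- constants of the grid -/
lemma grid_const {d T C : ℕ} {ν δ b B : ℝ} (hd : 1 ≤ d) (hT : 2 ≤ T) (hν : 1 ≤ ν) (hδ : δ ∈ Set.Ioo (0:ℝ) 1)
    (hb : b = 2 * 10 ^ 6 * d * ν ^ 2 * T)
    (hC : C = ⌈Real.logb 2 b⌉₊ * ⌈Real.logb 2 (b ^ 2 * T)⌉₊)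
    (hB : B = 2 + d * (6164 * ν ^ 3 * T + 20 * √ν)) :
    1 ≤ C ∧ 1 ≤ log (C / δ) ∧ B * (1 + √T) ≤ 2 ^ (C - 1) := by
  have hd' : (1:ℝ) ≤ d := by exact_mod_cast hd
  have hT' : (2:ℝ) ≤ T := by exact_mod_cast hT
  have hν2 : 1 ≤ ν ^ 2 := one_le_pow₀ hν
  have hb2 : 2 ≤ b := by
    rw [hb]
    have h1 : 1 ≤ d * ν ^ 2 := by nlinarith
    have h2 : 1 ≤ (d * ν ^ 2) * T := by nlinarith
    nlinarith
  set n1 := ⌈Real.logb 2 b⌉₊ with hn1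
  set n2 := ⌈Real.logb 2 (b ^ 2 * T)⌉₊ with hn2
  have hn1' : 1 ≤ n1 := by
    rw [hn1, Nat.one_le_ceil_iff]
    exact Real.logb_pos (by norm_num) (by linarith)
  have hbT : 0 < b ^ 2 * T := by positivity
  have hp : b ^ 2 * T ≤ 2 ^ n2 := by
    have h1 : Real.logb 2 (b ^ 2 * T) ≤ n2 := Nat.le_ceil _
    rw [Real.logb_le_iff_le_rpow (by norm_num) hbT] at h1
    simpa using h1
  have hn2' : 3 ≤ n2 := by
    by_contra hcon
    have : n2 ≤ 2 := by omega
    have h2 : (2:ℝ) ^ n2 ≤ 2 ^ 2 := pow_le_pow_right₀ (by norm_num) this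
    have h3 : 4 * 2 ≤ b ^ 2 * T := by
      apply mul_le_mul _ hT' (by norm_num) (by positivity)
      nlinarith
    linarith
  have hC2 : n2 ≤ C := by rw [hC]; exact Nat.le_mul_of_pos_left _ hn1'
  have hC3 : 3 ≤ C := hn2'.trans hC2
  refine ⟨by omega, ?_, ?_⟩
  · have hC3' : (3:ℝ) ≤ C := by exact_mod_cast hC3
    rw [Real.le_log_iff_exp_le (div_pos (by linarith) hδ.1)]
    have : (C:ℝ) ≤ C / δ := by
      rw [le_div_iff₀ hδ.1]; nlinarith [hδ.2]
    linarith [Real.exp_one_lt_d9]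
  · have e : (2:ℝ) ^ C = 2 * 2 ^ (C - 1) := by rw [← pow_succ']; congr 1; omega
    have h4 : (2:ℝ) ^ n2 ≤ 2 ^ C := pow_le_pow_right₀ (by norm_num) hC2
    suffices h : 2 * (B * (1 + √T)) ≤ b ^ 2 * T by linarith
    have hsT : 1 + √T ≤ 2 * T := by
      have : √(T:ℝ) ≤ T := by
        rw [Real.sqrt_le_left (by linarith)]; nlinarith
      linarith
    have hsν : √ν ≤ ν := by
      rw [Real.sqrt_le_left (by linarith)]; nlinarith
    have hν3 : ν ≤ ν ^ 3 := by nlinarith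
    have hB' : B ≤ 6200 * (d * ν ^ 3 * T) := by
      have h1 : ν ≤ ν ^ 3 * T := by nlinarith
      have h2 : 1 ≤ d * (ν ^ 3 * T) := by nlinarith
      have h3 : d * √ν ≤ d * (ν ^ 3 * T) := by
        apply mul_le_mul_of_nonneg_left _ (by linarith); linarith
      rw [hB]
      nlinarith
    have hB0 : 0 ≤ 6200 * (d * ν ^ 3 * T) := by positivity
    calc 2 * (B * (1 + √T)) ≤ 2 * (6200 * (d * ν ^ 3 * T) * (2 * T)) := by
          apply mul_le_mul_of_nonneg_left _ (by norm_num)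
          exact mul_le_mul hB' hsT (by positivity) hB0
      _ = 24800 * (d * ν ^ 3 * T ^ 2) := by ring
      _ ≤ 4 * 10 ^ 12 * (d * ν ^ 3 * T ^ 2) := by
          have : 0 ≤ d * ν ^ 3 * T ^ 2 := by positivity
          nlinarith
      _ ≤ 4 * 10 ^ 12 * (d * ν ^ 3 * T ^ 2 * (d * ν * T)) := by
          have h1 : 1 ≤ d * ν := by nlinarith
          have h2 : 1 ≤ d * ν * T := by nlinarith
          apply mul_le_mul_of_nonneg_left _ (by norm_num)
          exact le_mul_of_one_le_right (by positivity) h2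
      _ = b ^ 2 * T := by rw [hb]; ring

/-- final numerical comparison -/
lemma final_num {d T C : ℕ} {ν η L Q ρ A U D SX : ℝ} (hd : 1 ≤ d) (hT : 2 ≤ T) (hν : 1 ≤ ν) (hη : 0 < η)
    (hC : 1 ≤ C) (hL : 1 ≤ L) (hρ : 0 ≤ ρ) (hA : 0 ≤ A) (hU : 0 ≤ U)
    (hηb : η ≤ 1 / (64000 * C * d ^ 2 * Real.log (ν * T) * L))
    (hSX : SX ≤ 3 * (2 + d * (ρ + 20 * √ν)) * √(L * Q) + 2 * (2 + d * (ρ + 20 * √ν)) * L)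
    (hD : D ≤ ν / η * (800 * Real.log T + 805) + 2 * η * d ^ 2 * A - ρ / (40 * η * d * Real.log (ν * T))) :
    2 + SX + D ≤ 3000 * (Real.log ((d : ℝ) * ν * T)) ^ 1 * (ν / η + η * (d : ℝ) ^ 2 * A + U)
      + (√ν + ρ) * (161 * C * d * √(L * Q) - 1 / (1000 * η * d * Real.log (ν * T))) := by
  have hd' : (1:ℝ) ≤ d := by exact_mod_cast hd
  have hT' : (2:ℝ) ≤ T := by exact_mod_cast hT
  have hC' : (1:ℝ) ≤ C := by exact_mod_cast hC
  obtain ⟨hl1, hl2, hl3, hl4⟩ := logνT hν hT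
  set l := Real.log (ν * T) with hl
  have hl0 : 0 < l := by linarith
  have hlg : l ≤ Real.log (d * ν * T) := by
    apply Real.log_le_log (by linarith)
    rw [mul_assoc]
    exact le_mul_of_one_le_left (by linarith) hd'
  set lg := Real.log (d * ν * T)
  have hsν : 1 ≤ √ν := Real.one_le_sqrt.mpr hν
  have hsν2 : √ν ≤ ν := by rw [Real.sqrt_le_left (by linarith)]; nlinarith
  set y := √ν
  set z := √(L * Q) with hz
  have hz0 : 0 ≤ z := Real.sqrt_nonneg _
  set I := 1 / (η * d * l) with hI
  have e1 : 1 / (1000 * η * d * l) = I / 1000 := by rw [hI]; field_simp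
  have e2 : ρ / (40 * η * d * l) = ρ * I / 40 := by rw [hI]; field_simp
  have hIL : 64000 * (d * L) ≤ I := by
    rw [le_div_iff₀ (by positivity)] at hηb
    rw [hI, le_div_iff₀ (by positivity)]
    have : 0 ≤ η * (d ^ 2 * l * L) := by positivity
    calc 64000 * (d * L) * (η * d * l) = 64000 * (η * (d ^ 2 * l * L)) * 1 := by ring
      _ ≤ 64000 * (η * (d ^ 2 * l * L)) * C := by gcongr
      _ = η * (64000 * C * d ^ 2 * l * L) := by ring
      _ ≤ 1 := hηb
  set E := ν / η with hE
  have hE0 : 0 < E := by positivity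
  have hyI : y * I ≤ 2 * E := by
    rw [hI, hE, mul_one_div, div_le_iff₀ (by positivity)]
    have : 2 * (ν / η) * (η * d * l) = 2 * ν * (d * l) := by field_simp
    rw [this]
    have h69 : 0.69 ≤ d * l := hl1.trans (le_mul_of_one_le_left hl0.le hd')
    have h70 : ν * 0.69 ≤ ν * (d * l) := by gcongr
    linarith
  have hdL : 1 ≤ d * L := one_le_mul_of_one_le_of_one_le hd' hL
  have hEbig : 2 ≤ E := by
    have h1 : I ≤ y * I := le_mul_of_one_le_left (by linarith) hsν
    linarith
  have hg : 2 + d * (ρ + 20 * y) ≤ 22 * (d * (y + ρ)) := by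
    have h1 : 1 ≤ d * y := one_le_mul_of_one_le_of_one_le hd' hsν
    have h2 : 0 ≤ d * ρ := by positivity
    linarith
  have hyρ : 0 ≤ d * (y + ρ) := by positivity
  have hS1 : 3 * (2 + d * (ρ + 20 * y)) * z ≤ (y + ρ) * (161 * C * d * z) := by
    have h1 : 3 * (2 + d * (ρ + 20 * y)) * z ≤ 3 * (22 * (d * (y + ρ))) * z := by gcongr
    have h2 : d * (y + ρ) * z ≤ d * (y + ρ) * z * C := le_mul_of_one_le_right (by positivity) hC'
    have h3 : 0 ≤ d * (y + ρ) * z := by positivity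
    linarith
  have hS2 : 2 * (2 + d * (ρ + 20 * y)) * L ≤ (y + ρ) * (I / 1000) := by
    have h1 : 2 * (2 + d * (ρ + 20 * y)) * L ≤ 2 * (22 * (d * (y + ρ))) * L := by gcongr
    have h2 : (y + ρ) * (64000 * (d * L)) ≤ (y + ρ) * I := by gcongr
    have h3 : 0 ≤ (y + ρ) * (d * L) := by positivity
    linarith
  have hI0 : 0 ≤ I := by rw [hI]; positivity
  have hρI : 0 ≤ ρ * I := by positivity
  have hmain : E * (800 * Real.log T + 805) + 2 + y * I / 500 ≤ 3000 * lg * E := by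
    have h1 : E * Real.log T ≤ E * lg := by gcongr; linarith
    have h2 : E * 0.69 ≤ E * lg := by gcongr; linarith
    linarith
  have hA' : 2 * η * d ^ 2 * A ≤ 3000 * lg * (η * d ^ 2 * A) := by
    have h0 : 0 ≤ η * d ^ 2 * A := by positivity
    have : 2 * (η * d ^ 2 * A) ≤ 3000 * lg * (η * d ^ 2 * A) := by
      apply mul_le_mul_of_nonneg_right _ h0; linarith
    linarith
  have hU' : 0 ≤ 3000 * lg * U := by
    have : 0 ≤ lg := by linarith
    positivity
  rw [e1, pow_one]
  rw [e2] at hD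
  linarith

/-- **Lemma B.13: main high-probability regret decomposition for linear bandits.**
If `η ≤ 1/(64000 C d² ln(νT) ln(C/δ))`, then Algorithm 2 guarantees that with
probability at least `1 − δ`,
`∑_{t=1}^T ⟨w̃_t − u*, ℓ_t⟩ ≤ Õ(ν/η + η d² L̄_T + √(L̄_u ln(1/δ)))
   + (√ν + ρ)(161 C d √(ln(C/δ) L̊_T) − 1/(1000 η d ln(νT)))`,
where `C = ⌈log₂ b⌉ ⌈log₂ (b² T)⌉ = Θ(ln²(dνT))` with `b = 2·10⁶ d ν² T`. -/
theorem linear_bandit_main_regret_decomposition :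
    ∃ c : ℝ, 0 < c ∧ ∃ k : ℕ,
    ∀ {Ω : Type} {m0 : MeasurableSpace Ω} (μ : Measure Ω)
      (hμ : IsProbabilityMeasure μ)
      (F : ℕ → MeasurableSpace Ω) (hFmono : Monotone F) (hFle : ∀ t, F t ≤ m0)
      (d T : ℕ) (hd : 1 ≤ d) (hT : 2 ≤ T) (ν η : ℝ) (hν : 1 ≤ ν) (hη : 0 < η)
      (δ : ℝ) (hδ : δ ∈ Set.Ioo (0 : ℝ) 1)
      (Ωs : Set (Fin d → ℝ)) (hconv : Convex ℝ Ωs) (hcomp : IsCompact Ωs)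
      (hint : (interior Ωs).Nonempty)
      (ψ : (Fin d → ℝ) → ℝ) (hψ : IsSCB Ωs ψ ν)
      (ℓv : ℕ → Ω → Fin d → ℝ) (sv wp : ℕ → Ω → Fin (d + 1) → ℝ)
      (R : ℕ → Ω → Matrix (Fin (d + 1)) (Fin (d + 1)) ℝ)
      (ηv : ℕ → Ω → ℝ) (S : ℕ → Ω → Finset ℕ)
      (κ : ℕ → Ω → Measure (Fin (d + 1) → ℝ))
      (Ψ : (Fin (d + 1) → ℝ) → ℝ) (hΨ : Ψ = liftedBarrier ψ ν)
      (Ωp : Set (Fin (d + 1) → ℝ)) (hΩp : Ωp = liftv '' Ωs)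
      (w1 : Fin (d + 1) → ℝ) (hwp1 : ∀ ω, wp 1 ω = w1)
      (H : ℕ → Ω → Matrix (Fin (d + 1)) (Fin (d + 1)) ℝ)
      (hH : ∀ t ω, H t ω = hess Ψ (wp t ω))
      (elast : Fin (d + 1) → ℝ) (helast : elast = Pi.single (Fin.last d) 1)
      (lp : ℕ → Ω → Fin (d + 1) → ℝ) (hlp : ∀ t ω, lp t ω = Fin.snoc (ℓv t ω) 0)
      (wt : ℕ → Ω → Fin (d + 1) → ℝ)
      (hwt : ∀ t ω, wt t ω = wp t ω + (R t ω)⁻¹.mulVec (sv t ω))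
      (lh : ℕ → Ω → Fin (d + 1) → ℝ)
      (hlh : ∀ t ω, lh t ω =
        ((d : ℝ) * dotp (wt t ω) (lp t ω)) • (R t ω).mulVec (sv t ω))
      (Ωp' : Set (Fin (d + 1) → ℝ))
      (hΩp' : Ωp' = {x ∈ Ωp | mink Ωp w1 x ≤ 1 - 1 / (T : ℝ)})
      (hℓmeas : ∀ t i, StronglyMeasurable[F t] fun ω => ℓv t ω i)
      (hwpmeas : ∀ t i, StronglyMeasurable[F t] fun ω => wp t ω i)
      (hsmeas : ∀ t i, StronglyMeasurable[F (t + 1)] fun ω => sv t ω i)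
      (hℓbound : ∀ t ∈ Finset.Icc 1 T, ∀ ω, ∀ w ∈ Ωs, |dotp w (ℓv t ω)| ≤ 1)
      (hinit : w1 ∈ Ωp ∧ ∀ y ∈ Ωp, Ψ w1 ≤ Ψ y)
      (hR : ∀ t ∈ Finset.Icc 1 (T + 1), ∀ ω,
        (R t ω).PosDef ∧ (R t ω).IsSymm ∧ R t ω * R t ω = H t ω)
      (hκprob : ∀ t ω, IsProbabilityMeasure (κ t ω))
      (hκsupp : ∀ t ∈ Finset.Icc 1 T, ∀ ω, ∀ᵐ x ∂(κ t ω),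
        dotp x x = 1 ∧ dotp x ((R t ω)⁻¹.mulVec elast) = 0)
      (hκunif : ∀ t ∈ Finset.Icc 1 T, ∀ ω,
        ∀ O : Matrix (Fin (d + 1)) (Fin (d + 1)) ℝ, Oᵀ * O = 1 →
          O.mulVec ((R t ω)⁻¹.mulVec elast) = (R t ω)⁻¹.mulVec elast →
          (κ t ω).map O.mulVec = κ t ω)
      (hκlaw : ∀ t ∈ Finset.Icc 1 T, ∀ g : (Fin (d + 1) → ℝ) → ℝ, Measurable g →
        (∀ x, |g x| ≤ 1) →
        μ[fun ω => g (sv t ω) | F t] =ᵐ[μ] fun ω => ∫ x, g x ∂(κ t ω))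
      (hsval : ∀ t ∈ Finset.Icc 1 T, ∀ ω,
        dotp (sv t ω) (sv t ω) = 1 ∧ dotp (sv t ω) ((R t ω)⁻¹.mulVec elast) = 0)
      (hupd : ∀ t ∈ Finset.Icc 1 T, ∀ ω, wp (t + 1) ω ∈ Ωp' ∧ ∀ y ∈ Ωp',
        dotp (wp (t + 1) ω) (lh t ω) + (1 / ηv t ω) * breg Ψ (wp (t + 1) ω) (wp t ω)
          ≤ dotp y (lh t ω) + (1 / ηv t ω) * breg Ψ y (wp t ω))
      (hη1 : ∀ ω, ηv 1 ω = η) (hS1 : ∀ ω, S 1 ω = {1})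
      (hsch : ∀ t ∈ Finset.Icc 1 T, ∀ ω,
        ((∃ p : Fin (d + 1) → ℝ,
            0 < dotp p ((H (t + 1) ω - ∑ τ ∈ S t ω, H τ ω).mulVec p)) →
          S (t + 1) ω = insert (t + 1) (S t ω) ∧
          ηv (t + 1) ω = Real.exp (1 / (100 * d * Real.log (ν * T))) * ηv t ω) ∧
        (¬ (∃ p : Fin (d + 1) → ℝ,
            0 < dotp p ((H (t + 1) ω - ∑ τ ∈ S t ω, H τ ω).mulVec p)) →
          S (t + 1) ω = S t ω ∧ ηv (t + 1) ω = ηv t ω))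
      (ustar : Fin d → ℝ) (hustar : ustar ∈ Ωs)
      (up : Fin (d + 1) → ℝ)
      (hup : up = (1 - 1 / (T : ℝ)) • liftv ustar + (1 / (T : ℝ)) • w1)
      (uvec : Fin d → ℝ) (huvec : uvec = fun i => up i.castSucc)
      (ρm : Ω → ℝ)
      (hρm : ∀ ω, ρm ω = (Finset.Icc 1 T).sup'
        (Finset.nonempty_Icc.mpr (by omega)) fun t => qnorm (H t ω) up)
      (b : ℝ) (hb : b = 2 * 10 ^ 6 * d * ν ^ 2 * T)
      (C : ℕ) (hC : C = ⌈Real.logb 2 b⌉₊ * ⌈Real.logb 2 (b ^ 2 * T)⌉₊)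
      (hηbound : η ≤ 1 / (64000 * C * d ^ 2 * Real.log (ν * T) * Real.log (C / δ))),
    ENNReal.ofReal (1 - δ) ≤
      μ {ω | ∑ t ∈ Finset.Icc 1 T, dotp (wt t ω - liftv ustar) (lp t ω)
        ≤ c * (Real.log ((d : ℝ) * ν * T)) ^ k *
            (ν / η + η * (d : ℝ) ^ 2 *
                (∑ t ∈ Finset.Icc 1 T, |dotp (wt t ω) (lp t ω)|) +
              Real.sqrt ((∑ t ∈ Finset.Icc 1 T, |dotp uvec (ℓv t ω)|) *
                Real.log (1 / δ)))
          + (Real.sqrt ν + ρm ω) *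
            (161 * C * d * Real.sqrt (Real.log (C / δ) *
                (∑ t ∈ Finset.Icc 1 T,
                  (μ[fun ω' => |dotp (wt t ω') (lp t ω')| | F t]) ω))
              - 1 / (1000 * η * d * Real.log (ν * T)))} := by
  refine ⟨3000, by norm_num, 1, ?_⟩
  intro Ω m0 μ hμ F hFmono hFle d T hd hT ν η hν hη δ hδ Ωs hconv hcomp hint ψ hψ ℓv sv wp R ηv S κ Ψ hΨ
    Ωp hΩp w1 hwp1 H hH elast helast lp hlp wt hwt lh hlh Ωp' hΩp' hℓmeas hwpmeas hsmeas hℓbound hinit hR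
    hκprob hκsupp hκunif hκlaw hsval hupd hη1 hS1 hsch ustar hustar up hup uvec huvec ρm hρm b hb C hC hηbound
  subst hΨ hΩp helast
  have hT' : (2:ℝ) ≤ T := by exact_mod_cast hT
  have hd' : (1:ℝ) ≤ d := by exact_mod_cast hd
  have hc0 : (0:ℝ) < 1 - 1 / (T:ℝ) := by
    have : 1 / (T:ℝ) ≤ 1 / 2 := one_div_le_one_div_of_le (by norm_num) hT'
    linarith
  -- the starting point
  obtain ⟨⟨v1, hv1, hv1e⟩, hmin0⟩ := hinit
  have hmin : ∀ y ∈ Ωs, ψ v1 ≤ ψ y := by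
    intro y hy
    have := hmin0 (liftv y) ⟨y, hy, rfl⟩
    rw [← hv1e, lifted_liftv, lifted_liftv] at this
    linarith
  have hHpd : ∀ t ∈ Icc 1 (T + 1), ∀ ω, (H t ω).PosDef := by
    intro t ht ω
    obtain ⟨h1, h2, h3⟩ := hR t ht ω
    rw [← h3]
    nth_rewrite 1 [← h1.isHermitian.eq]
    exact Matrix.PosDef.conjTranspose_mul_self _ (Matrix.mulVec_injective_of_isUnit h1.isUnit)
  rcases isEmpty_or_nonempty Ω with hE | ⟨⟨ω0⟩⟩
  · exfalso
    have : μ Set.univ = 1 := measure_univ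
    rw [Set.univ_eq_empty_iff.mpr hE] at this
    simp at this
  have hw1i : v1 ∈ interior Ωs := by
    have h1 := hHpd 1 (by simp) ω0
    refine hψ.int_of_hess hconv hint hv1 (p := Pi.single (Fin.last d) 1) ?_
    rw [← dotp_hess, hv1e, ← hwp1 ω0, ← hH]
    have := h1.dotProduct_mulVec_pos (x := Pi.single (Fin.last d) (1:ℝ)) (by
      intro h; have := congrFun h (Fin.last d); simp at this)
    exact ne_of_gt (by simpa [dotp_eq] using this)
  -- the shrunk domain
  have hΩ' : Ωp' = liftv '' shr Ωs v1 (1 - 1 / (T:ℝ)) := by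
    rw [hΩp', ← hv1e]
    ext x
    constructor
    · rintro ⟨⟨y, hy, rfl⟩, h⟩
      exact ⟨y, mink_mem hconv hcomp.isClosed hv1 hy hc0 h, rfl⟩
    · rintro ⟨y, ⟨z, hz, rfl⟩, rfl⟩
      refine ⟨⟨_, ?_, rfl⟩, mink_le hz hc0⟩
      exact interior_subset (shr_int hconv hw1i hT' ⟨z, hz, rfl⟩)
  have hWex : ∀ t ω, t ∈ Icc 1 (T + 1) → ∃ w ∈ shr Ωs v1 (1 - 1 / (T:ℝ)), wp t ω = liftv w := by
    intro t ω ht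
    rcases eq_or_ne t 1 with rfl | h1
    · exact ⟨v1, w1_shr hv1 _, by rw [hwp1, hv1e]⟩
    · obtain ⟨n, rfl⟩ : ∃ n, t = n + 1 := ⟨t - 1, by simp at ht; omega⟩
      have hn : n ∈ Icc 1 T := by simp at ht ⊢; omega
      have := (hupd n hn ω).1
      rw [hΩ'] at this
      obtain ⟨w, hw, e⟩ := this
      exact ⟨w, hw, e.symm⟩
  choose! W hWs hWe using hWex
  obtain ⟨u, huS, hue⟩ : ∃ u ∈ shr Ωs v1 (1 - 1 / (T:ℝ)), up = liftv u := by
    refine ⟨v1 + (1 - 1 / (T:ℝ)) • (ustar - v1), ⟨ustar, hustar, rfl⟩, ?_⟩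
    rw [hup, ← hv1e]
    ext i
    refine Fin.lastCases ?_ (fun i => ?_) i
    · simp [liftv_last]
    · simp [liftv_castSucc]; ring
  have hui := shr_int hconv hw1i hT' huS
  have huK := interior_subset hui
  have huv : uvec = u := by rw [huvec, hue]; ext i; rw [liftv_castSucc]
  have hlz : ∀ t ω, lp t ω = lz (ℓv t ω) := fun t ω => hlp t ω
  have hsub : ∀ t ∈ Icc 1 T, t ∈ Icc 1 (T + 1) := fun t ht => by simp at ht ⊢; omega
  have hWi : ∀ t ∈ Icc 1 T, ∀ ω, W t ω ∈ interior Ωs := fun t ht ω =>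
    shr_int hconv hw1i hT' (hWs t ω (hsub t ht))
  -- per round quantities
  set x : ℕ → Ω → ℝ := fun t ω => dotp (wt t ω) (lp t ω) with hx
  set X : ℕ → Ω → ℝ := fun t ω => x t ω + dotp (up - wp t ω) (lh t ω) - dotp uvec (ℓv t ω) with hX
  set G : ℕ → Ω → ℝ := fun t ω => 2 + d * (qnorm (H t ω) up + 20 * √ν) with hG
  have hxe : ∀ t ∈ Icc 1 T, ∀ ω, x t ω = dotp (liftv (W t ω) + (R t ω)⁻¹.mulVec (sv t ω)) (lz (ℓv t ω)) := by
    intro t ht ω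
    simp only [hx]
    rw [hwt, hlz, hWe t ω (hsub t ht)]
  have hXe : ∀ t ∈ Icc 1 T, ∀ ω, X t ω = x t ω + dotp (liftv u - liftv (W t ω))
      (((d:ℝ) * x t ω) • (R t ω).mulVec (sv t ω)) - dotp u (ℓv t ω) := by
    intro t ht ω
    simp only [hX]
    rw [hlh, huv, hue, hWe t ω (hsub t ht)]
  have hHe : ∀ t ∈ Icc 1 (T + 1), ∀ ω, H t ω = hess (liftedBarrier ψ ν) (liftv (W t ω)) := by
    intro t ht ω
    rw [hH, hWe t ω ht]
  have hpt : ∀ t ∈ Icc 1 T, ∀ ω, |x t ω| ≤ 1 ∧ |X t ω| ≤ G t ω ∧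
      X t ω ^ 2 ≤ G t ω ^ 2 * |x t ω| - 2 * dotp u (ℓv t ω) * X t ω := by
    intro t ht ω
    obtain ⟨r1, r2, r3⟩ := hR t (hsub t ht) ω
    exact hψ.round_pt hν (hWi t ht ω) huK r1 r2 r3 (hHe t (hsub t ht) ω) (hsval t ht ω).1 (hsval t ht ω).2
      (hℓbound t ht ω) (hxe t ht ω) (hXe t ht ω) (by simp only [hG]; rw [hue])
  obtain ⟨B, hB⟩ : ∃ B : ℝ, B = 2 + d * (6164 * ν ^ 3 * T + 20 * √ν) := ⟨_, rfl⟩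
  have hqB : ∀ t ∈ Icc 1 T, ∀ ω, qnorm (H t ω) up ≤ 6164 * ν ^ 3 * T := by
    intro t ht ω
    rw [hHe t (hsub t ht) ω, hue]
    exact hψ.G_le hconv hν hw1i hT' hmin (hWs t ω (hsub t ht)) huK
  have hGB : ∀ t ∈ Icc 1 T, ∀ ω, G t ω ≤ B := by
    intro t ht ω
    simp only [hG]
    rw [hB]
    have := hqB t ht ω
    gcongr
  -- measurability
  have mℓ : ∀ t i, Measurable[F t] fun ω => ℓv t ω i := fun t i => (hℓmeas t i).measurable
  have mlp : ∀ t i, Measurable[F t] fun ω => lp t ω i := by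
    intro t i
    simp only [hlz]
    refine Fin.lastCases ?_ (fun i => ?_) i
    · simp only [lz_last]; exact measurable_const
    · simp only [lz_castSucc]; exact mℓ t i
  have mwp : ∀ t i, Measurable[F t] fun ω => wp t ω i := fun t i => (hwpmeas t i).measurable
  have mH : ∀ t ∈ Icc 1 T, ∀ i j, Measurable[F t] fun ω => H t ω i j := by
    intro t ht i j
    have := hess_meas (F t) hψ (wp t) (mwp t) (fun ω => by
      rw [hWe t ω (hsub t ht)]; exact liftv_mem_coneU (hWi t ht ω)) i j
    simpa only [hH] using this
  have mR : ∀ t ∈ Icc 1 T, ∀ i j, Measurable[F t] fun ω => R t ω i j := fun t ht =>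
    sqrt_meas (F t) (H t) (R t) (mH t ht) fun ω =>
      ⟨(hR t (hsub t ht) ω).1.posSemidef, (hR t (hsub t ht) ω).2.2⟩
  have mRi : ∀ t ∈ Icc 1 T, ∀ i j, Measurable[F t] fun ω => (R t ω)⁻¹ i j := fun t ht =>
    inv_meas (F t) (R t) (mR t ht)
  have hF1 : ∀ t, F t ≤ F (t + 1) := fun t => hFmono (Nat.le_succ t)
  have ms : ∀ t i, Measurable[F (t + 1)] fun ω => sv t ω i := fun t i => (hsmeas t i).measurable
  have mRs : ∀ t ∈ Icc 1 T, ∀ i, Measurable[F (t + 1)] fun ω => (R t ω).mulVec (sv t ω) i := fun t ht =>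
    mulVec_meas _ _ _ (fun i j => (mR t ht i j).mono (hF1 t) le_rfl) (ms t)
  have mRis : ∀ t ∈ Icc 1 T, ∀ i, Measurable[F (t + 1)] fun ω => (R t ω)⁻¹.mulVec (sv t ω) i := fun t ht =>
    mulVec_meas _ _ _ (fun i j => (mRi t ht i j).mono (hF1 t) le_rfl) (ms t)
  have mwt : ∀ t ∈ Icc 1 T, ∀ i, Measurable[F (t + 1)] fun ω => wt t ω i := by
    intro t ht i
    simp only [hwt, Pi.add_apply]
    exact ((mwp t i).mono (hF1 t) le_rfl).add (mRis t ht i)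
  have mx : ∀ t ∈ Icc 1 T, Measurable[F (t + 1)] (x t) := fun t ht =>
    dotp_meas _ _ _ (mwt t ht) fun i => (mlp t i).mono (hF1 t) le_rfl
  have mlh : ∀ t ∈ Icc 1 T, ∀ i, Measurable[F (t + 1)] fun ω => lh t ω i := by
    intro t ht i
    simp only [hlh, Pi.smul_apply, smul_eq_mul]
    exact ((mx t ht).const_mul _).mul (mRs t ht i)
  have ma : ∀ t, Measurable[F t] fun ω => dotp u (ℓv t ω) := fun t =>
    dotp_meas _ _ _ (fun i => measurable_const) (mℓ t)
  have mdiff : ∀ t i, Measurable[F t] fun ω => (up - wp t ω) i := fun t i =>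
    measurable_const.sub (mwp t i)
  have mX : ∀ t ∈ Icc 1 T, Measurable[F (t + 1)] (X t) := by
    intro t ht
    refine Measurable.sub (Measurable.add (mx t ht) ?_) ?_
    · exact dotp_meas _ _ _ (fun i => (mdiff t i).mono (hF1 t) le_rfl) (mlh t ht)
    · rw [huv]; exact (ma t).mono (hF1 t) le_rfl
  have mG : ∀ t ∈ Icc 1 T, Measurable[F t] (G t) := by
    intro t ht
    refine measurable_const.add (Measurable.const_mul (Measurable.add ?_ measurable_const) _)
    simp only [qnorm]
    refine Real.continuous_sqrt.measurable.comp ?_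
    exact dotp_meas _ _ _ (fun i => measurable_const) (mulVec_meas _ _ _ (mH t ht) fun i => measurable_const)
  -- conditional means
  have h0 : ∀ t ∈ Icc 1 T, μ[X t | F t] =ᵐ[μ] 0 := by
    intro t ht
    have hdec := fun ω => round_dec (hR t (hsub t ht) ω).1 (hR t (hsub t ht) ω).2.1 (s := sv t ω)
      (hxe t ht ω) (hXe t ht ω) rfl rfl
    have mRl : ∀ i, Measurable[F t] fun ω => (R t ω)⁻¹.mulVec (lz (ℓv t ω)) i := by
      have := mulVec_meas _ _ _ (mRi t ht) (mlp t)
      simpa only [hlz] using this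
    have mRc : ∀ i, Measurable[F t] fun ω => (R t ω).mulVec (liftv u - liftv (W t ω)) i := by
      have := mulVec_meas _ _ _ (mR t ht) (mdiff t)
      intro i
      have h := this i
      have e : (fun ω => (R t ω).mulVec (up - wp t ω) i) =
          fun ω => (R t ω).mulVec (liftv u - liftv (W t ω)) i := by
        ext ω; rw [hue, hWe t ω (hsub t ht)]
      rw [e] at h
      exact h
    have mwl : Measurable[F t] fun ω => dotp (W t ω) (ℓv t ω) := by
      have := dotp_meas _ _ _ (mwp t) (mlp t)
      have e : (fun ω => dotp (wp t ω) (lp t ω)) = fun ω => dotp (W t ω) (ℓv t ω) := by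
        ext ω; rw [hWe t ω (hsub t ht), hlz, dotp_liftv_lz]
      rw [e] at this
      exact this
    refine step_mean (hFle t) (sv t) (κ t) (fun ω => (R t ω)⁻¹.mulVec (Pi.single (Fin.last d) 1))
      (hκprob t) ?_ (hκsupp t ht) (hκunif t ht) (hκlaw t ht)
      (fun i => (ms t i).mono (hFle _) le_rfl) (fun ω => (hsval t ht ω).1)
      (fun ω => dotp (W t ω) (ℓv t ω) - dotp u (ℓv t ω))
      (fun ω => (R t ω)⁻¹.mulVec (lz (ℓv t ω)) +
        (d * dotp (W t ω) (ℓv t ω)) • (R t ω).mulVec (liftv u - liftv (W t ω)))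
      (fun ω => (R t ω)⁻¹.mulVec (lz (ℓv t ω)))
      (fun ω => (R t ω).mulVec (liftv u - liftv (W t ω)))
      (mwl.sub (ma t)) ?_ mRl mRc (fun ω => (hdec ω).1) (fun ω => (hdec ω).2.1) (X t)
      (fun ω => (hdec ω).2.2) ?_
    · intro ω h
      have := congrArg (fun y => (R t ω).mulVec y) h
      rw [Matrix.mulVec_mulVec, (pd_inv (hR t (hsub t ht) ω).1).1, Matrix.one_mulVec, Matrix.mulVec_zero] at this
      have := congrFun this (Fin.last d)
      simp at this
    · intro i
      exact (mRl i).add ((mwl.const_mul _).mul (mRc i))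
    · exact Integrable.of_bound (C := B) ((mX t ht).mono (hFle _) le_rfl).aestronglyMeasurable
        (Filter.Eventually.of_forall fun ω => ((hpt t ht ω).2.1).trans (hGB t ht ω))
  obtain ⟨hC1, hL1, hBC⟩ := grid_const hd hT hν hδ hb hC hB
  have hfr := freedman (μ := μ) hFmono hFle (T := T) (N := C) hC1 hδ.1 mX mG hGB
    (fun t ht ω => (hpt t ht ω).2.1) (fun t _ => ma t) (fun t ht ω => hℓbound t ht ω u huK)
    mx (fun t ht ω => (hpt t ht ω).1) (fun t ht ω => (hpt t ht ω).2.2) h0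
  refine hfr.trans (measure_mono ?_)
  rintro ω ⟨hq01, hgrid⟩
  -- from here on everything is deterministic
  obtain ⟨t1, ht1, hρt⟩ : ∃ t ∈ Icc 1 T, ρm ω = qnorm (H t ω) up := by
    rw [hρm]
    exact Finset.exists_mem_eq_sup' _ _
  have hρle : ∀ t ∈ Icc 1 T, qnorm (H t ω) up ≤ ρm ω := by
    intro t ht
    rw [hρm]
    exact Finset.le_sup' (fun t => qnorm (H t ω) up) ht
  have hρ0 : 0 ≤ ρm ω := by rw [hρt]; exact Real.sqrt_nonneg _
  have hsν : 0 ≤ √ν := Real.sqrt_nonneg _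
  have hSX := grid_choice (N := C) (T := T) (L := Real.log (C / δ)) (g := 2 + d * (ρm ω + 20 * √ν))
    (X := fun t => X t ω) (G := fun t => G t ω) (q := fun t => (μ[fun ω => |x t ω| | F t]) ω)
    hL1 (by
      have : 0 ≤ d * (ρm ω + 20 * √ν) := by positivity
      linarith) (by
      refine le_trans ?_ hBC
      have := hqB t1 ht1 ω
      rw [hB, hρt]
      gcongr) hC1
    (fun t ht => ⟨(abs_nonneg _).trans (hpt t ht ω).2.1, by
      have := hρle t ht
      simp only [hG]
      gcongr⟩) hq01 hgrid
  obtain ⟨hl1, -, -, -⟩ := logνT hν hT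
  have hηs : η * d ≤ 5 / 2 := by
    have hC' : (1:ℝ) ≤ C := by exact_mod_cast hC1
    rw [le_div_iff₀ (by positivity)] at hηbound
    have h1 : 0.69 ≤ Real.log (ν * T) * Real.log (C / δ) := by nlinarith
    have h2 : 0.69 * (η * d) * 1 ≤ (Real.log (ν * T) * Real.log (C / δ)) * (η * d) * (C * d) := by
      have h3 : (1:ℝ) ≤ C * d := one_le_mul_of_one_le_of_one_le hC' hd'
      have h4 : 0 ≤ η * d := by positivity
      gcongr
    nlinarith
  have hD := hψ.det_regret hconv hd hT hν hη hηs hw1i hmin (W := fun t => W t ω) (u := u)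
    (H := fun t => H t ω) (R := fun t => R t ω) (s := fun t => sv t ω) (x := fun t => x t ω)
    (g := fun t => lh t ω) (S := fun t => S t ω) (e := fun t => ηv t ω) (ρ := ρm ω)
    (liftv_inj (by rw [← hWe 1 ω (by simp), hwp1, hv1e]))
    (fun t ht => hWs t ω ht) huS (fun t ht => hHe t ht ω) (fun t ht => hHpd t ht ω)
    (fun t ht => (hR t (hsub t ht) ω).2.1) (fun t ht => (hR t (hsub t ht) ω).2.2)
    (fun t ht => (hsval t ht ω).1) (fun t ht => (hpt t ht ω).1) (fun t ht => hlh t ω)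
    ⟨hS1 ω, hη1 ω, fun t ht => hsch t ht ω⟩
    (fun t ht y hy => by
      have h := (hupd t ht ω).2 (liftv y) (by rw [hΩ']; exact ⟨y, hy, rfl⟩)
      rw [hWe t ω (hsub t ht), hWe (t + 1) ω (by simp at ht ⊢; omega)] at h
      exact h)
    ⟨t1, ht1, by rw [hρt, hue]⟩
  have hfin := final_num (T := T) (C := C) (L := Real.log (C / δ)) (ρ := ρm ω)
    (A := ∑ t ∈ Icc 1 T, |x t ω|)
    (U := Real.sqrt ((∑ t ∈ Icc 1 T, |dotp uvec (ℓv t ω)|) * Real.log (1 / δ)))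
    hd hT hν hη hC1 hL1 hρ0 (Finset.sum_nonneg fun t _ => abs_nonneg _) (Real.sqrt_nonneg _)
    hηbound hSX hD
  refine le_trans ?_ hfin
  have h2 : (2:ℝ) = ∑ t ∈ Icc 1 T, 2 / (T:ℝ) := by
    rw [Finset.sum_const, Nat.card_Icc, nsmul_eq_mul]
    have : (T:ℝ) ≠ 0 := by positivity
    simp; field_simp
  rw [h2, ← Finset.sum_add_distrib, ← Finset.sum_add_distrib]
  refine Finset.sum_le_sum fun t ht => ?_
  have e1 : dotp (liftv ustar) (lp t ω) = dotp ustar (ℓv t ω) := by rw [hlz, dotp_liftv_lz]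
  have e2 : dotp (up - wp t ω) (lh t ω) = - dotp (liftv (W t ω) - liftv u) (lh t ω) := by
    rw [hue, hWe t ω (hsub t ht), dotp_sub_left, dotp_sub_left]; ring
  have e3 : dotp u (ℓv t ω) - dotp ustar (ℓv t ω) ≤ 2 / T := by
    have hu' : u = (1 - 1 / (T:ℝ)) • ustar + (1 / (T:ℝ)) • v1 := by
      ext i
      have := congrFun (hue.symm.trans hup) i.castSucc
      rw [← hv1e] at this
      simpa [liftv_castSucc] using this
    rw [hu', dotp_add_left, dotp_smul_left, dotp_smul_left]
    have a1 := (abs_le.mp (hℓbound t ht ω _ hv1)).2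
    have a2 := (abs_le.mp (hℓbound t ht ω _ hustar)).1
    have a3 : 0 < 1 / (T:ℝ) := by positivity
    have a4 : 2 / (T:ℝ) = 2 * (1 / T) := by ring
    rw [a4]
    nlinarith
  rw [dotp_sub_left, e1]
  simp only [hX, huv]
  rw [e2]
  linarith
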